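/- arXiv:2308.14138 — 3 statements merged into one kernel-verified Lean document; each statement's English description precedes it below -/
import Mathlib

section
/- Let 0 ≤ s ≤ r be odd integers with r ≥ 2^t for a positive integer t, and let n ≥ 2 be an integer. Then, for the free S^1-action on ℝH_{r,s}, n(2^t + s − 1) − s + 2 ≤ TC_{S^1,n}(ℝH_{r,s}) ≤ n(s+r−1). In particular, if s = 1 and r = 2^t + 1, then n·2^t + 1 ≤ TC_{S^1,n}(ℝH_{r,1}) ≤ n(2^t + 1). -/
open scoped unitInterval

noncomputable section

/-- Topology on the projectivization, as a quotient of the nonzero vectors. -/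
instance projTop (K V : Type*) [DivisionRing K] [AddCommGroup V] [Module K V]
    [TopologicalSpace V] : TopologicalSpace (Projectivization K V) :=
  inferInstanceAs (TopologicalSpace (Quotient (projectivizationSetoid K V)))

/-- The real Milnor manifold `ℝH_{r,s}`, as the subspace of `ℝPʳ × ℝPˢ` of pairs
`([x], [y])` with `x₀y₀ + ⋯ + x_sy_s = 0` (for `s ≤ r`). -/
def RealMilnor (r s : ℕ) :
    Set (Projectivization ℝ (Fin (r + 1) → ℝ) × Projectivization ℝ (Fin (s + 1) → ℝ)) :=
  {p | ∑ i : Fin (min (s + 1) (r + 1)),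
      p.1.rep (Fin.castLE (min_le_right _ _) i) * p.2.rep (Fin.castLE (min_le_left _ _) i) = 0}

/-- The complex Milnor manifold `ℂH_{r,s}`, as the subspace of `ℂPʳ × ℂPˢ` of pairs
`([z], [w])` with `z₀w̄₀ + ⋯ + z_sw̄_s = 0` (for `s ≤ r`). -/
def ComplexMilnor (r s : ℕ) :
    Set (Projectivization ℂ (Fin (r + 1) → ℂ) × Projectivization ℂ (Fin (s + 1) → ℂ)) :=
  {p | ∑ i : Fin (min (s + 1) (r + 1)),
      p.1.rep (Fin.castLE (min_le_right _ _) i) *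
        (starRingEnd ℂ) (p.2.rep (Fin.castLE (min_le_left _ _) i)) = 0}

/-- The Lusternik–Schnirelmann category of `X`: the least number of open sets covering `X`,
each of whose inclusion into `X` is null-homotopic. -/
def lsCat (X : Type*) [TopologicalSpace X] : ℕ :=
  sInf {k | 0 < k ∧ ∃ U : Fin k → Set X,
    (∀ i, IsOpen (U i)) ∧ (⋃ i, U i) = Set.univ ∧
    ∀ i, ∃ x₀ : X, ∃ H : C(U i × I, X),
      (∀ u : U i, H (u, 0) = (u : X)) ∧ (∀ u : U i, H (u, 1) = x₀)}

/-- The fibration `π_n : X^I → X^n`, evaluating a path at the times `i/(n-1)`,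
`i = 0, …, n-1`. -/
def tcPi (X : Type*) [TopologicalSpace X] (n : ℕ) (γ : C(I, X)) : Fin n → X :=
  fun i => γ (Set.projIcc (0 : ℝ) 1 zero_le_one ((i : ℝ) / ((n : ℝ) - 1)))

/-- The `n`-th higher (sequential) topological complexity of `X`: the least number of open
sets covering `X^n`, each admitting a continuous local section of `π_n : X^I → X^n`. -/
def higherTC (X : Type*) [TopologicalSpace X] (n : ℕ) : ℕ :=
  sInf {k | 0 < k ∧ ∃ U : Fin k → Set (Fin n → X),
    (∀ i, IsOpen (U i)) ∧ (⋃ i, U i) = Set.univ ∧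
    ∀ i, ∃ sec : C(U i, C(I, X)), ∀ u : U i, tcPi X n (sec u) = (u : Fin n → X)}

/-- The `n`-th higher equivariant topological complexity of a `G`-space `X`:
the least number of `G`-invariant open sets covering `X^n` (with the diagonal action),
each admitting a `G`-equivariant map to `X^I` whose composite with `π_n` is
`G`-homotopic to the inclusion. -/
def eqHigherTC (G : Type*) [Group G] (X : Type*) [TopologicalSpace X] [MulAction G X]
    (n : ℕ) : ℕ :=
  sInf {k | 0 < k ∧ ∃ U : Fin k → Set (Fin n → X),
    (∀ i, IsOpen (U i)) ∧ (⋃ i, U i) = Set.univ ∧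
    (∀ i (g : G), ∀ v ∈ U i, g • v ∈ U i) ∧
    ∀ i, ∃ sec : C(U i, C(I, X)),
      (∀ (g : G) (v : U i) (hgv : g • (v : Fin n → X) ∈ U i) (t : I),
        (sec ⟨g • (v : Fin n → X), hgv⟩) t = g • (sec v) t) ∧
      ∃ H : C(U i × I, Fin n → X),
        (∀ v : U i, H (v, 0) = tcPi X n (sec v)) ∧
        (∀ v : U i, H (v, 1) = (v : Fin n → X)) ∧
        (∀ (g : G) (v : U i) (hgv : g • (v : Fin n → X) ∈ U i) (t : I),
          H (⟨g • (v : Fin n → X), hgv⟩, t) = g • H (v, t))}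

/-- `X` has covering dimension at most `m`: every finite open cover admits an open
refinement which still covers `X` and in which every point lies in at most `m + 1` sets. -/
def HasCovDimLE (X : Type*) [TopologicalSpace X] (m : ℕ) : Prop :=
  ∀ 𝒰 : Set (Set X), 𝒰.Finite → (∀ U ∈ 𝒰, IsOpen U) → ⋃₀ 𝒰 = Set.univ →
    ∃ 𝒱 : Set (Set X), (∀ V ∈ 𝒱, IsOpen V) ∧ ⋃₀ 𝒱 = Set.univ ∧
      (∀ V ∈ 𝒱, ∃ U ∈ 𝒰, V ⊆ U) ∧
      ∀ x : X, {V ∈ 𝒱 | x ∈ V}.encard ≤ (m + 1 : ℕ)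

/-- The covering dimension of `X`. -/
def covDim (X : Type*) [TopologicalSpace X] : ℕ :=
  sInf {m | HasCovDimLE X m}

end

set_option linter.unusedSectionVars false
set_option linter.unusedSimpArgs false

namespace MilnorAux

open scoped BigOperators

/-! ### Ordered chains modulo two -/

section Chains

variable {P : Type*}

/-- Chains: formal `ZMod 2`-combinations of lists of points. -/
abbrev Ch (P : Type*) := List P →₀ ZMod 2

noncomputable def single1 (l : List P) : Ch P := Finsupp.single l 1

noncomputable def cone (v : P) : Ch P →ₗ[ZMod 2] Ch P :=
  Finsupp.lmapDomain _ _ (List.cons v)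

noncomputable def bdL : List P → Ch P
  | [] => 0
  | v :: l => single1 l + cone v (bdL l)

noncomputable def bd : Ch P →ₗ[ZMod 2] Ch P := Finsupp.linearCombination (ZMod 2) bdL

noncomputable def push (f : P → P) : Ch P →ₗ[ZMod 2] Ch P :=
  Finsupp.lmapDomain _ _ (List.map f)

noncomputable def prL (a b : P → P) : List P → Ch P
  | [] => 0
  | v :: l => single1 (a v :: b v :: l.map b) + cone (a v) (prL a b l)

noncomputable def prism (a b : P → P) : Ch P →ₗ[ZMod 2] Ch P :=
  Finsupp.linearCombination (ZMod 2) (prL a b)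

@[simp] lemma cone_single1 (v : P) (l : List P) : cone v (single1 l) = single1 (v :: l) := by
  simp [cone, single1, Finsupp.lmapDomain_apply, Finsupp.mapDomain_single]

@[simp] lemma bd_single1 (l : List P) : bd (single1 l) = bdL l := by
  simp [bd, single1]

@[simp] lemma push_single1 (f : P → P) (l : List P) : push f (single1 l) = single1 (l.map f) := by
  simp [push, single1, Finsupp.lmapDomain_apply, Finsupp.mapDomain_single]

@[simp] lemma prism_single1 (a b : P → P) (l : List P) : prism a b (single1 l) = prL a b l := by
  simp [prism, single1]

lemma ch_add_self (c : Ch P) : c + c = 0 := by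
  ext l
  exact CharTwo.add_self_eq_zero _

lemma ch_neg (c : Ch P) : -c = c := neg_eq_of_add_eq_zero_left (ch_add_self c)

/-- Linear maps on chains agree if they agree on lists. -/
lemma ch_ext {M : Type*} [AddCommGroup M] [Module (ZMod 2) M] {f g : Ch P →ₗ[ZMod 2] M}
    (h : ∀ l, f (single1 l) = g (single1 l)) : f = g := by
  apply Finsupp.lhom_ext'
  intro l
  ext
  exact h l

lemma bd_cone (v : P) (c : Ch P) : bd (cone v c) = c + cone v (bd c) := by
  have : bd ∘ₗ cone v = LinearMap.id + cone v ∘ₗ bd := by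
    apply ch_ext
    intro l
    simp [bdL]
  exact LinearMap.congr_fun this c

lemma bd_bd (c : Ch P) : bd (bd c) = 0 := by
  have : bd ∘ₗ bd = (0 : Ch P →ₗ[ZMod 2] Ch P) := by
    apply ch_ext
    intro l
    simp only [LinearMap.comp_apply, bd_single1, LinearMap.zero_apply]
    induction l with
    | nil => simp [bdL]
    | cons v l ih =>
      simp only [bdL, map_add, bd_single1, bd_cone, ih, map_zero, add_zero]
      exact ch_add_self _
  exact LinearMap.congr_fun this c

lemma push_cone (f : P → P) (v : P) (c : Ch P) : push f (cone v c) = cone (f v) (push f c) := by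
  have : push f ∘ₗ cone v = cone (f v) ∘ₗ push f := by
    apply ch_ext
    intro l
    simp
  exact LinearMap.congr_fun this c

lemma bd_push (f : P → P) (c : Ch P) : bd (push f c) = push f (bd c) := by
  have : bd ∘ₗ push f = push f ∘ₗ bd := by
    apply ch_ext
    intro l
    simp only [LinearMap.comp_apply, push_single1, bd_single1]
    induction l with
    | nil => simp [bdL]
    | cons v l ih => simp [bdL, ih, push_cone]
  exact LinearMap.congr_fun this c

lemma prism_cone (a b : P → P) (v : P) (c : Ch P) :
    prism a b (cone v c) = cone (a v) (cone (b v) (push b c)) + cone (a v) (prism a b c) := by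
  have : prism a b ∘ₗ cone v
      = cone (a v) ∘ₗ cone (b v) ∘ₗ push b + cone (a v) ∘ₗ prism a b := by
    apply ch_ext
    intro l
    simp [prL]
  exact LinearMap.congr_fun this c

lemma bd_prism (a b : P → P) (c : Ch P) :
    bd (prism a b c) = push a c + push b c + prism a b (bd c) := by
  have : bd ∘ₗ prism a b = push a + push b + prism a b ∘ₗ bd := by
    apply ch_ext
    intro l
    simp only [LinearMap.comp_apply, LinearMap.add_apply, push_single1, bd_single1, prism_single1]
    induction l with
    | nil => simp [prL, bdL, ch_add_self]
    | cons v l ih =>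
      have e1 : bdL (l.map b) = push b (bdL l) := by
        rw [← bd_single1, ← push_single1, bd_push, bd_single1]
      simp only [prL, bdL, map_add, bd_single1, bd_cone, ih, cone_single1, prism_single1,
        prism_cone, List.map_cons, e1]
      have := ch_add_self (single1 (a v :: l.map b))
      generalize single1 (a v :: l.map b) = x at *
      rw [show ∀ p q r s t u : Ch P, (p + (x + q)) + (r + (s + x + t)) =
        s + p + (r + (q + t)) + (x + x) by intros; abel, this]
      · abel
      · exact 0
  exact LinearMap.congr_fun this c

lemma cone_supp {S S' : Set (List P)} {v : P} (h : ∀ l ∈ S, v :: l ∈ S') {c : Ch P}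
    (hc : c ∈ Finsupp.supported (ZMod 2) (ZMod 2) S) :
    cone v c ∈ Finsupp.supported (ZMod 2) (ZMod 2) S' := by
  rw [Finsupp.supported_eq_span_single] at hc
  induction hc using Submodule.span_induction with
  | mem x hx =>
    obtain ⟨l, hl, rfl⟩ := hx
    change cone v (single1 l) ∈ _
    rw [cone_single1]
    exact Finsupp.single_mem_supported _ _ (h l hl)
  | zero => simp
  | add x y _ _ hx hy => rw [map_add]; exact add_mem hx hy
  | smul a x _ hx => rw [map_smul]; exact Submodule.smul_mem _ _ hx

/-- A linear map preserves supports if it does so on lists. -/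
lemma lin_supp {S S' : Set (List P)} (F : Ch P →ₗ[ZMod 2] Ch P)
    (h : ∀ l ∈ S, F (single1 l) ∈ Finsupp.supported (ZMod 2) (ZMod 2) S') {c : Ch P}
    (hc : c ∈ Finsupp.supported (ZMod 2) (ZMod 2) S) :
    F c ∈ Finsupp.supported (ZMod 2) (ZMod 2) S' := by
  rw [Finsupp.supported_eq_span_single] at hc
  induction hc using Submodule.span_induction with
  | mem x hx =>
    obtain ⟨l, hl, rfl⟩ := hx
    exact h l hl
  | zero => simp
  | add x y _ _ hx hy => rw [map_add]; exact add_mem hx hy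
  | smul a x _ hx => rw [map_smul]; exact Submodule.smul_mem _ _ hx

lemma lin_eq_on {M : Type*} [AddCommGroup M] [Module (ZMod 2) M] {S : Set (List P)}
    (F F' : Ch P →ₗ[ZMod 2] M)
    (h : ∀ l ∈ S, F (single1 l) = F' (single1 l)) {c : Ch P}
    (hc : c ∈ Finsupp.supported (ZMod 2) (ZMod 2) S) : F c = F' c := by
  rw [Finsupp.supported_eq_span_single] at hc
  induction hc using Submodule.span_induction with
  | mem x hx =>
    obtain ⟨l, hl, rfl⟩ := hx
    exact h l hl
  | zero => simp
  | add x y _ _ hx hy => rw [map_add, map_add, hx, hy]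
  | smul a x _ hx => rw [map_smul, map_smul, hx]

/-- The entries of `prL a b l`: all lists of length one more, with entries of the form `a v`, `b v`. -/
lemma prL_supp (a b : P → P) (l : List P) : prL a b l ∈ Finsupp.supported (ZMod 2) (ZMod 2)
    {l' : List P | l'.length = l.length + 1 ∧ ∀ x ∈ l', ∃ v ∈ l, x = a v ∨ x = b v} := by
  induction l with
  | nil => simp [prL]
  | cons v l ih =>
    simp only [prL]
    refine add_mem (Finsupp.single_mem_supported _ _ ?_) (cone_supp ?_ ih)
    · refine ⟨by simp, ?_⟩
      intro x hx
      simp only [List.mem_cons, List.mem_map] at hx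
      rcases hx with rfl | rfl | ⟨w, hw, rfl⟩
      · exact ⟨v, by simp, Or.inl rfl⟩
      · exact ⟨v, by simp, Or.inr rfl⟩
      · exact ⟨w, by simp [hw], Or.inr rfl⟩
    · rintro l' ⟨h1, h2⟩
      refine ⟨by simp [h1], ?_⟩
      intro x hx
      rcases List.mem_cons.1 hx with rfl | hx
      · exact ⟨v, by simp, Or.inl rfl⟩
      · obtain ⟨w, hw, h⟩ := h2 x hx
        exact ⟨w, by simp [hw], h⟩

end Chains

/-! ### Cochains -/

section Cochains

variable {P : Type*}

/-- Evaluation of the cup product of the coboundaries of the functions in the list. -/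
def ev : List (P → ZMod 2) → List P → ZMod 2
  | [], [_] => 1
  | [], _ => 0
  | e :: es, v :: w :: l => (e v + e w) * ev es (w :: l)
  | _ :: _, _ => 0

noncomputable def evC (es : List (P → ZMod 2)) : Ch P →ₗ[ZMod 2] ZMod 2 :=
  Finsupp.linearCombination (ZMod 2) (ev es)

def mh (e : P → ZMod 2) (es : List (P → ZMod 2)) : List P → ZMod 2
  | [] => 0
  | v :: l => e v * ev es (v :: l)

noncomputable def mhC (e : P → ZMod 2) (es : List (P → ZMod 2)) : Ch P →ₗ[ZMod 2] ZMod 2 :=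
  Finsupp.linearCombination (ZMod 2) (mh e es)

@[simp] lemma evC_single1 (es : List (P → ZMod 2)) (l : List P) : evC es (single1 l) = ev es l := by
  simp [evC, single1]

@[simp] lemma mhC_single1 (e : P → ZMod 2) (es : List (P → ZMod 2)) (l : List P) :
    mhC e es (single1 l) = mh e es l := by
  simp [mhC, single1]

lemma ev_nil_right (es : List (P → ZMod 2)) : ev es [] = 0 := by
  cases es <;> rfl

lemma mhC_cone (e : P → ZMod 2) (es : List (P → ZMod 2)) (v : P) (c : Ch P) :
    mhC e es (cone v c) = e v * evC es (cone v c) := by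
  have : mhC e es ∘ₗ cone v = (e v) • (evC es ∘ₗ cone v) := by
    apply ch_ext
    intro l
    simp [mh]
  exact LinearMap.congr_fun this c

lemma leibniz (e : P → ZMod 2) (es : List (P → ZMod 2))
    (hco : ∀ c : Ch P, evC es (bd c) = 0) (c : Ch P) : mhC e es (bd c) = evC (e :: es) c := by
  have : mhC e es ∘ₗ bd = evC (e :: es) := by
    apply ch_ext
    intro l
    simp only [LinearMap.comp_apply, bd_single1, evC_single1]
    rcases l with _ | ⟨v, _ | ⟨w, l⟩⟩
    · simp [bdL, ev]
    · simp [bdL, ev, mh]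
    · have h := hco (single1 (v :: w :: l))
      rw [bd_single1] at h
      rw [bdL, map_add, evC_single1] at h
      rw [bdL, map_add, mhC_single1, mhC_cone]
      have h2 : evC es (cone v (bdL (w :: l))) = ev es (w :: l) := by
        have := eq_neg_of_add_eq_zero_right h
        rw [this, CharTwo.neg_eq]
      rw [h2]
      simp only [mh, ev]
      ring
  exact LinearMap.congr_fun this c

lemma evC_bd (es : List (P → ZMod 2)) (c : Ch P) : evC es (bd c) = 0 := by
  induction es generalizing c with
  | nil =>
    have : evC [] ∘ₗ bd = (0 : Ch P →ₗ[ZMod 2] ZMod 2) := by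
      apply ch_ext
      intro l
      simp only [LinearMap.comp_apply, bd_single1, LinearMap.zero_apply]
      have key : ∀ (v w : P) (c : Ch P), evC [] (cone v (cone w c)) = 0 := by
        intro v w c
        have : (evC [] ∘ₗ cone v) ∘ₗ cone w = 0 := by
          apply ch_ext
          intro l
          simp [ev]
        exact LinearMap.congr_fun this c
      rcases l with _ | ⟨v, _ | ⟨w, l⟩⟩
      · simp [bdL]
      · simp [bdL, ev]
      · simp only [bdL, map_add, evC_single1, cone_single1, key]
        rcases l with _ | ⟨x, l⟩
        · simp [ev]; decide
        · simp [ev]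
    exact LinearMap.congr_fun this c
  | cons e es ih =>
    rw [← leibniz e es ih, bd_bd, map_zero]

/-- Invariance of the evaluation under a symmetry. -/
lemma ev_map (T : P → P) (S : Set P) (es : List (P → ZMod 2))
    (h : ∀ e ∈ es, ∃ a : ZMod 2, ∀ v ∈ S, e (T v) = e v + a) (l : List P) (hl : ∀ x ∈ l, x ∈ S) :
    ev es (l.map T) = ev es l := by
  induction es generalizing l with
  | nil => rcases l with _ | ⟨v, _ | ⟨w, l⟩⟩ <;> simp [ev]
  | cons e es ih =>
    rcases l with _ | ⟨v, _ | ⟨w, l⟩⟩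
    · simp
    · simp [ev]
    · obtain ⟨a, ha⟩ := h e (by simp)
      have := ih (fun e he => h e (by simp [he])) (w :: l) (fun x hx => hl x (by simp at hx ⊢; tauto))
      simp only [List.map_cons] at this
      simp only [List.map_cons, ev, this, ha v (hl v (by simp)), ha w (hl w (by simp))]
      have h2 : a + a = 0 := CharTwo.add_self_eq_zero a
      linear_combination ev es (w :: l) * h2

lemma ev_length (es : List (P → ZMod 2)) (l : List P) (h : ev es l ≠ 0) :
    l.length = es.length + 1 := by
  induction es generalizing l with
  | nil => rcases l with _ | ⟨v, _ | ⟨w, l⟩⟩ <;> simp [ev] at h ⊢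
  | cons e es ih =>
    rcases l with _ | ⟨v, _ | ⟨w, l⟩⟩
    · simp [ev] at h
    · simp [ev] at h
    · have := ih (w :: l) (right_ne_zero_of_mul h)
      simp at this ⊢
      omega

/-- If the evaluation is nonzero then every function changes value along the list. -/
lemma ev_ne (es : List (P → ZMod 2)) (l : List P) (h : ev es l ≠ 0) :
    ∀ e ∈ es, ∃ v ∈ l, ∃ w ∈ l, e v ≠ e w := by
  induction es generalizing l with
  | nil => simp
  | cons e es ih =>
    rcases l with _ | ⟨v, _ | ⟨w, l⟩⟩
    · simp [ev] at h
    · simp [ev] at h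
    · intro e' he'
      rcases List.mem_cons.1 he' with rfl | he'
      · refine ⟨v, by simp, w, by simp, ?_⟩
        intro hvw
        apply left_ne_zero_of_mul h
        rw [hvw]
        exact CharTwo.add_self_eq_zero _
      · obtain ⟨a, ha, b, hb, hab⟩ := ih (w :: l) (right_ne_zero_of_mul h) e' he'
        exact ⟨a, List.mem_cons_of_mem _ ha, b, List.mem_cons_of_mem _ hb, hab⟩

end Cochains

end MilnorAux

set_option linter.unusedSectionVars false
set_option linter.unusedSimpArgs false

namespace MilnorAux

open scoped BigOperators
open Set

section Fill

variable {P : Type*} [MetricSpace P]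

/-- Lists of length `q` in `D` of mesh less than `δ`. -/
def small (D : Set P) (δ : ℝ) (q : ℕ) : Set (List P) :=
  {l | l.length = q ∧ (∀ x ∈ l, x ∈ D) ∧ ∀ x ∈ l, ∀ y ∈ l, dist x y < δ}

/-- Chains supported on small lists. -/
abbrev SC (D : Set P) (δ : ℝ) (q : ℕ) : Submodule (ZMod 2) (Ch P) :=
  Finsupp.supported (ZMod 2) (ZMod 2) (small D δ q)

lemma small_mono {D D' : Set P} {δ δ' : ℝ} (hD : D ⊆ D') (hδ : δ ≤ δ') (q : ℕ) :
    small D δ q ⊆ small D' δ' q := fun _ h =>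
  ⟨h.1, fun x hx => hD (h.2.1 x hx), fun x hx y hy => (h.2.2 x hx y hy).trans_le hδ⟩

lemma SC_mono {D D' : Set P} {δ δ' : ℝ} (hD : D ⊆ D') (hδ : δ ≤ δ') (q : ℕ) :
    SC D δ q ≤ SC D' δ' q := Finsupp.supported_mono (small_mono hD hδ q)

lemma fill (D : Set P) (hD : IsCompact D) (H : ℝ → P → P)
    (hH : ContinuousOn (fun q : ℝ × P => H q.1 q.2) (Icc 0 1 ×ˢ D))
    (hmap : ∀ t ∈ Icc (0 : ℝ) 1, ∀ u ∈ D, H t u ∈ D)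
    (h0 : ∀ u ∈ D, H 0 u = u) (p : P) (hp : p ∈ D) (h1 : ∀ u ∈ D, H 1 u = p)
    {δ : ℝ} (hδ : 0 < δ) :
    ∃ δ' > 0, ∀ q, ∀ w ∈ SC D δ' q, bd w = 0 → ∃ c ∈ SC D δ (q + 1), bd c = w := by
  have hu := (isCompact_Icc.prod hD).uniformContinuousOn_of_continuous hH
  rw [Metric.uniformContinuousOn_iff] at hu
  obtain ⟨η, hη, hu⟩ := hu δ hδ
  obtain ⟨J, hJ⟩ := exists_nat_one_div_lt hη
  refine ⟨η, hη, ?_⟩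
  intro q w hw hbw
  let a : ℕ → P → P := fun l => H ((l : ℝ) / ((J : ℝ) + 1))
  have hJ1 : (0 : ℝ) < (J : ℝ) + 1 := by positivity
  have ht : ∀ l : ℕ, l ≤ J + 1 → (l : ℝ) / ((J : ℝ) + 1) ∈ Icc (0 : ℝ) 1 := by
    intro l hl
    refine ⟨by positivity, ?_⟩
    rw [div_le_one hJ1]
    exact_mod_cast hl
  have hclose : ∀ l l' : ℕ, l ≤ J + 1 → l' ≤ J + 1 → l' ≤ l + 1 → l ≤ l' + 1 →
      ∀ u ∈ D, ∀ v ∈ D, dist u v < η → dist (a l u) (a l' v) < δ := by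
    intro l l' hl hl' h12 h21 u hu' v hv huv
    refine hu ((l : ℝ) / ((J : ℝ) + 1), u) ⟨ht l hl, hu'⟩ ((l' : ℝ) / ((J : ℝ) + 1), v)
      ⟨ht l' hl', hv⟩ ?_
    rw [Prod.dist_eq, max_lt_iff]
    refine ⟨?_, huv⟩
    refine lt_of_le_of_lt ?_ hJ
    rw [Real.dist_eq, ← sub_div, abs_div, abs_of_pos hJ1]
    apply div_le_div_of_nonneg_right _ hJ1.le
    rw [abs_le]
    have e1 : (l' : ℝ) ≤ l + 1 := by exact_mod_cast h12
    have e2 : (l : ℝ) ≤ l' + 1 := by exact_mod_cast h21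
    constructor <;> linarith
  refine ⟨∑ l ∈ Finset.range (J + 1), prism (a l) (a (l + 1)) w + cone p (push (a (J + 1)) w),
    ?_, ?_⟩
  · refine add_mem (Submodule.sum_mem _ ?_) ?_
    · intro l hl
      rw [Finset.mem_range] at hl
      refine lin_supp _ ?_ hw
      rintro x ⟨hx1, hx2, hx3⟩
      rw [prism_single1]
      refine Finsupp.supported_mono ?_ (prL_supp _ _ x)
      rintro y ⟨hy1, hy2⟩
      refine ⟨by rw [hy1, hx1], ?_, ?_⟩
      · intro z hz
        obtain ⟨v, hv, rfl | rfl⟩ := hy2 z hz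
        · exact hmap _ (ht l (by omega)) _ (hx2 v hv)
        · exact hmap _ (ht (l + 1) (by omega)) _ (hx2 v hv)
      · intro z hz z' hz'
        obtain ⟨v, hv, rfl | rfl⟩ := hy2 z hz <;> obtain ⟨v', hv', rfl | rfl⟩ := hy2 z' hz' <;>
        exact hclose _ _ (by omega) (by omega) (by omega) (by omega) _ (hx2 v hv) _ (hx2 v' hv')
          (hx3 v hv v' hv')
    · have e : a (J + 1) = H 1 := by
        simp only [a]
        congr 1
        push_cast
        exact div_self hJ1.ne'
      have : push (a (J + 1)) w ∈ Finsupp.supported (ZMod 2) (ZMod 2)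
          {l : List P | l.length = q ∧ ∀ x ∈ l, x = p} := by
        refine lin_supp _ ?_ hw
        rintro x ⟨hx1, hx2, hx3⟩
        rw [push_single1]
        refine Finsupp.single_mem_supported _ _ ⟨by simpa using hx1, ?_⟩
        intro y hy
        obtain ⟨v, hv, rfl⟩ := List.mem_map.1 hy
        rw [e]
        exact h1 v (hx2 v hv)
      refine cone_supp ?_ this
      rintro l ⟨hl1, hl2⟩
      have : ∀ x ∈ p :: l, x = p := by
        intro x hx
        rcases List.mem_cons.1 hx with h | h
        · exact h
        · exact hl2 x h
      refine ⟨by simp [hl1], fun x hx => by rw [this x hx]; exact hp, ?_⟩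
      intro x hx y hy
      rw [this x hx, this y hy, dist_self]
      exact hδ
  · have h00 : push (a 0) w = w := by
      conv_rhs => rw [← LinearMap.id_apply (R := ZMod 2) w]
      refine lin_eq_on _ _ ?_ hw
      rintro l ⟨_, hl, _⟩
      rw [push_single1, LinearMap.id_apply]
      congr 1
      rw [List.map_congr_left (g := id), List.map_id]
      intro x hx
      simp only [a, Nat.cast_zero, zero_div, id]
      exact h0 x (hl x hx)
    have tel : ∀ L : ℕ, ∑ l ∈ Finset.range L, (push (a l) w + push (a (l + 1)) w)
        = push (a 0) w + push (a L) w := by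
      intro L
      induction L with
      | zero => simp [ch_add_self]
      | succ L ih =>
        rw [Finset.sum_range_succ, ih]
        have := ch_add_self (push (a L) w)
        rw [show ∀ x y z : Ch P, x + y + (y + z) = x + z + (y + y) by intros; abel, this, add_zero]
    rw [map_add, map_sum, bd_cone, bd_push, hbw, map_zero, map_zero, add_zero]
    simp only [bd_prism, hbw, map_zero, add_zero]
    rw [tel, h00, add_assoc, ch_add_self, add_zero]

end Fill

end MilnorAux

set_option linter.unusedSectionVars false
set_option linter.unusedSimpArgs false

namespace MilnorAux

open scoped BigOperators
open Set

section Spheres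

variable {ι : Type*} [Fintype ι] [DecidableEq ι] {M : ℕ}

/-- The ambient space of the product of spheres. -/
abbrev PP (ι : Type*) (M : ℕ) := ι → EuclideanSpace ℝ (Fin M)

/-- The product of spheres. -/
def SS (k : ι →₀ ℕ) : Set (PP ι M) :=
  {u | ∀ i, ‖u i‖ = 1 ∧ ∀ j : Fin M, k i < j → u i j = 0}

/-- The product of hemispheres. -/
def DD (k : ι →₀ ℕ) : Set (PP ι M) :=
  {u | u ∈ SS k ∧ ∀ i, ∀ j : Fin M, (j : ℕ) = k i → 0 ≤ u i j}

/-- Antipode in the `i`-th factor. -/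
def TT (i : ι) (u : PP ι M) : PP ι M := Function.update u i (-u i)

lemma TT_TT (i : ι) (u : PP ι M) : TT i (TT i u) = u := by
  ext j : 1
  by_cases h : j = i
  · subst h; simp [TT]
  · simp [TT, h]

lemma TT_comm (i j : ι) (u : PP ι M) : TT i (TT j u) = TT j (TT i u) := by
  by_cases h : i = j
  · subst h; rfl
  · ext l : 1
    by_cases h1 : l = i
    · subst h1; simp [TT, h]
    · by_cases h2 : l = j
      · subst h2; simp [TT, h1]
      · simp [TT, h1, h2]

lemma TT_mem_SS {k : ι →₀ ℕ} {i : ι} {u : PP ι M} (hu : u ∈ SS k) : TT i u ∈ SS k := by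
  intro j
  by_cases h : j = i
  · subst h
    refine ⟨by simpa [TT] using (hu j).1, ?_⟩
    intro l hl
    simp [TT, (hu j).2 l hl]
  · simpa [TT, h] using hu j

lemma dist_TT (i : ι) (u v : PP ι M) : dist (TT i u) (TT i v) = dist u v := by
  have : ∀ j, dist (TT i u j) (TT i v j) = dist (u j) (v j) := by
    intro j
    by_cases h : j = i
    · subst h; simp [TT, dist_neg_neg]
    · simp [TT, h]
  apply le_antisymm
  · rw [dist_pi_le_iff dist_nonneg]
    intro j; rw [this]; exact dist_le_pi_dist u v j
  · rw [dist_pi_le_iff dist_nonneg]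
    intro j; rw [← this]; exact dist_le_pi_dist _ _ j

lemma SS_mono {k k' : ι →₀ ℕ} (h : k ≤ k') : (SS k : Set (PP ι M)) ⊆ SS k' := by
  intro u hu i
  exact ⟨(hu i).1, fun j hj => (hu i).2 j ((h i).trans_lt hj)⟩

lemma SS_compact (k : ι →₀ ℕ) : IsCompact (SS k : Set (PP ι M)) := by
  apply Metric.isCompact_of_isClosed_isBounded
  · have : (SS k : Set (PP ι M)) = ⋂ i, ({u | ‖u i‖ = 1} ∩ ⋂ j : Fin M, {u | k i < j → u i j = 0}) := by
      ext u; simp [SS]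
    rw [this]
    refine isClosed_iInter fun i => ?_
    refine IsClosed.inter (isClosed_eq (by fun_prop) continuous_const) (isClosed_iInter fun j => ?_)
    by_cases h : k i < j
    · simp only [h, true_imp_iff]
      exact isClosed_eq (by fun_prop) continuous_const
    · simp [h]
  · refine (Metric.isBounded_closedBall (x := (0 : PP ι M)) (r := 1)).subset ?_
    intro u hu
    rw [mem_closedBall_zero_iff, pi_norm_le_iff_of_nonneg zero_le_one]
    intro i
    exact (hu i).1.le

lemma DD_compact (k : ι →₀ ℕ) : IsCompact (DD k : Set (PP ι M)) := by
  have : (DD k : Set (PP ι M)) = SS k ∩ ⋂ i, ⋂ j : Fin M, {u | (j : ℕ) = k i → 0 ≤ u i j} := by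
    ext u; simp [DD]
  rw [this]
  refine (SS_compact k).inter_right (isClosed_iInter fun i => isClosed_iInter fun j => ?_)
  by_cases h : (j : ℕ) = k i
  · simp only [h, true_imp_iff]
    exact isClosed_le continuous_const (by fun_prop)
  · simp [h]

/-- The pole vector. -/
noncomputable def pole (M k : ℕ) : EuclideanSpace ℝ (Fin M) :=
  WithLp.toLp 2 (fun j => if (j : ℕ) = k then 1 else 0)

lemma pole_norm {k : ℕ} (h : k < M) : ‖pole M k‖ = 1 := by
  have : pole M k = EuclideanSpace.single ⟨k, h⟩ 1 := by
    ext j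
    simp [pole, Fin.ext_iff, Pi.single_apply]
  rw [this]
  simp

/-- The contraction of the product of hemispheres. -/
noncomputable def HH (k : ι →₀ ℕ) (t : ℝ) (u : PP ι M) : PP ι M := fun i =>
  ‖(1 - t) • u i + t • pole M (k i)‖⁻¹ • ((1 - t) • u i + t • pole M (k i))

lemma HH_ne {k : ι →₀ ℕ} (hk : ∀ i, k i < M) {t : ℝ} (ht : t ∈ Icc (0 : ℝ) 1) {u : PP ι M}
    (hu : u ∈ DD k) (i : ι) : (1 - t) • u i + t • pole M (k i) ≠ 0 := by
  intro h
  have h1 := congrArg (fun x : EuclideanSpace ℝ (Fin M) => x ⟨k i, hk i⟩) h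
  simp [pole] at h1
  have h2 := hu.2 i ⟨k i, hk i⟩ rfl
  have h3 : t = 0 := by
    have : 0 ≤ (1 - t) * (u i) ⟨k i, hk i⟩ := mul_nonneg (by linarith [ht.2]) h2
    linarith [ht.1]
  subst h3
  simp at h
  have := (hu.1 i).1
  rw [h] at this
  simp at this

lemma HH_mem {k : ι →₀ ℕ} (hk : ∀ i, k i < M) {t : ℝ} (ht : t ∈ Icc (0 : ℝ) 1) {u : PP ι M}
    (hu : u ∈ DD k) : HH k t u ∈ DD k := by
  refine ⟨fun i => ⟨?_, ?_⟩, ?_⟩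
  · have := HH_ne hk ht hu i
    rw [HH, norm_smul, norm_inv, norm_norm, inv_mul_cancel₀]
    rwa [norm_ne_zero_iff]
  · intro j hj
    have h1 := (hu.1 i).2 j hj
    simp [HH, h1, pole, hj.ne']
  · intro i j hj
    have h1 := hu.2 i j hj
    simp only [HH, PiLp.smul_apply, PiLp.add_apply, smul_eq_mul, pole, hj, if_true]
    have := ht.1
    have := ht.2
    have : 0 ≤ 1 - t := by linarith
    positivity

lemma fill_DD {k : ι →₀ ℕ} (hk : ∀ i, k i < M) {δ : ℝ} (hδ : 0 < δ) :
    ∃ δ' > 0, ∀ q, ∀ w ∈ SC (DD k : Set (PP ι M)) δ' q, bd w = 0 →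
      ∃ c ∈ SC (DD k : Set (PP ι M)) δ (q + 1), bd c = w := by
  have hpole : (fun i => pole M (k i)) ∈ (DD k : Set (PP ι M)) := by
    refine ⟨fun i => ⟨pole_norm (hk i), fun j hj => ?_⟩, fun i j hj => ?_⟩
    · simp [pole, hj.ne']
    · simp [pole, hj]
  refine fill (DD k) (DD_compact k) (HH k) ?_ (fun t ht u hu => HH_mem hk ht hu) ?_
    (fun i => pole M (k i)) hpole ?_ hδ
  · rw [continuousOn_pi]
    intro i
    unfold HH
    apply ContinuousOn.fun_smul
    · apply ContinuousOn.fun_inv₀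
      · fun_prop
      · rintro ⟨t, u⟩ ⟨ht, hu⟩
        rw [norm_ne_zero_iff]
        exact HH_ne hk ht hu i
    · fun_prop
  · intro u hu
    ext i : 1
    simp [HH, (hu.1 i).1]
  · intro u hu
    ext i : 1
    simp [HH, pole_norm (hk i)]

/-- The boundary condition for the fundamental chains. -/
noncomputable def bdSum (h : (ι →₀ ℕ) → Ch (PP ι M)) (k : ι →₀ ℕ) : Ch (PP ι M) :=
  ∑ i ∈ k.support, (h (k - Finsupp.single i 1) + push (TT i) (h (k - Finsupp.single i 1)))

lemma deg_sub {k : ι →₀ ℕ} {i : ι} (hi : i ∈ k.support) :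
    (k - Finsupp.single i 1).degree + 1 = k.degree := by
  have h1 : Finsupp.single i 1 ≤ k := by
    rw [Finsupp.single_le_iff]
    have := Finsupp.mem_support_iff.1 hi
    omega
  have h2 := congrArg Finsupp.degree (tsub_add_cancel_of_le h1)
  rw [map_add] at h2
  simpa using h2

lemma push_TT_TT (i j : ι) (c : Ch (PP ι M)) :
    push (TT i) (push (TT j) c) = push (TT j) (push (TT i) c) := by
  have : push (TT i) ∘ₗ push (TT j) = push (TT j) ∘ₗ (push (TT i) : Ch (PP ι M) →ₗ[ZMod 2] _) := by
    apply ch_ext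
    intro l
    simp [Function.comp_def, TT_comm i j]
  exact LinearMap.congr_fun this c

lemma push_TT_self (i : ι) (c : Ch (PP ι M)) : push (TT i) (push (TT i) c) = c := by
  have : push (TT i) ∘ₗ push (TT i) = (LinearMap.id : Ch (PP ι M) →ₗ[ZMod 2] _) := by
    apply ch_ext
    intro l
    simp [Function.comp_def, TT_TT]
  exact LinearMap.congr_fun this c

/-- The boundary of the boundary sum vanishes. -/
lemma bd_bdSum (h : (ι →₀ ℕ) → Ch (PP ι M)) (k : ι →₀ ℕ)
    (hh : ∀ i ∈ k.support, bd (h (k - Finsupp.single i 1)) = bdSum h (k - Finsupp.single i 1)) :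
    bd (bdSum h k) = 0 := by
  have e1 : bd (bdSum h k) = ∑ i ∈ k.support, (bdSum h (k - Finsupp.single i 1)
      + push (TT i) (bdSum h (k - Finsupp.single i 1))) := by
    rw [bdSum, map_sum]
    apply Finset.sum_congr rfl
    intro i hi
    rw [map_add, bd_push, hh i hi]
  rw [e1]
  -- the summand indexed by a pair
  let g : ι → ι → Ch (PP ι M) := fun i j =>
    (h (k - Finsupp.single i 1 - Finsupp.single j 1)
      + push (TT j) (h (k - Finsupp.single i 1 - Finsupp.single j 1)))
    + push (TT i) (h (k - Finsupp.single i 1 - Finsupp.single j 1)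
      + push (TT j) (h (k - Finsupp.single i 1 - Finsupp.single j 1)))
  have e2 : ∑ i ∈ k.support, (bdSum h (k - Finsupp.single i 1)
      + push (TT i) (bdSum h (k - Finsupp.single i 1)))
      = ∑ x ∈ k.support.sigma (fun i => (k - Finsupp.single i 1).support), g x.1 x.2 := by
    rw [Finset.sum_sigma]
    apply Finset.sum_congr rfl
    intro i _
    rw [bdSum, map_sum, ← Finset.sum_add_distrib]
  rw [e2]
  refine Finset.sum_involution (fun x _ => ⟨x.2, x.1⟩) ?_ ?_ ?_ ?_
  · rintro ⟨i, j⟩ hx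
    have : g j i = g i j := by
      simp only [g, map_add]
      rw [tsub_right_comm, push_TT_TT]
      abel
    simp only [this]
    exact ch_add_self _
  · rintro ⟨i, j⟩ hx hne heq
    apply hne
    simp only [Sigma.mk.injEq, heq_eq_eq] at heq
    obtain ⟨rfl, _⟩ := heq
    simp only [g, map_add, push_TT_self]
    rw [add_comm (push _ _)]
    exact ch_add_self _
  · rintro ⟨i, j⟩ hx
    simp only [Finset.mem_sigma, Finsupp.mem_support_iff, Finsupp.coe_tsub, Pi.sub_apply,
      Finsupp.single_apply] at hx ⊢
    rcases eq_or_ne i j with rfl | hij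
    · simpa using hx
    · simp only [hij, hij.symm, if_false] at hx ⊢
      omega
  · rintro ⟨i, j⟩ hx
    rfl

/-- Existence of the fundamental chains. -/
lemma exists_chains (m : ι →₀ ℕ) (hm : ∀ i, m i < M) (d : ℕ) : ∀ δ > (0 : ℝ),
    ∃ h : (ι →₀ ℕ) → Ch (PP ι M), (∃ p, h 0 = single1 [p]) ∧
      ∀ k ≤ m, k.degree ≤ d → h k ∈ SC (DD k) δ (k.degree + 1) ∧
        (k ≠ 0 → bd (h k) = bdSum h k) := by
  induction d with
  | zero =>
    intro δ hδ
    have hp : (fun i => pole M ((0 : ι →₀ ℕ) i)) ∈ (DD (0 : ι →₀ ℕ) : Set (PP ι M)) := by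
      refine ⟨fun i => ⟨pole_norm ((Nat.zero_le _).trans_lt (hm i)), fun j hj => ?_⟩, fun i j hj => ?_⟩
      · have hj' : 0 < (j : ℕ) := hj
        simp [pole]
        omega
      · simp [pole, hj]
    refine ⟨fun _ => single1 [fun i => pole M ((0 : ι →₀ ℕ) i)], ⟨_, rfl⟩, ?_⟩
    intro k _ hk0
    have : k = 0 := by
      rw [← Finsupp.degree_eq_zero_iff]; omega
    subst this
    refine ⟨Finsupp.single_mem_supported _ _ ⟨by simp, ?_, ?_⟩, fun h => absurd rfl h⟩
    · intro x hx
      rw [List.mem_singleton] at hx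
      rw [hx]; exact hp
    · intro x hx y hy
      rw [List.mem_singleton] at hx hy
      rw [hx, hy, dist_self]; exact hδ
  | succ d ih =>
    intro δ hδ
    have hfin : (Set.Iic m).Finite := Set.finite_Iic m
    have hev : ∀ k ∈ Set.Iic m, ∀ᶠ δ' in nhdsWithin (0 : ℝ) (Set.Ioi 0),
        ∀ q, ∀ w ∈ SC (DD k : Set (PP ι M)) δ' q, bd w = 0 →
          ∃ c ∈ SC (DD k : Set (PP ι M)) δ (q + 1), bd c = w := by
      intro k hk
      obtain ⟨δ₁, hδ₁, H⟩ := fill_DD (M := M) (k := k) (fun i => (hk i).trans_lt (hm i)) hδ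
      filter_upwards [Ioo_mem_nhdsGT hδ₁] with x hx q w hw
      exact H q w (SC_mono subset_rfl hx.2.le q hw)
    have hev2 := (hfin.eventually_all).2 hev
    obtain ⟨δ', ⟨hδ'1, hδ'0, hδ'2⟩⟩ := (hev2.and (Ioo_mem_nhdsGT hδ)).exists
    obtain ⟨h, ⟨p, hp⟩, hh⟩ := ih δ' hδ'0
    have hcyc : ∀ k ≤ m, k.degree = d + 1 → bdSum h k ∈ SC (DD k) δ' (d + 1) ∧ bd (bdSum h k) = 0 := by
      intro k hk hkd
      have hsub : ∀ i ∈ k.support, k - Finsupp.single i 1 ≤ m ∧ (k - Finsupp.single i 1).degree = d := by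
        intro i hi
        have := deg_sub hi
        exact ⟨tsub_le_self.trans hk, by omega⟩
      constructor
      · refine Submodule.sum_mem _ fun i hi => ?_
        obtain ⟨h1, h2⟩ := hsub i hi
        have h3 := (hh _ h1 h2.le).1
        rw [h2] at h3
        have hpos : 0 < k i := Nat.pos_of_ne_zero (Finsupp.mem_support_iff.1 hi)
        have hin : ∀ u ∈ (SS (k - Finsupp.single i 1) : Set (PP ι M)),
            (∀ j, j ≠ i → ∀ l : Fin M, (l : ℕ) = k j → 0 ≤ u j l) → u ∈ DD k := by
          intro u hu hu2
          refine ⟨SS_mono tsub_le_self hu, ?_⟩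
          intro j l hl
          by_cases hji : j = i
          · subst hji
            rw [(hu j).2 l (by simp [hl]; omega)]
          · exact hu2 j hji l hl
        have hin2 : ∀ u ∈ (DD (k - Finsupp.single i 1) : Set (PP ι M)), ∀ j, j ≠ i →
            ∀ l : Fin M, (l : ℕ) = k j → 0 ≤ u j l := by
          intro u hu j hj l hl
          apply hu.2 j l
          simp [hl, Finsupp.single_apply, hj.symm]
        refine add_mem ?_ (lin_supp _ ?_ h3)
        · refine SC_mono ?_ le_rfl _ h3
          intro u hu
          exact hin u hu.1 (hin2 u hu)
        · rintro l ⟨hl1, hl2, hl3⟩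
          rw [push_single1]
          refine Finsupp.single_mem_supported _ _ ⟨by simpa using hl1, ?_, ?_⟩
          · intro x hx
            obtain ⟨v, hv, rfl⟩ := List.mem_map.1 hx
            have hvD := hl2 v hv
            refine hin _ (TT_mem_SS hvD.1) ?_
            intro j hj
            simpa [TT, hj] using hin2 v hvD j hj
          · intro x hx y hy
            obtain ⟨v, hv, rfl⟩ := List.mem_map.1 hx
            obtain ⟨w, hw, rfl⟩ := List.mem_map.1 hy
            rw [dist_TT]
            exact hl3 v hv w hw
      · rcases Nat.eq_zero_or_pos d with hd0 | hdpos
        · -- degree one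
          rw [bdSum, map_sum]
          apply Finset.sum_eq_zero
          intro i hi
          have h2 := (hsub i hi).2
          have h0 : k - Finsupp.single i 1 = 0 := by
            rw [← Finsupp.degree_eq_zero_iff]; omega
          rw [h0, hp]
          simp [bdL, ch_add_self]
        · apply bd_bdSum
          intro i hi
          obtain ⟨h1, h2⟩ := hsub i hi
          refine (hh _ h1 h2.le).2 ?_
          intro h0
          rw [h0] at h2
          simp at h2
          omega
    have hex : ∀ k, ∃ c : Ch (PP ι M), k ≤ m → k.degree = d + 1 →
        c ∈ SC (DD k) δ (k.degree + 1) ∧ bd c = bdSum h k := by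
      intro k
      by_cases hk : k ≤ m ∧ k.degree = d + 1
      · obtain ⟨h1, h2⟩ := hcyc k hk.1 hk.2
        obtain ⟨c, hc1, hc2⟩ := hδ'1 k hk.1 _ _ h1 h2
        refine ⟨c, fun _ _ => ⟨?_, hc2⟩⟩
        rw [hk.2]; exact hc1
      · exact ⟨0, fun h1 h2 => absurd ⟨h1, h2⟩ hk⟩
    choose f hf using hex
    have hbs : ∀ k : ι →₀ ℕ, k.degree ≤ d + 1 →
        bdSum (fun k => if k.degree ≤ d then h k else f k) k = bdSum h k := by
      intro k hk
      apply Finset.sum_congr rfl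
      intro i hi
      have := deg_sub hi
      beta_reduce
      rw [if_pos (by omega)]
    refine ⟨fun k => if k.degree ≤ d then h k else f k, ⟨p, by simp [hp]⟩, ?_⟩
    intro k hk hkd
    rw [hbs k hkd]
    by_cases hd : k.degree ≤ d
    · simp only [hd, if_true]
      obtain ⟨h1, h2⟩ := hh k hk hd
      exact ⟨SC_mono subset_rfl hδ'2.le _ h1, h2⟩
    · simp only [hd, if_false]
      obtain ⟨h1, h2⟩ := hf k hk (by omega)
      exact ⟨h1, fun _ => h2⟩

end Spheres

end MilnorAux

set_option linter.unusedSectionVars false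
set_option linter.unusedSimpArgs false

namespace MilnorAux

open scoped BigOperators
open Set

section BU

variable {ι : Type*} [Fintype ι] [DecidableEq ι] {M : ℕ}

/-- Linear form attached to a character. -/
noncomputable def lin (χ : ι → ZMod 2) : MvPolynomial ι (ZMod 2) :=
  ∑ i, MvPolynomial.C (χ i) * MvPolynomial.X i

lemma coeff_lin_mul (χ : ι → ZMod 2) (k : ι →₀ ℕ) (p : MvPolynomial ι (ZMod 2)) :
    MvPolynomial.coeff k (lin χ * p) =
      ∑ i ∈ k.support, χ i * MvPolynomial.coeff (k - Finsupp.single i 1) p := by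
  rw [lin, Finset.sum_mul, MvPolynomial.coeff_sum]
  simp only [mul_assoc, MvPolynomial.coeff_C_mul, MvPolynomial.coeff_X_mul']
  rw [← Finset.sum_subset (Finset.subset_univ k.support)]
  · apply Finset.sum_congr rfl
    intro i hi
    rw [if_pos hi]
  · intro i _ hi
    rw [if_neg hi, mul_zero]

lemma mhC_TT {k : ι →₀ ℕ} {m : ι →₀ ℕ} (hk : k ≤ m) (i : ι) (e : PP ι M → ZMod 2) (a : ZMod 2)
    (es : List (PP ι M → ZMod 2))
    (he : ∀ u ∈ SS m, e (TT i u) = e u + a)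
    (hes : ∀ e ∈ es, ∃ a : ZMod 2, ∀ v ∈ SS m, e (TT i v) = e v + a)
    {δ : ℝ} {q : ℕ} {c : Ch (PP ι M)} (hc : c ∈ SC (DD k) δ q) :
    mhC e es (c + push (TT i) c) = a * evC es c := by
  have : (mhC e es + mhC e es ∘ₗ push (TT i)) c = (a • evC es) c := by
    refine lin_eq_on _ _ ?_ hc
    rintro l ⟨_, hl, _⟩
    have hl' : ∀ x ∈ l, x ∈ SS m := fun x hx => SS_mono hk (hl x hx).1
    simp only [LinearMap.add_apply, LinearMap.comp_apply, push_single1, mhC_single1,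
      LinearMap.smul_apply, evC_single1, smul_eq_mul]
    rcases l with _ | ⟨v, l⟩
    · simp [mh, ev_nil_right]
    · have h1 := ev_map (TT i) (SS m) es hes (v :: l) hl'
      simp only [List.map_cons] at h1
      simp only [List.map_cons, mh, h1, he v (hl' v (by simp))]
      have h2 : e v + e v = 0 := CharTwo.add_self_eq_zero _
      linear_combination ev es (v :: l) * h2
  simpa using this

lemma evC_chains (m : ι →₀ ℕ) {δ : ℝ} (h : (ι →₀ ℕ) → Ch (PP ι M)) (hp : ∃ p, h 0 = single1 [p])
    (hh : ∀ k ≤ m, h k ∈ SC (DD k) δ (k.degree + 1) ∧ (k ≠ 0 → bd (h k) = bdSum h k))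
    (L : List ((ι → ZMod 2) × (PP ι M → ZMod 2)))
    (hL : ∀ x ∈ L, ∀ i, ∀ u ∈ SS m, x.2 (TT i u) = x.2 u + x.1 i) :
    ∀ k ≤ m, evC (L.map Prod.snd) (h k) = MvPolynomial.coeff k (L.map (fun x => lin x.1)).prod := by
  induction L with
  | nil =>
    intro k hk
    by_cases h0 : k = 0
    · subst h0
      obtain ⟨p, hp⟩ := hp
      simp [hp, ev]
    · simp only [List.map_nil, List.prod_nil, MvPolynomial.coeff_one, if_neg (Ne.symm h0)]
      have : (evC ([] : List (PP ι M → ZMod 2))) (h k) = (0 : Ch (PP ι M) →ₗ[ZMod 2] ZMod 2) (h k) := by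
        refine lin_eq_on _ _ ?_ (hh k hk).1
        rintro l ⟨h1, _, _⟩
        simp only [evC_single1, LinearMap.zero_apply]
        by_contra hne
        have := ev_length _ _ hne
        apply h0
        rw [← Finsupp.degree_eq_zero_iff]
        simp at this
        omega
      simpa using this
  | cons x L ih =>
    intro k hk
    have ih' := ih (fun y hy => hL y (List.mem_cons_of_mem _ hy))
    simp only [List.map_cons, List.prod_cons]
    rw [← leibniz _ _ (evC_bd _), coeff_lin_mul]
    by_cases h0 : k = 0
    · subst h0
      obtain ⟨p, hp⟩ := hp
      simp [hp, bdL, mh, ev_nil_right]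
    · rw [(hh k hk).2 h0, bdSum, map_sum]
      apply Finset.sum_congr rfl
      intro i hi
      have hk' : k - Finsupp.single i 1 ≤ m := tsub_le_self.trans hk
      rw [← ih' _ hk']
      refine mhC_TT hk' i _ _ _ (hL x (by simp) i) ?_ (hh _ hk').1
      intro e he
      obtain ⟨y, hy, rfl⟩ := List.mem_map.1 he
      exact ⟨y.1 i, hL y (List.mem_cons_of_mem _ hy) i⟩

/-- A Borsuk-Ulam type theorem for products of spheres. -/
theorem borsukUlam {J : Type*} [Fintype J] (m : ι →₀ ℕ) (hm : ∀ i, m i < M)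
    (χ : J → ι → ZMod 2) (ε : J → PP ι M → ZMod 2)
    (hε : ∀ j i, ∀ u ∈ SS m, ε j (TT i u) = ε j u + χ j i)
    (hc : MvPolynomial.coeff m (∏ j, lin (χ j)) ≠ 0) :
    ∃ u ∈ (SS m : Set (PP ι M)), ∀ j, ∀ δ > 0, ∃ w ∈ SS m, ∃ w' ∈ SS m,
      dist w u < δ ∧ dist w' u < δ ∧ ε j w ≠ ε j w' := by
  have key : ∀ δ > (0 : ℝ), ∃ u ∈ (SS m : Set (PP ι M)), ∀ j, ∃ w ∈ SS m, ∃ w' ∈ SS m,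
      dist w u < δ ∧ dist w' u < δ ∧ ε j w ≠ ε j w' := by
    intro δ hδ
    obtain ⟨h, hp, hh⟩ := exists_chains m hm m.degree δ hδ
    have hh' : ∀ k ≤ m, h k ∈ SC (DD k) δ (k.degree + 1) ∧ (k ≠ 0 → bd (h k) = bdSum h k) := by
      intro k hk
      apply hh k hk
      have h2 := congrArg Finsupp.degree (tsub_add_cancel_of_le hk)
      rw [map_add] at h2
      omega
    let L : List ((ι → ZMod 2) × (PP ι M → ZMod 2)) :=
      (Finset.univ : Finset J).toList.map (fun j => (χ j, ε j))
    have e1 := evC_chains m h hp hh' L (by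
      intro x hx i u hu
      obtain ⟨j, _, rfl⟩ := List.mem_map.1 hx
      exact hε j i u hu) m le_rfl
    have e2 : (L.map (fun x => lin x.1)).prod = ∏ j, lin (χ j) := by
      simp [L, Function.comp_def, Finset.prod_map_toList]
    rw [e2] at e1
    rw [← e1] at hc
    obtain ⟨l, hl, hne⟩ : ∃ l ∈ small (DD m : Set (PP ι M)) δ (m.degree + 1),
        ev (L.map Prod.snd) l ≠ 0 := by
      by_contra hcon
      push Not at hcon
      apply hc
      have : (evC (L.map Prod.snd)) (h m) = (0 : Ch (PP ι M) →ₗ[ZMod 2] ZMod 2) (h m) := by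
        refine lin_eq_on _ _ ?_ (hh' m le_rfl).1
        intro l hl
        simpa using hcon l hl
      simpa using this
    have hlen := hl.1
    rcases l with _ | ⟨u, l⟩
    · simp at hlen
    refine ⟨u, (hl.2.1 u (by simp)).1, fun j => ?_⟩
    obtain ⟨w, hw, w', hw', hww⟩ := ev_ne _ _ hne (ε j) (by simp [L])
    exact ⟨w, (hl.2.1 w hw).1, w', (hl.2.1 w' hw').1, hl.2.2 w hw u (by simp),
      hl.2.2 w' hw' u (by simp), hww⟩
  choose! f hf using key
  have hpos : ∀ n : ℕ, (0 : ℝ) < 1 / ((n : ℝ) + 1) := fun n => by positivity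
  obtain ⟨u, hu, φ, hφ, hlim⟩ := (SS_compact m).tendsto_subseq
    (x := fun n : ℕ => f (1 / ((n : ℝ) + 1))) (fun n => (hf _ (hpos n)).1)
  refine ⟨u, hu, fun j δ hδ => ?_⟩
  have h1 : Filter.Tendsto (fun n : ℕ => (1 : ℝ) / ((φ n : ℝ) + 1)) Filter.atTop (nhds 0) :=
    tendsto_one_div_add_atTop_nhds_zero_nat.comp hφ.tendsto_atTop
  have h2 := h1.eventually (gt_mem_nhds (half_pos hδ))
  have h3 := hlim.eventually (Metric.ball_mem_nhds u (half_pos hδ))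
  obtain ⟨N, hN1, hN2⟩ := (h2.and h3).exists
  obtain ⟨w, hw, w', hw', d1, d2, hne⟩ := (hf _ (hpos (φ N))).2 j
  have hN3 : dist (f (1 / ((φ N : ℝ) + 1))) u < δ / 2 := hN2
  refine ⟨w, hw, w', hw', ?_, ?_, hne⟩
  · linarith [dist_triangle w (f (1 / ((φ N : ℝ) + 1))) u]
  · linarith [dist_triangle w' (f (1 / ((φ N : ℝ) + 1))) u]

end BU

end MilnorAux

set_option linter.unusedSectionVars false
set_option linter.unusedSimpArgs false

namespace MilnorAux

open scoped BigOperators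
open Set

section Coeff

open MvPolynomial

variable {ζ : Type*} [DecidableEq ζ]

lemma coeff_strip1 {k : ζ →₀ ℕ} {a b : ζ} (hb : k b = 0) (hab : a ≠ b) (p : MvPolynomial ζ (ZMod 2)) :
    coeff (k + Finsupp.single a 1) ((X a + X b) * p) = coeff k p := by
  rw [add_mul, coeff_add, coeff_X_mul', coeff_X_mul', if_pos, if_neg, add_zero, add_tsub_cancel_right]
  · simp [hb, Finsupp.single_apply, hab]
  · simp

lemma coeff_strip_pow {k : ζ →₀ ℕ} {a b : ζ} (hb : k b = 0) (hab : a ≠ b) (j : ℕ)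
    (p : MvPolynomial ζ (ZMod 2)) :
    coeff (k + Finsupp.single a j) ((X a + X b) ^ j * p) = coeff k p := by
  induction j generalizing p with
  | zero => simp
  | succ j ih =>
    rw [pow_succ', mul_assoc, Finsupp.single_add, ← add_assoc, coeff_strip1, ih]
    · simp [hb, Finsupp.single_apply, hab]
    · exact hab

lemma coeff_strip_frob {k : ζ →₀ ℕ} {a b : ζ} (t : ℕ) (hb : k b < 2 ^ t) (hab : a ≠ b)
    (p : MvPolynomial ζ (ZMod 2)) :
    coeff (k + Finsupp.single a (2 ^ t)) ((X a + X b) ^ (2 ^ t) * p) = coeff k p := by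
  have : Fact (Nat.Prime 2) := ⟨Nat.prime_two⟩
  rw [add_pow_char_pow, add_mul, coeff_add, X_pow_eq_monomial, X_pow_eq_monomial,
    coeff_monomial_mul', coeff_monomial_mul', if_pos, if_neg, add_zero, add_tsub_cancel_right, one_mul]
  · intro h
    have := h b
    simp [Finsupp.single_apply, hab] at this
    omega
  · exact le_add_self

lemma coeff_strip_X {k : ζ →₀ ℕ} {a : ζ} (j : ℕ) (p : MvPolynomial ζ (ZMod 2)) :
    coeff (k + Finsupp.single a j) (X a ^ j * p) = coeff k p := by
  rw [X_pow_eq_monomial, coeff_monomial_mul', if_pos le_add_self, add_tsub_cancel_right, one_mul]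

lemma coeff_block {n : ℕ} {k : Fin n × Bool →₀ ℕ} {i l : Fin n} (hil : i ≠ l) (s c t : ℕ)
    (h1 : k (i, false) = 0) (h2 : k (l, false) = 0) (h3 : k (l, true) < 2 ^ t)
    (p : MvPolynomial (Fin n × Bool) (ZMod 2)) :
    coeff (k + (Finsupp.single (i, false) s + Finsupp.single (i, true) (2 ^ t + c + 1)))
      ((X (i, true) + X (i, false)) * (X (i, false) + X (l, false)) ^ s * X (i, true) ^ c
        * (X (i, true) + X (l, true)) ^ (2 ^ t) * p) = coeff k p := by
  have e : k + (Finsupp.single (i, false) s + Finsupp.single (i, true) (2 ^ t + c + 1))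
      = k + Finsupp.single (i, true) (2 ^ t) + Finsupp.single (i, true) c
        + Finsupp.single (i, true) 1 + Finsupp.single (i, false) s := by
    rw [Finsupp.single_add, Finsupp.single_add]; abel
  have e2 : ((X (i, true) + X (i, false)) * (X (i, false) + X (l, false)) ^ s * X (i, true) ^ c
        * (X (i, true) + X (l, true)) ^ (2 ^ t) * p)
      = (X (i, false) + X (l, false)) ^ s * ((X (i, true) + X (i, false)) * (X (i, true) ^ c
        * ((X (i, true) + X (l, true)) ^ (2 ^ t) * p))) := by ring
  rw [e, e2, coeff_strip_pow, coeff_strip1, coeff_strip_X, coeff_strip_frob]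
  · exact h3
  · simp [hil]
  · simp [h1, Finsupp.single_apply]
  · simp
  · simp [h2, Finsupp.single_apply]
  · simp [hil]

/-- The target exponent. -/
noncomputable def mexp (n : ℕ) (l : Fin n) (s c t : ℕ) : Fin n × Bool →₀ ℕ :=
  (Finsupp.single (l, true) (2 ^ t - 1) + ∑ i ∈ Finset.univ.erase l,
    (Finsupp.single (i, false) s + Finsupp.single (i, true) (2 ^ t + c + 1)))
    + Finsupp.single (l, true) 1

lemma coeff_blocks {n : ℕ} {k : Fin n × Bool →₀ ℕ} (l : Fin n) (s c t : ℕ)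
    (S : Finset (Fin n)) (hl : l ∉ S)
    (h1 : ∀ i, k (i, false) = 0) (h3 : k (l, true) < 2 ^ t)
    (p : MvPolynomial (Fin n × Bool) (ZMod 2)) :
    coeff (k + ∑ i ∈ S, (Finsupp.single (i, false) s + Finsupp.single (i, true) (2 ^ t + c + 1)))
      ((∏ i ∈ S, ((X (i, true) + X (i, false)) * (X (i, false) + X (l, false)) ^ s * X (i, true) ^ c
        * (X (i, true) + X (l, true)) ^ (2 ^ t))) * p) = coeff k p := by
  induction S using Finset.induction_on generalizing p with
  | empty => simp
  | insert i S hi ih =>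
    have hil : i ≠ l := fun h => hl (by simp [h])
    have hlS : l ∉ S := fun h => hl (by simp [h])
    rw [Finset.prod_insert hi, Finset.sum_insert hi, mul_assoc,
      add_comm (Finsupp.single (i, false) s + _), ← add_assoc, coeff_block hil, ih hlS]
    · have : ∀ j ∈ S, j ≠ i := fun j hj h => hi (h ▸ hj)
      simp only [Finsupp.add_apply, h1, Finsupp.finsetSum_apply, zero_add, Finset.sum_eq_zero_iff]
      intro j hj
      simp [Finsupp.single_apply, this j hj]
    · have : ∀ j ∈ S, j ≠ l := fun j hj h => hlS (h ▸ hj)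
      simp only [Finsupp.add_apply, h1, Finsupp.finsetSum_apply, zero_add, Finset.sum_eq_zero_iff]
      intro j hj
      simp [Finsupp.single_apply, this j hj]
    · have : ∀ j ∈ S, j ≠ l := fun j hj h => hlS (h ▸ hj)
      simp only [Finsupp.add_apply, Finsupp.finsetSum_apply]
      rw [Finset.sum_eq_zero]
      · simpa using h3
      · intro j hj
        simp [Finsupp.single_apply, this j hj]

lemma coeff_main {n : ℕ} (l i₁ : Fin n) (hl : i₁ ≠ l) (s c t : ℕ) :
    coeff (mexp n l s c t) ((X (l, true) + X (l, false)) *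
      ((∏ i ∈ Finset.univ.erase l,
        ((X (i, true) + X (i, false)) * (X (i, false) + X (l, false)) ^ s * X (i, true) ^ c
        * (X (i, true) + X (l, true)) ^ (2 ^ t))) * (X (l, true) + X (i₁, true)) ^ (2 ^ t - 1)))
      = (1 : ZMod 2) := by
  rw [mexp, coeff_strip1, coeff_blocks]
  · have := coeff_strip_pow (ζ := Fin n × Bool) (k := 0) (a := (l, true)) (b := (i₁, true)) rfl
      (by simp [hl.symm]) (2 ^ t - 1) 1
    rw [zero_add, mul_one] at this
    rw [this]
    simp
  · simp
  · intro i; simp [Finsupp.single_apply]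
  · have : 0 < 2 ^ t := by positivity
    simp
  · simp only [Finsupp.add_apply, Finsupp.finsetSum_apply]
    rw [Finset.sum_eq_zero]
    · simp [Finsupp.single_apply]
    · intro j hj
      have : j ≠ l := (Finset.mem_erase.1 hj).1
      simp [Finsupp.single_apply, this]
  · simp

lemma mexp_false {n : ℕ} (l : Fin n) (s c t : ℕ) (i : Fin n) : mexp n l s c t (i, false) ≤ s := by
  simp only [mexp, Finsupp.add_apply, Finsupp.finsetSum_apply]
  simp [Finsupp.single_apply]
  split_ifs <;> simp

lemma mexp_true {n : ℕ} (l : Fin n) (s c t : ℕ) (i : Fin n) :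
    mexp n l s c t (i, true) ≤ 2 ^ t + c + 1 := by
  have : 0 < 2 ^ t := by positivity
  have hq : 2 ^ t - 1 + 1 ≤ 2 ^ t + c + 1 := by omega
  simp only [mexp, Finsupp.add_apply, Finsupp.finsetSum_apply]
  generalize 2 ^ t + c + 1 = q at *
  generalize 2 ^ t - 1 = q' at *
  simp [Finsupp.single_apply]
  by_cases h : i = l
  · subst h
    simp
    omega
  · simp [h, Ne.symm h]

/-- The index type of the topological complexity classes. -/
abbrev TCI (n : ℕ) (l : Fin n) (s t : ℕ) :=
  Fin (2 ^ t - 1) ⊕ ({i : Fin n // i ≠ l} × (Fin s ⊕ Fin (2 ^ t)))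

/-- Which factor a class compares with the last one. -/
def tcF {n : ℕ} {l : Fin n} {s t : ℕ} (i₁ : Fin n) : TCI n l s t → Fin n × Bool
  | Sum.inl _ => (i₁, true)
  | Sum.inr (i, Sum.inl _) => (i, false)
  | Sum.inr (i, Sum.inr _) => (i, true)

abbrev JJ (n : ℕ) (l : Fin n) (s c t : ℕ) :=
  Fin n ⊕ (TCI n l s t ⊕ ({i : Fin n // i ≠ l} × Fin c))

/-- All the characters. -/
def chi {n : ℕ} {l : Fin n} {s c t : ℕ} (i₁ : Fin n) : JJ n l s c t → Fin n × Bool → ZMod 2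
  | Sum.inl i => Pi.single (i, true) 1 + Pi.single (i, false) 1
  | Sum.inr (Sum.inl x) => Pi.single (tcF i₁ x) 1 + Pi.single (l, (tcF i₁ x).2) 1
  | Sum.inr (Sum.inr x) => Pi.single ((x.1 : Fin n), true) 1

lemma lin_single [Fintype ζ] (a : ζ) : lin (Pi.single a 1) = X a := by
  rw [lin, Finset.sum_eq_single a]
  · simp
  · intro b _ hb
    simp [Pi.single_apply, hb]
  · simp

lemma lin_add [Fintype ζ] (a b : ζ → ZMod 2) : lin (a + b) = lin a + lin b := by
  simp [lin, add_mul, Finset.sum_add_distrib]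

lemma coeff_chi {n : ℕ} (l i₁ : Fin n) (hl : i₁ ≠ l) (s c t : ℕ) :
    coeff (mexp n l s c t) (∏ j : JJ n l s c t, lin (chi i₁ j)) ≠ 0 := by
  have : ∏ j : JJ n l s c t, lin (chi i₁ j) = ((X (l, true) + X (l, false)) *
      ((∏ i ∈ Finset.univ.erase l,
        ((X (i, true) + X (i, false)) * (X (i, false) + X (l, false)) ^ s * X (i, true) ^ c
        * (X (i, true) + X (l, true)) ^ (2 ^ t))) * (X (l, true) + X (i₁, true)) ^ (2 ^ t - 1))) := by
    rw [Fintype.prod_sum_type, Fintype.prod_sum_type, Fintype.prod_sum_type, Fintype.prod_prod_type,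
      Fintype.prod_prod_type]
    simp only [Fintype.prod_sum_type, chi, tcF, lin_add, lin_single, Finset.prod_const,
      Finset.card_univ, Fintype.card_fin]
    rw [← Finset.mul_prod_erase Finset.univ _ (Finset.mem_univ l)]
    have hsub : ∀ f : Fin n → MvPolynomial (Fin n × Bool) (ZMod 2),
        ∏ i : {i : Fin n // i ≠ l}, f i = ∏ i ∈ Finset.univ.erase l, f i := by
      intro f
      rw [Finset.prod_subtype (Finset.univ.erase l) (p := fun i => i ≠ l)]
      simp
    rw [hsub (fun i => (X (i, false) + X (l, false)) ^ s * (X (i, true) + X (l, true)) ^ (2 ^ t)),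
      hsub (fun i => X (i, true) ^ c)]
    simp only [Finset.prod_mul_distrib]
    rw [add_comm (X (l, true)) (X (i₁, true))]
    ring
  rw [this, coeff_main l i₁ hl]
  exact one_ne_zero

end Coeff

end MilnorAux

set_option linter.unusedSectionVars false
set_option linter.unusedSimpArgs false

namespace MilnorAux

open scoped BigOperators
open Set

section BU2

variable {ι : Type*} [Fintype ι] [DecidableEq ι] {M : ℕ}

/-- The sign attached to a character value. -/
def sg (a : ZMod 2) : ℝ := if a = 0 then 1 else -1

/-- Sign of a real number, in `ZMod 2`. -/
noncomputable def sgnz (x : ℝ) : ZMod 2 := if 0 < x then 0 else 1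

lemma zmod2_cases (a : ZMod 2) : a = 0 ∨ a = 1 := by
  revert a; decide

lemma sgnz_sg (a : ZMod 2) {x : ℝ} (hx : x ≠ 0) : sgnz (sg a * x) = sgnz x + a := by
  rcases zmod2_cases a with rfl | rfl
  · simp [sg]
  · have : sg 1 = -1 := by simp [sg]
    rw [this]
    rcases lt_or_gt_of_ne hx with h | h
    · simp [sgnz, h, not_lt.2 h.le]; decide
    · simp [sgnz, h, h.le]

open Classical in
/-- A discontinuous odd function. -/
noncomputable def s0 (x : EuclideanSpace ℝ (Fin M)) : ZMod 2 :=
  if WellOrderingRel x (-x) then 0 else 1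

open Classical in
lemma s0_neg {x : EuclideanSpace ℝ (Fin M)} (hx : x ≠ 0) : s0 (-x) = s0 x + 1 := by
  have hne : x ≠ -x := fun h => hx (by
    have : (2 : ℝ) • x = 0 := by
      rw [two_smul]; nth_rewrite 1 [h]; simp
    simpa using this)
  have e1 : s0 (-x) = if WellOrderingRel (-x) x then 0 else 1 := by
    unfold s0; rw [neg_neg]
  rw [e1, s0]
  rcases trichotomous_of WellOrderingRel x (-x) with h | h | h
  · rw [if_neg (asymm h), if_pos h]; decide
  · exact absurd h hne
  · rw [if_pos h, if_neg (asymm h)]; decide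

/-- Reference function for a character. -/
noncomputable def refE (χ : ι → ZMod 2) (u : PP ι M) : ZMod 2 := ∑ q, χ q * s0 (u q)

lemma refE_TT (χ : ι → ZMod 2) (u : PP ι M) (q : ι) (hu : u q ≠ 0) :
    refE χ (TT q u) = refE χ u + χ q := by
  rw [refE, refE, ← Finset.add_sum_erase _ _ (Finset.mem_univ q),
    ← Finset.add_sum_erase (a := q) _ (fun q => χ q * s0 (u q)) (Finset.mem_univ q)]
  have h1 : TT q u q = - u q := by simp [TT]
  have h2 : ∑ x ∈ Finset.univ.erase q, χ x * s0 (TT q u x) = ∑ x ∈ Finset.univ.erase q, χ x * s0 (u x) := by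
    apply Finset.sum_congr rfl
    intro x hx
    have : x ≠ q := (Finset.mem_erase.1 hx).1
    simp [TT, this]
  rw [h1, h2, s0_neg hu]
  ring

open Classical in
noncomputable def signE (f : PP ι M → ℝ) (χ : ι → ZMod 2) (u : PP ι M) : ZMod 2 :=
  if f u ≠ 0 then sgnz (f u) else refE χ u

lemma sg_ne (a : ZMod 2) : sg a ≠ 0 := by
  unfold sg; split_ifs <;> norm_num

theorem borsukUlam2 {J : Type*} [Fintype J] (m : ι →₀ ℕ) (hm : ∀ i, m i < M)
    (χ : J → ι → ZMod 2) (f : J → PP ι M → ℝ)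
    (hf : ∀ j i, ∀ u ∈ SS m, f j (TT i u) = sg (χ j i) * f j u)
    (hc : MvPolynomial.coeff m (∏ j, lin (χ j)) ≠ 0) :
    ∃ u ∈ (SS m : Set (PP ι M)), ∀ j, ContinuousWithinAt (f j) (SS m) u → f j u = 0 := by
  obtain ⟨u, hu, h⟩ := borsukUlam m hm χ (fun j => signE (f j) (χ j)) (by
    intro j i u hu
    have hu0 : u i ≠ 0 := by
      rw [← norm_ne_zero_iff, (hu i).1]; exact one_ne_zero
    by_cases h0 : f j u = 0
    · have h1 : f j (TT i u) = 0 := by rw [hf j i u hu, h0, mul_zero]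
      simp only [signE, h0, h1, ne_eq, not_true_eq_false, if_false]
      exact refE_TT _ _ _ hu0
    · have h1 : f j (TT i u) ≠ 0 := by rw [hf j i u hu]; exact mul_ne_zero (sg_ne _) h0
      simp only [signE, h0, h1, ne_eq, not_false_eq_true, if_true]
      rw [hf j i u hu, sgnz_sg _ h0]) hc
  refine ⟨u, hu, fun j hcont => ?_⟩
  by_contra hne
  have key : ∀ᶠ w in nhdsWithin u (SS m), signE (f j) (χ j) w = sgnz (f j u) := by
    rcases lt_or_gt_of_ne hne with hlt | hgt
    · filter_upwards [hcont.eventually (gt_mem_nhds hlt)] with w hw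
      simp [signE, sgnz, hw.ne, not_lt.2 hw.le, not_lt.2 hlt.le]
    · filter_upwards [hcont.eventually (lt_mem_nhds hgt)] with w hw
      simp [signE, sgnz, hw.ne', hw, hgt]
  obtain ⟨δ, hδ, hball⟩ := Metric.mem_nhdsWithin_iff.1 key
  obtain ⟨w, hw, w', hw', d1, d2, hww⟩ := h j δ hδ
  apply hww
  have e1 := hball ⟨Metric.mem_ball.2 d1, hw⟩
  have e2 := hball ⟨Metric.mem_ball.2 d2, hw'⟩
  simp only [mem_ofPred_eq] at e1 e2
  rw [e1, e2]

end BU2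

end MilnorAux

set_option linter.unusedSectionVars false
set_option linter.unusedSimpArgs false

namespace MilnorAux

open scoped BigOperators unitInterval Matrix
open Set Projectivization

section Proj

variable {k : ℕ}

/-- Shorthand for real projective space. -/
abbrev RP (k : ℕ) := Projectivization ℝ (Fin k → ℝ)

lemma isQuotientMap_mk' :
    Topology.IsQuotientMap (fun v : {v : Fin k → ℝ // v ≠ 0} => (Projectivization.mk ℝ v.1 v.2 : RP k)) :=
  isQuotientMap_quotient_mk'

lemma continuous_mk {X : Type*} [TopologicalSpace X] {f : X → Fin k → ℝ} (hf : Continuous f)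
    (h0 : ∀ x, f x ≠ 0) : Continuous (fun x => (Projectivization.mk ℝ (f x) (h0 x) : RP k)) :=
  isQuotientMap_mk'.continuous.comp (hf.subtype_mk h0)

/-- The projection matrix. -/
noncomputable def pm (p : RP k) : Matrix (Fin k) (Fin k) ℝ :=
  fun i j => (p.rep i * p.rep j) / (p.rep ⬝ᵥ p.rep)

lemma dot_self_ne {v : Fin k → ℝ} (hv : v ≠ 0) : v ⬝ᵥ v ≠ 0 := by
  rwa [ne_eq, dotProduct_self_eq_zero]

lemma pm_mk {v : Fin k → ℝ} (hv : v ≠ 0) (i j : Fin k) :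
    pm (Projectivization.mk ℝ v hv) i j = (v i * v j) / (v ⬝ᵥ v) := by
  obtain ⟨a, ha⟩ := exists_smul_eq_mk_rep ℝ v hv
  have ha0 : (a : ℝ) ≠ 0 := a.ne_zero
  have hv' := dot_self_ne hv
  simp only [pm, ← ha, Units.smul_def, Pi.smul_apply, smul_eq_mul, smul_dotProduct, dotProduct_smul]
  field_simp

lemma pm_mulVec {v : Fin k → ℝ} (hv : v ≠ 0) (x : Fin k → ℝ) :
    pm (Projectivization.mk ℝ v hv) *ᵥ x = ((v ⬝ᵥ x) / (v ⬝ᵥ v)) • v := by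
  ext i
  simp only [Matrix.mulVec, dotProduct, pm_mk, Pi.smul_apply, smul_eq_mul]
  rw [Finset.sum_div, Finset.sum_mul]
  apply Finset.sum_congr rfl
  intro j _
  ring

lemma continuous_pm : Continuous (pm : RP k → Matrix (Fin k) (Fin k) ℝ) := by
  rw [isQuotientMap_mk'.continuous_iff]
  apply continuous_matrix
  intro i j
  simp only [Function.comp_def, pm_mk]
  apply Continuous.div
  · exact ((continuous_apply i).comp continuous_subtype_val).mul
      ((continuous_apply j).comp continuous_subtype_val)
  · exact continuous_subtype_val.dotProduct continuous_subtype_val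
  · intro v; exact dot_self_ne v.2

lemma pm_injective : Function.Injective (pm : RP k → Matrix (Fin k) (Fin k) ℝ) := by
  intro p q
  induction p using Projectivization.ind with | _ v hv => ?_
  induction q using Projectivization.ind with | _ w hw => ?_
  intro h
  have h1 : (pm (Projectivization.mk ℝ v hv)) *ᵥ v = v := by
    rw [pm_mulVec, div_self (dot_self_ne hv), one_smul]
  rw [h, pm_mulVec] at h1
  rw [Projectivization.mk_eq_mk_iff']
  exact ⟨_, h1⟩

instance : T2Space (RP k) := T2Space.of_injective_continuous pm_injective continuous_pm

/-- Nonorthogonality indicator. -/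
noncomputable def tau (p q : RP k) : ℝ := (pm p * pm q).trace

lemma tau_mk {v w : Fin k → ℝ} (hv : v ≠ 0) (hw : w ≠ 0) :
    tau (Projectivization.mk ℝ v hv) (Projectivization.mk ℝ w hw) =
      (v ⬝ᵥ w) ^ 2 / ((v ⬝ᵥ v) * (w ⬝ᵥ w)) := by
  simp only [tau, Matrix.trace, Matrix.diag, Matrix.mul_apply, pm_mk]
  have : v ⬝ᵥ w = ∑ i, v i * w i := rfl
  rw [sq, this, Finset.sum_mul_sum, Finset.sum_div]
  apply Finset.sum_congr rfl
  intro i _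
  rw [Finset.sum_div]
  apply Finset.sum_congr rfl
  intro j _
  rw [div_mul_div_comm]
  congr 1
  ring

lemma tau_self (p : RP k) : tau p p ≠ 0 := by
  induction p using Projectivization.ind with | _ v hv => ?_
  rw [tau_mk]
  have := dot_self_ne hv
  positivity

lemma continuous_tau {Z : Type*} [TopologicalSpace Z] {f g : Z → RP k} (hf : Continuous f)
    (hg : Continuous g) : Continuous (fun z => tau (f z) (g z)) :=
  ((continuous_pm.comp hf).matrix_mul (continuous_pm.comp hg)).matrix_trace

/-- The vector `x` is nonzero on the line `p`. -/
def onLine (p : RP k) (x : Fin k → ℝ) : Prop := ∃ hx : x ≠ 0, Projectivization.mk ℝ x hx = p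

lemma onLine_step {p q : RP k} {x : Fin k → ℝ} (hx : onLine p x) (h : tau q p ≠ 0) :
    onLine q (pm q *ᵥ x) := by
  obtain ⟨hx, rfl⟩ := hx
  induction q using Projectivization.ind with | _ v hv => ?_
  rw [tau_mk] at h
  have h1 : v ⬝ᵥ x ≠ 0 := by
    intro h0; apply h; rw [h0]; simp
  have h2 : (v ⬝ᵥ x) / (v ⬝ᵥ v) ≠ 0 := div_ne_zero h1 (dot_self_ne hv)
  rw [pm_mulVec]
  refine ⟨smul_ne_zero h2 hv, ?_⟩
  rw [Projectivization.mk_eq_mk_iff']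
  exact ⟨_, rfl⟩

lemma onLine_dot {p : RP k} {x y : Fin k → ℝ} (hx : onLine p x) (hy : onLine p y) : y ⬝ᵥ x ≠ 0 := by
  obtain ⟨hx, rfl⟩ := hx
  obtain ⟨hy, h⟩ := hy
  rw [Projectivization.mk_eq_mk_iff'] at h
  obtain ⟨a, rfl⟩ := h
  rw [smul_dotProduct]
  have : a ≠ 0 := by rintro rfl; simp at hy
  exact mul_ne_zero this (dot_self_ne hx)

/-- Transport along a homotopy of lines. -/
lemma transport {W : Type*} [TopologicalSpace W] (V : Set W) (hV : IsCompact V)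
    (h : C(I × W, RP k)) : ∃ K : W → Matrix (Fin k) (Fin k) ℝ, Continuous K ∧
      ∀ w ∈ V, ∀ x y, onLine (h (0, w)) x → onLine (h (1, w)) y → y ⬝ᵥ (K w *ᵥ x) ≠ 0 := by
  have := isCompact_iff_compactSpace.1 hV
  let C : Set (V × (I × I)) := {z | tau (h (z.2.1, z.1)) (h (z.2.2, z.1)) = 0}
  have hC : IsClosed C := by
    have hc1 : Continuous (fun z : V × (I × I) => h (z.2.1, (z.1 : W))) :=
      h.continuous.comp ((continuous_fst.comp continuous_snd).prodMk (continuous_subtype_val.comp continuous_fst))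
    have hc2 : Continuous (fun z : V × (I × I) => h (z.2.2, (z.1 : W))) :=
      h.continuous.comp ((continuous_snd.comp continuous_snd).prodMk (continuous_subtype_val.comp continuous_fst))
    exact isClosed_eq (continuous_tau hc1 hc2) continuous_const
  let D : Set (I × I) := (Prod.snd : V × (I × I) → I × I) '' C
  have hD : IsClosed D := isClosedMap_snd_of_compactSpace C hC
  have hO : IsOpen Dᶜ := hD.isOpen_compl
  have hU : Dᶜ ∈ uniformity I := by
    rw [← nhdsSet_diagonal_eq_uniformity, hO.mem_nhdsSet]
    rintro ⟨a, b⟩ hab ⟨⟨w, c⟩, hz, hz'⟩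
    simp only [mem_diagonal_iff] at hab
    subst hab
    simp only at hz'
    subst hz'
    exact tau_self _ hz
  obtain ⟨δ, hδ, hδU⟩ := Metric.mem_uniformity_dist.1 hU
  obtain ⟨N, hN⟩ := exists_nat_one_div_lt hδ
  let tm : ℕ → I := fun j => projIcc (0 : ℝ) 1 zero_le_one ((j : ℝ) / (N + 1))
  have htm : ∀ j, dist (tm (j + 1)) (tm j) < δ := by
    intro j
    refine lt_of_le_of_lt ?_ hN
    have h1 : dist (tm (j + 1)) (tm j) = |((tm (j + 1) : I) : ℝ) - tm j| := rfl
    rw [h1]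
    simp only [tm]
    refine (abs_projIcc_sub_projIcc zero_le_one).trans ?_
    rw [← sub_div]
    push_cast
    rw [add_sub_cancel_left, abs_of_pos (by positivity)]
  have key : ∀ j : ℕ, ∃ K : W → Matrix (Fin k) (Fin k) ℝ, Continuous K ∧
      ∀ w ∈ V, ∀ x, onLine (h (0, w)) x → onLine (h (tm j, w)) (K w *ᵥ x) := by
    intro j
    induction j with
    | zero =>
      refine ⟨fun _ => 1, continuous_const, ?_⟩
      intro w hw x hx
      have : tm 0 = 0 := by simp [tm]
      simpa [this] using hx
    | succ j ih =>
      obtain ⟨K, hK, hK2⟩ := ih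
      refine ⟨fun w => pm (h (tm (j + 1), w)) * K w, ?_, ?_⟩
      · exact (continuous_pm.comp (h.continuous.comp (by fun_prop))).matrix_mul hK
      · intro w hw x hx
        rw [← Matrix.mulVec_mulVec]
        refine onLine_step (hK2 w hw x hx) ?_
        intro h0
        exact hδU (htm j) ⟨(⟨w, hw⟩, (tm (j + 1), tm j)), h0, rfl⟩
  obtain ⟨K, hK, hK2⟩ := key (N + 1)
  refine ⟨K, hK, fun w hw x y hx hy => ?_⟩
  have h1 := hK2 w hw x hx
  have : tm (N + 1) = 1 := by
    simp only [tm]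
    push_cast
    rw [div_self (by positivity)]
    simp
  rw [this] at h1
  exact onLine_dot h1 hy

end Proj

end MilnorAux

set_option linter.unusedSectionVars false
set_option linter.unusedSimpArgs false

namespace MilnorAux

open scoped BigOperators unitInterval Matrix
open Set Projectivization

section Milnor

variable {r s : ℕ}

/-- The bilinear form. -/
def bil (v : Fin (r + 1) → ℝ) (w : Fin (s + 1) → ℝ) : ℝ :=
  ∑ i : Fin (min (s + 1) (r + 1)),
      v (Fin.castLE (min_le_right _ _) i) * w (Fin.castLE (min_le_left _ _) i)

lemma bil_eq (h : s + 1 ≤ r + 1) (v : Fin (r + 1) → ℝ) (w : Fin (s + 1) → ℝ) :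
    bil v w = ∑ j : Fin (s + 1), v (Fin.castLE h j) * w j := by
  have hm : min (s + 1) (r + 1) = s + 1 := min_eq_left h
  refine Fintype.sum_equiv (finCongr hm) _ _ ?_
  intro i
  rfl

lemma bil_smul (a b : ℝ) (v : Fin (r + 1) → ℝ) (w : Fin (s + 1) → ℝ) :
    bil (a • v) (b • w) = a * b * bil v w := by
  simp only [bil, Finset.mul_sum, Pi.smul_apply, smul_eq_mul]
  apply Finset.sum_congr rfl
  intro i _
  ring

lemma mem_milnor {v : Fin (r + 1) → ℝ} {w : Fin (s + 1) → ℝ} (hv : v ≠ 0) (hw : w ≠ 0) :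
    ((Projectivization.mk ℝ v hv, Projectivization.mk ℝ w hw) : RP (r + 1) × RP (s + 1)) ∈ RealMilnor r s
      ↔ bil v w = 0 := by
  obtain ⟨a, ha⟩ := exists_smul_eq_mk_rep ℝ v hv
  obtain ⟨b, hb⟩ := exists_smul_eq_mk_rep ℝ w hw
  have : bil (Projectivization.mk ℝ v hv).rep (Projectivization.mk ℝ w hw).rep = a * b * bil v w := by
    rw [← ha, ← hb]
    exact bil_smul _ _ _ _
  change bil (Projectivization.mk ℝ v hv).rep (Projectivization.mk ℝ w hw).rep = 0 ↔ _
  rw [this]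
  simp

/-- Points of the Milnor manifold. -/
noncomputable def mkX (v : Fin (r + 1) → ℝ) (w : Fin (s + 1) → ℝ) (hv : v ≠ 0) (hw : w ≠ 0) (h : bil v w = 0) :
    RealMilnor r s := ⟨(Projectivization.mk ℝ v hv, Projectivization.mk ℝ w hw), (mem_milnor hv hw).2 h⟩

lemma mkX_eq {v v' : Fin (r + 1) → ℝ} {w w' : Fin (s + 1) → ℝ} {hv : v ≠ 0} {hw : w ≠ 0}
    {h : bil v w = 0} {hv' : v' ≠ 0} {hw' : w' ≠ 0} {h' : bil v' w' = 0} {a b : ℝ}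
    (e1 : a • v' = v) (e2 : b • w' = w) : mkX v w hv hw h = mkX v' w' hv' hw' h' := by
  apply Subtype.ext
  apply Prod.ext
  · exact (Projectivization.mk_eq_mk_iff' ℝ _ _ hv hv').2 ⟨a, e1⟩
  · exact (Projectivization.mk_eq_mk_iff' ℝ _ _ hw hw').2 ⟨b, e2⟩

lemma continuous_mkX {Z : Type*} [TopologicalSpace Z] {v : Z → Fin (r + 1) → ℝ}
    {w : Z → Fin (s + 1) → ℝ} (hv : ∀ z, v z ≠ 0) (hw : ∀ z, w z ≠ 0) (h : ∀ z, bil (v z) (w z) = 0)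
    (hvc : Continuous v) (hwc : Continuous w) :
    Continuous (fun z => mkX (v z) (w z) (hv z) (hw z) (h z)) :=
  ((continuous_mk hvc hv).prodMk (continuous_mk hwc hw)).subtype_mk _

end Milnor

section Homot

/-- Coordinate projection on a subset. -/
def prU {X : Type*} [TopologicalSpace X] {n : ℕ} (U : Set (Fin n → X)) (a : Fin n) : C(U, X) :=
  ⟨fun v => (v : Fin n → X) a, (continuous_apply a).comp continuous_subtype_val⟩

/-- All coordinate projections are homotopic on a set with a homotopy section. -/
lemma proj_homotopic {X : Type*} [TopologicalSpace X] {n : ℕ} (U : Set (Fin n → X))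
    (sec : C(U, C(I, X))) (H : C(U × I, Fin n → X)) (h0 : ∀ v : U, H (v, 0) = tcPi X n (sec v))
    (h1 : ∀ v : U, H (v, 1) = (v : Fin n → X)) (a b : Fin n) :
    ContinuousMap.Homotopic (prU U a)
      (prU U b) := by
  have hs : Continuous (fun z : U × I => sec z.1 z.2) := by
    have : Continuous (fun z : U × I => (sec z.1, z.2)) := by fun_prop
    exact continuous_eval.comp this
  let E : I → C(U, X) := fun τ => ⟨fun v => sec v τ, hs.comp (continuous_id.prodMk continuous_const)⟩
  have key : ∀ τ τ', (E τ).Homotopic (E τ') := by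
    intro τ τ'
    have hpc : PathConnectedSpace I :=
      isPathConnected_iff_pathConnectedSpace.1 ((convex_Icc (0 : ℝ) 1).isPathConnected ⟨0, by simp⟩)
    let γ : Path τ τ' := (PathConnectedSpace.joined τ τ').somePath
    exact ⟨⟨⟨fun z => sec z.2 (γ z.1),
      hs.comp (continuous_snd.prodMk (γ.continuous.comp continuous_fst))⟩,
      fun v => by simp [E], fun v => by simp [E]⟩⟩
  have key2 : ∀ c : Fin n, (E (projIcc (0 : ℝ) 1 zero_le_one ((c : ℝ) / ((n : ℝ) - 1)))).Homotopic
      (prU U c) := by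
    intro c
    refine ⟨⟨⟨fun z => H (z.2, z.1) c, by fun_prop⟩, fun v => ?_, fun v => ?_⟩⟩
    · simp [h0, tcPi, E, prU]
    · simp [h1, prU]
  exact ((key2 a).symm.trans (key _ _)).trans (key2 b)

end Homot

section Compare

variable {n M k : ℕ} {X : Type*} [TopologicalSpace X]

lemma dot_continuous_aux {Z : Type*} [TopologicalSpace Z] {f g : Z → Fin k → ℝ}
    {K : Z → Matrix (Fin k) (Fin k) ℝ} (hf : Continuous f) (hg : Continuous g) (hK : Continuous K) :
    Continuous (fun z => f z ⬝ᵥ (K z *ᵥ g z)) :=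
  hf.dotProduct (hK.matrix_mulVec hg)

open Classical in
lemma compare (m : Fin n × Bool →₀ ℕ) (GG : Set (PP (Fin n × Bool) M))
    (hTT : ∀ q, ∀ u ∈ GG, TT q u ∈ GG) (hGG : ∀ u ∈ GG, GG ∈ nhdsWithin u (SS m))
    (Θ : GG → Fin n → X) (hΘ : Continuous Θ)
    (hΘT : ∀ q (u : GG), Θ ⟨TT q u, hTT q u u.2⟩ = Θ u)
    (U : Set (Fin n → X)) (hU : IsOpen U) (Kc : Set GG) (hKc : IsCompact Kc) (hKU : Kc ⊆ Θ ⁻¹' U)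
    (comp : C(X, RP k)) (V : PP (Fin n × Bool) M → Fin n → Fin k → ℝ) (hV : Continuous V) (bb : Bool)
    (hVT : ∀ q u i, V (TT q u) i = (if q = (i, bb) then (-1 : ℝ) else 1) • V u i)
    (hcomp : ∀ (u : GG) i, onLine (comp (Θ u i)) (V u i))
    (a l : Fin n) (hal : a ≠ l)
    (hh : ContinuousMap.Homotopic (prU U a)
      (prU U l)) :
    ∃ f : PP (Fin n × Bool) M → ℝ,
      (∀ q u, f (TT q u) = sg ((Pi.single (a, bb) 1 + Pi.single (l, bb) 1 : Fin n × Bool → ZMod 2) q) * f u) ∧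
      ∀ u ∈ Kc, f u ≠ 0 ∧ ContinuousWithinAt f (SS m) u := by
  obtain ⟨F⟩ := hh
  have hK' : IsCompact ((↑) ⁻¹' (Θ '' Kc) : Set U) := by
    rw [Subtype.isCompact_iff, Subtype.image_preimage_coe, inter_eq_right.2]
    · exact hKc.image hΘ
    · rintro _ ⟨u, hu, rfl⟩
      exact hKU hu
  obtain ⟨K, hKcont, hK⟩ := transport _ hK' (comp.comp F.toContinuousMap)
  let f : PP (Fin n × Bool) M → ℝ := fun u =>
    if h : ∃ hu : u ∈ GG, Θ ⟨u, hu⟩ ∈ U then V u l ⬝ᵥ (K ⟨_, h.2⟩ *ᵥ V u a) else 0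
  refine ⟨f, ?_, ?_⟩
  · intro q u
    by_cases h : ∃ hu : u ∈ GG, Θ ⟨u, hu⟩ ∈ U
    · have h' : ∃ hu : TT q u ∈ GG, Θ ⟨TT q u, hu⟩ ∈ U := ⟨hTT q u h.1, by
        have := hΘT q ⟨u, h.1⟩
        simp only at this
        rw [this]; exact h.2⟩
      have e : (⟨_, h'.2⟩ : U) = ⟨_, h.2⟩ := Subtype.ext (hΘT q ⟨u, h.1⟩)
      simp only [f, dif_pos h, dif_pos h', e, hVT, Matrix.mulVec_smul, smul_dotProduct,
        dotProduct_smul, smul_eq_mul]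
      by_cases h1 : q = (a, bb)
      · subst h1
        have : sg ((Pi.single (a, bb) 1 + Pi.single (l, bb) 1 : Fin n × Bool → ZMod 2) (a, bb)) = -1 := by
          simp [sg, Pi.single_apply, hal]
        rw [this]
        simp [hal]
      · by_cases h2 : q = (l, bb)
        · subst h2
          have : sg ((Pi.single (a, bb) 1 + Pi.single (l, bb) 1 : Fin n × Bool → ZMod 2) (l, bb)) = -1 := by
            simp [sg, Pi.single_apply, hal.symm]
          rw [this]
          simp [hal.symm]
        · have : sg ((Pi.single (a, bb) 1 + Pi.single (l, bb) 1 : Fin n × Bool → ZMod 2) q) = 1 := by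
            simp [sg, Pi.single_apply, h1, h2]
          rw [this]
          simp [h1, h2]
    · have h' : ¬ ∃ hu : TT q u ∈ GG, Θ ⟨TT q u, hu⟩ ∈ U := by
        rintro ⟨h1, h2⟩
        apply h
        have h3 : u ∈ GG := by
          have := hTT q _ h1
          rwa [TT_TT] at this
        refine ⟨h3, ?_⟩
        have := hΘT q ⟨u, h3⟩
        simp only at this
        rw [← this]; exact h2
      simp only [f, dif_neg h, dif_neg h', mul_zero]
  · intro u hu
    have huU : Θ u ∈ U := hKU hu
    constructor
    · have h : ∃ hu : (u : PP (Fin n × Bool) M) ∈ GG, Θ ⟨u, hu⟩ ∈ U := ⟨u.2, huU⟩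
      simp only [f, dif_pos h]
      apply hK _ ⟨u, hu, rfl⟩
      · have e : (comp.comp F.toContinuousMap) (0, ⟨Θ u, huU⟩) = comp (Θ u a) := by
          change comp (F (0, ⟨Θ u, huU⟩)) = _
          rw [F.apply_zero]; rfl
        rw [e]
        exact hcomp u a
      · have e : (comp.comp F.toContinuousMap) (1, ⟨Θ u, huU⟩) = comp (Θ u l) := by
          change comp (F (1, ⟨Θ u, huU⟩)) = _
          rw [F.apply_one]; rfl
        rw [e]
        exact hcomp u l
    · refine ContinuousWithinAt.mono_of_mem_nhdsWithin ?_ (hGG u u.2)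
      rw [continuousWithinAt_iff_continuousAt_domRestrict f u.2]
      have hW : IsOpen (Θ ⁻¹' U) := hU.preimage hΘ
      refine ContinuousOn.continuousAt ?_ (hW.mem_nhds huU)
      rw [continuousOn_iff_continuous_domRestrict]
      have : (Θ ⁻¹' U).domRestrict (GG.domRestrict f) = fun w : Θ ⁻¹' U =>
          V w l ⬝ᵥ (K ⟨Θ w, w.2⟩ *ᵥ V w a) := by
        ext w
        have h : ∃ hu : ((w : GG) : PP (Fin n × Bool) M) ∈ GG, Θ ⟨w, hu⟩ ∈ U := ⟨w.1.2, w.2⟩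
        simp only [Set.domRestrict_apply]
        simp only [f, dif_pos h]
      rw [this]
      have hVc : ∀ i, Continuous (fun w : Θ ⁻¹' U => V w i) := fun i =>
        (continuous_apply i).comp (hV.comp (continuous_subtype_val.comp continuous_subtype_val))
      refine dot_continuous_aux (hVc l) (hVc a) (hKcont.comp ?_)
      exact (hΘ.comp continuous_subtype_val).subtype_mk _

end Compare

end MilnorAux

set_option linter.unusedSectionVars false
set_option linter.unusedSimpArgs false

namespace MilnorAux

open scoped BigOperators unitInterval Matrix
open Set Projectivization

section Lower

variable {r s n : ℕ}

abbrev QQ (r n : ℕ) := PP (Fin n × Bool) (r + 1)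

noncomputable def ip (u : QQ r n) (i : Fin n) : ℝ := ∑ j, u (i, true) j * u (i, false) j

noncomputable def rx (u : QQ r n) (i : Fin n) : Fin (r + 1) → ℝ :=
  fun j => u (i, true) j - ip u i * u (i, false) j

noncomputable def ry (h : s + 1 ≤ r + 1) (u : QQ r n) (i : Fin n) : Fin (s + 1) → ℝ :=
  fun j => u (i, false) (Fin.castLE h j)

lemma ip_TT (q : Fin n × Bool) (u : QQ r n) (i : Fin n) :
    ip (TT q u) i = sg ((Pi.single (i, true) 1 + Pi.single (i, false) 1 : Fin n × Bool → ZMod 2) q)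
      * ip u i := by
  rcases q with ⟨j, b⟩
  by_cases h : j = i
  · subst h
    cases b <;> simp [ip, TT, sg, Finset.sum_neg_distrib]
  · have h1 : (i, true) ≠ (j, b) := fun e => h (by simp at e; exact e.1.symm)
    have h2 : (i, false) ≠ (j, b) := fun e => h (by simp at e; exact e.1.symm)
    simp [ip, TT, sg, h1, h2, h1.symm, h2.symm, Pi.single_apply]

lemma rx_TT (q : Fin n × Bool) (u : QQ r n) (i : Fin n) :
    rx (TT q u) i = (if q = (i, true) then (-1 : ℝ) else 1) • rx u i := by
  ext l
  rw [Pi.smul_apply, smul_eq_mul]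
  simp only [rx, ip_TT]
  rcases q with ⟨j, b⟩
  by_cases h : j = i
  · subst h
    cases b <;> simp [TT, sg]; ring
  · have h1 : (i, true) ≠ (j, b) := fun e => h (by simp at e; exact e.1.symm)
    have h2 : (i, false) ≠ (j, b) := fun e => h (by simp at e; exact e.1.symm)
    simp [TT, sg, h1, h2, h1.symm, h2.symm, Pi.single_apply]

lemma ry_TT (h : s + 1 ≤ r + 1) (q : Fin n × Bool) (u : QQ r n) (i : Fin n) :
    ry h (TT q u) i = (if q = (i, false) then (-1 : ℝ) else 1) • ry h u i := by
  ext l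
  rw [Pi.smul_apply, smul_eq_mul]
  simp only [ry]
  rcases q with ⟨j, b⟩
  by_cases h : j = i
  · subst h
    cases b <;> simp [TT, sg]
  · have h1 : (i, true) ≠ (j, b) := fun e => h (by simp at e; exact e.1.symm)
    have h2 : (i, false) ≠ (j, b) := fun e => h (by simp at e; exact e.1.symm)
    simp [TT, sg, h1, h2, h1.symm, h2.symm, Pi.single_apply]

lemma continuous_ip (i : Fin n) : Continuous (fun u : QQ r n => ip u i) := by
  unfold ip
  fun_prop

lemma continuous_rx : Continuous (fun (u : QQ r n) (i : Fin n) => rx u i) := by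
  refine continuous_pi fun i => continuous_pi fun j => ?_
  unfold rx
  have := continuous_ip (r := r) i
  fun_prop

lemma continuous_ry (h : s + 1 ≤ r + 1) : Continuous (fun (u : QQ r n) (i : Fin n) => ry h u i) := by
  refine continuous_pi fun i => continuous_pi fun j => ?_
  unfold ry
  fun_prop

/-- The good set. -/
def GGs (r s n : ℕ) : Set (QQ r n) :=
  {u | (∀ q, ‖u q‖ = 1) ∧ (∀ i, ∀ j : Fin (r + 1), s < j → u (i, false) j = 0) ∧ ∀ i, rx u i ≠ 0}

lemma sum_trunc (h : s + 1 ≤ r + 1) (f : Fin (r + 1) → ℝ) (hf : ∀ j : Fin (r + 1), s < j → f j = 0) :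
    ∑ j : Fin (s + 1), f (Fin.castLE h j) = ∑ j, f j := by
  refine Fintype.sum_of_injective (Fin.castLE h) (Fin.castLE_injective h) _ _ ?_ (fun _ => rfl)
  intro i hi
  apply hf
  by_contra hcon
  exact hi ⟨⟨i, by omega⟩, rfl⟩

lemma norm_one_sum {M : ℕ} {x : EuclideanSpace ℝ (Fin M)} (hx : ‖x‖ = 1) : ∑ j, x j * x j = 1 := by
  have := EuclideanSpace.real_norm_sq_eq x
  rw [hx] at this
  simp only [← sq]
  linarith

lemma ry_ne (h : s + 1 ≤ r + 1) {u : QQ r n} {i : Fin n} (h1 : ‖u (i, false)‖ = 1)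
    (h2 : ∀ j : Fin (r + 1), s < j → u (i, false) j = 0) : ry h u i ≠ 0 := by
  intro h0
  have e := sum_trunc h (fun j => u (i, false) j * u (i, false) j) (fun j hj => by simp [h2 j hj])
  simp only [norm_one_sum h1] at e
  have : ∀ j, u (i, false) (Fin.castLE h j) = 0 := fun j => congrFun h0 j
  simp [this] at e

lemma bil_rx_ry (h : s + 1 ≤ r + 1) {u : QQ r n} {i : Fin n} (h1 : ‖u (i, false)‖ = 1)
    (h2 : ∀ j : Fin (r + 1), s < j → u (i, false) j = 0) : bil (rx u i) (ry h u i) = 0 := by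
  rw [bil_eq h]
  have e := sum_trunc h (fun j => rx u i j * u (i, false) j) (fun j hj => by simp [h2 j hj])
  have e2 := norm_one_sum h1
  simp only [ry]
  rw [e]
  simp only [rx, sub_mul, Finset.sum_sub_distrib, mul_assoc, ← Finset.mul_sum, e2]
  simp [ip]

lemma GGs_norm {u : QQ r n} (hu : u ∈ GGs r s n) : ∀ q, ‖u q‖ = 1 := hu.1

lemma GGs_zero {u : QQ r n} (hu : u ∈ GGs r s n) :
    ∀ i, ∀ j : Fin (r + 1), s < j → u (i, false) j = 0 := hu.2.1

lemma GGs_ne {u : QQ r n} (hu : u ∈ GGs r s n) : ∀ i, rx u i ≠ 0 := hu.2.2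

/-- The map to the product of Milnor manifolds. -/
noncomputable def Thet (h : s + 1 ≤ r + 1) (u : GGs r s n) (i : Fin n) : RealMilnor r s :=
  mkX (rx (u : QQ r n) i) (ry h (u : QQ r n) i) (GGs_ne u.2 i)
    (ry_ne h (GGs_norm u.2 (i, false)) (GGs_zero u.2 i))
    (bil_rx_ry h (GGs_norm u.2 (i, false)) (GGs_zero u.2 i))

lemma continuous_Thet (h : s + 1 ≤ r + 1) : Continuous (Thet (n := n) h) := by
  refine continuous_pi fun i => ?_
  apply continuous_mkX
  · exact (continuous_apply i).comp (continuous_rx.comp continuous_subtype_val)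
  · exact (continuous_apply i).comp ((continuous_ry h).comp continuous_subtype_val)

lemma TT_GGs (q : Fin n × Bool) (u : QQ r n) (hu : u ∈ GGs r s n) : TT q u ∈ GGs r s n := by
  refine ⟨fun q' => ?_, fun i j hj => ?_, fun i => ?_⟩
  · by_cases hq : q' = q
    · subst hq; simpa [TT] using hu.1 q'
    · simpa [TT, hq] using hu.1 q'
  · by_cases hq : (i, false) = q
    · subst hq; simpa [TT] using hu.2.1 i j hj
    · simpa [TT, hq] using hu.2.1 i j hj
  · rw [rx_TT]
    refine smul_ne_zero ?_ (hu.2.2 i)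
    split_ifs <;> norm_num

lemma Thet_TT (h : s + 1 ≤ r + 1) (q : Fin n × Bool) (u : GGs r s n) :
    Thet h ⟨TT q (u : QQ r n), TT_GGs q u.1 u.2⟩ = Thet h u := by
  ext i : 1
  exact mkX_eq (rx_TT q u.1 i).symm (ry_TT h q u.1 i).symm

lemma lower_bound (h : s + 1 ≤ r + 1) (t : ℕ) (hrt : 2 ^ t + 1 ≤ r) (hn : 2 ≤ n) (k : ℕ)
    (U : Fin k → Set (Fin n → RealMilnor r s)) (hU : ∀ p, IsOpen (U p)) (hcov : (⋃ p, U p) = univ)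
    (hsec : ∀ p (a b : Fin n), ContinuousMap.Homotopic (prU (U p) a) (prU (U p) b)) :
    2 ^ t - 1 + (n - 1) * (s + 2 ^ t) < k := by
  classical
  by_contra hk
  push Not at hk
  obtain ⟨c, hc⟩ : ∃ c, r = 2 ^ t + c + 1 := ⟨r - 1 - 2 ^ t, by omega⟩
  let l : Fin n := ⟨0, by omega⟩
  let i₁ : Fin n := ⟨1, by omega⟩
  have hil : i₁ ≠ l := by simp [i₁, l]
  let m := mexp n l s c t
  have hm0 : ∀ i, m (i, false) ≤ s := mexp_false l s c t
  have hm1 : ∀ i, m (i, true) ≤ r := fun i => by rw [hc]; exact mexp_true l s c t i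
  have hmM : ∀ q, m q < r + 1 := by
    rintro ⟨i, b⟩
    cases b
    · have := hm0 i; omega
    · have := hm1 i; omega
  have hcard : Fintype.card (Fin k) ≤ Fintype.card (TCI n l s t) := by
    have : Fintype.card {i : Fin n // i ≠ l} = n - 1 := by
      rw [Fintype.card_subtype_compl]; simp
    simp only [Fintype.card_sum, Fintype.card_prod, this, Fintype.card_fin]
    exact hk
  obtain ⟨emb⟩ := Function.Embedding.nonempty_of_card_le hcard
  -- the constraint set
  let A : Set (QQ r n) := SS m ∩ {u | ∀ i, ip u i = 0}
  have hSS2 : ∀ u ∈ (SS m : Set (QQ r n)), (∀ q, ‖u q‖ = 1) ∧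
      (∀ i, ∀ j : Fin (r + 1), s < j → u (i, false) j = 0) := by
    intro u hu
    exact ⟨fun q => (hu q).1, fun i j hj => (hu (i, false)).2 j ((hm0 i).trans_lt hj)⟩
  have hAG : A ⊆ GGs r s n := by
    rintro u ⟨hu, hu2⟩
    refine ⟨(hSS2 u hu).1, (hSS2 u hu).2, fun i h0 => ?_⟩
    have h1 := (hu (i, true)).1
    have : u (i, true) = 0 := by
      ext j
      have := congrFun h0 j
      simpa [rx, hu2 i] using this
    rw [this] at h1
    simp at h1
  have hAc : IsCompact A := by
    refine (SS_compact m).inter_right ?_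
    have : {u : QQ r n | ∀ i, ip u i = 0} = ⋂ i, {u | ip u i = 0} := by ext; simp
    rw [this]
    exact isClosed_iInter fun i => isClosed_eq (continuous_ip i) continuous_const
  let A' : Set (GGs r s n) := (↑) ⁻¹' A
  have hA'c : IsCompact A' := by
    rw [Subtype.isCompact_iff, Subtype.image_preimage_coe, inter_eq_right.2 hAG]
    exact hAc
  have hGG : ∀ u ∈ GGs r s n, GGs r s n ∈ nhdsWithin u (SS m) := by
    intro u hu
    have hop : IsOpen {w : QQ r n | ∀ i, rx w i ≠ 0} := by
      have : {w : QQ r n | ∀ i, rx w i ≠ 0} = ⋂ i, {w | rx w i ≠ 0} := by ext; simp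
      rw [this]
      refine isOpen_iInter_of_finite fun i => ?_
      exact isOpen_ne_fun ((continuous_apply i).comp continuous_rx) continuous_const
    refine mem_nhdsWithin.2 ⟨_, hop, hu.2.2, ?_⟩
    rintro w ⟨hw1, hw2⟩
    exact ⟨(hSS2 w hw2).1, (hSS2 w hw2).2, hw1⟩
  obtain ⟨Kc, hKc, hKU, hKA⟩ := hA'c.finite_compact_cover Finset.univ
    (fun p => Thet h ⁻¹' (U p)) (fun p _ => (hU p).preimage (continuous_Thet h)) (by
      intro u _
      have : Thet h u ∈ ⋃ p, U p := by rw [hcov]; trivial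
      simpa using this)
  have hne : ∀ x : TCI n l s t, (tcF i₁ x).1 ≠ l := by
    rintro (x | ⟨i, x | x⟩)
    · exact hil
    · exact i.2
    · exact i.2
  have hf : ∀ p : Fin k, ∃ f : QQ r n → ℝ,
      (∀ q u, f (TT q u) = sg ((Pi.single (tcF i₁ (emb p)) 1 + Pi.single (l, (tcF i₁ (emb p)).2) 1 :
        Fin n × Bool → ZMod 2) q) * f u) ∧
      ∀ u ∈ Kc p, f u ≠ 0 ∧ ContinuousWithinAt f (SS m) u := by
    intro p
    have hne' := hne (emb p)
    generalize tcF i₁ (emb p) = ab at hne'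
    rcases ab with ⟨a, b⟩
    cases b
    · exact compare m (GGs r s n) TT_GGs hGG (Thet h) (continuous_Thet h) (Thet_TT h) (U p) (hU p)
        (Kc p) (hKc p) (hKU p) ⟨fun x => x.1.2, continuous_snd.comp continuous_subtype_val⟩
        (fun u i => ry h u i) (continuous_ry h) false (fun q u i => ry_TT h q u i)
        (fun u i => ⟨_, rfl⟩) a l hne' (hsec p a l)
    · exact compare m (GGs r s n) TT_GGs hGG (Thet h) (continuous_Thet h) (Thet_TT h) (U p) (hU p)
        (Kc p) (hKc p) (hKU p) ⟨fun x => x.1.1, continuous_fst.comp continuous_subtype_val⟩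
        (fun u i => rx u i) continuous_rx true (fun q u i => rx_TT q u i)
        (fun u i => ⟨_, rfl⟩) a l hne' (hsec p a l)
  choose f hf1 hf2 using hf
  let F : JJ n l s c t → QQ r n → ℝ := fun j => match j with
    | Sum.inl i => fun u => ip u i
    | Sum.inr (Sum.inl x) => if hx : ∃ p, emb p = x then f hx.choose else 0
    | Sum.inr (Sum.inr x) => 0
  obtain ⟨u, hu, hbu⟩ := borsukUlam2 m hmM (chi i₁) F (by
    rintro (i | x | x) q u hu
    · exact ip_TT q u i
    · by_cases hx : ∃ p, emb p = x
      · have e := hx.choose_spec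
        have := hf1 hx.choose q u
        rw [e] at this
        simp only [F, dif_pos hx, chi]
        exact this
      · simp [F, dif_neg hx]
    · simp [F]) (coeff_chi l i₁ hil s c t)
  have hip : ∀ i, ip u i = 0 := fun i => hbu (Sum.inl i) (continuous_ip i).continuousWithinAt
  have huA : u ∈ A := ⟨hu, hip⟩
  have huA' : (⟨u, hAG huA⟩ : GGs r s n) ∈ A' := huA
  rw [hKA] at huA'
  simp only [Finset.mem_univ, iUnion_true, mem_iUnion] at huA'
  obtain ⟨p, hp⟩ := huA'
  have hx : ∃ p', emb p' = emb p := ⟨p, rfl⟩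
  have hch : hx.choose = p := emb.injective hx.choose_spec
  have hFp : F (Sum.inr (Sum.inl (emb p))) = f p := by
    simp only [F, dif_pos hx, hch]
  have := hbu (Sum.inr (Sum.inl (emb p)))
  rw [hFp] at this
  exact (hf2 p _ hp).1 (this (hf2 p _ hp).2)

end Lower

end MilnorAux

set_option linter.unusedSectionVars false
set_option linter.unusedSimpArgs false

namespace MilnorAux

open scoped BigOperators Topology
open Set

section Miss

variable {m : ℕ}

lemma poly_approx {L : Type*} [TopologicalSpace L] [CompactSpace L] (κ : L → Fin m → ℝ)
    (hκ : Continuous κ) (hinj : Function.Injective κ) (ψ : L → Fin m → ℝ) (hψ : Continuous ψ)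
    (ε : ℝ) (hε : 0 < ε) :
    ∃ P : (Fin m → ℝ) → (Fin m → ℝ), ContDiff ℝ 1 P ∧ ∀ z, dist (P (κ z)) (ψ z) < ε := by
  let co : Fin m → C(L, ℝ) := fun j => ⟨fun z => κ z j, (continuous_apply j).comp hκ⟩
  let A : Subalgebra ℝ C(L, ℝ) := Algebra.adjoin ℝ (range co)
  have hA : A.SeparatesPoints := by
    intro x y hxy
    have : ∃ j, κ x j ≠ κ y j := by
      by_contra hcon
      push Not at hcon
      exact hxy (hinj (funext hcon))
    obtain ⟨j, hj⟩ := this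
    exact ⟨co j, ⟨co j, Algebra.subset_adjoin ⟨j, rfl⟩, rfl⟩, hj⟩
  have hpoly : ∀ f ∈ A, ∃ p : (Fin m → ℝ) → ℝ, ContDiff ℝ 1 p ∧ ∀ z, f z = p (κ z) := by
    intro f hf
    induction hf using Algebra.adjoin_induction with
    | mem x hx =>
      obtain ⟨j, rfl⟩ := hx
      exact ⟨fun v => v j, contDiff_apply ℝ ℝ j, fun z => rfl⟩
    | algebraMap c => exact ⟨fun _ => c, contDiff_const, fun z => by simp⟩
    | add x y _ _ hx hy =>
      obtain ⟨p, hp, hp'⟩ := hx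
      obtain ⟨q, hq, hq'⟩ := hy
      exact ⟨fun v => p v + q v, hp.add hq, fun z => by simp [hp', hq']⟩
    | mul x y _ _ hx hy =>
      obtain ⟨p, hp, hp'⟩ := hx
      obtain ⟨q, hq, hq'⟩ := hy
      exact ⟨fun v => p v * q v, hp.mul hq, fun z => by simp [hp', hq']⟩
  have : ∀ j, ∃ p : (Fin m → ℝ) → ℝ, ContDiff ℝ 1 p ∧ ∀ z, dist (p (κ z)) (ψ z j) < ε := by
    intro j
    obtain ⟨g, hg⟩ := ContinuousMap.exists_mem_subalgebra_near_continuous_of_separatesPoints A hA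
      (fun z => ψ z j) ((continuous_apply j).comp hψ) ε hε
    obtain ⟨p, hp, hp'⟩ := hpoly g g.2
    refine ⟨p, hp, fun z => ?_⟩
    rw [← hp', Real.dist_eq]
    exact hg z
  choose p hp hp' using this
  refine ⟨fun v j => p j v, contDiff_pi.2 hp, fun z => ?_⟩
  rw [dist_pi_lt_iff hε]
  exact fun j => hp' j z

lemma exists_regular (P : (Fin m → ℝ) → (Fin m → ℝ)) (hP : ContDiff ℝ 1 P) (ε : ℝ) (hε : 0 < ε) :
    ∃ c : Fin m → ℝ, ‖c‖ < ε ∧ ∀ x, P x = c → (fderiv ℝ P x).det ≠ 0 := by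
  by_contra hcon
  push Not at hcon
  let s : Set (Fin m → ℝ) := {x | (fderiv ℝ P x).det = 0}
  have h0 : MeasureTheory.volume (P '' s) = 0 :=
    MeasureTheory.addHaar_image_eq_zero_of_det_fderivWithin_eq_zero MeasureTheory.volume (f' := fderiv ℝ P)
      (fun x _ => (hP.differentiable one_ne_zero x).hasFDerivAt.hasFDerivWithinAt) (fun x hx => hx)
  have hsub : Metric.ball (0 : Fin m → ℝ) ε ⊆ P '' s := by
    intro c hc
    obtain ⟨x, hx, hx'⟩ := hcon c (by simpa using hc)
    exact ⟨x, hx', hx⟩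
  have := MeasureTheory.measure_mono_null hsub h0
  exact (Metric.measure_ball_pos MeasureTheory.volume (0 : Fin m → ℝ) hε).ne' this

lemma finite_zeros (P : (Fin m → ℝ) → (Fin m → ℝ)) (hP : ContDiff ℝ 1 P) (c : Fin m → ℝ)
    (hc : ∀ x, P x = c → (fderiv ℝ P x).det ≠ 0) (B : Set (Fin m → ℝ)) (hB : IsCompact B) :
    (B ∩ {x | P x = c}).Finite := by
  have hcomp : IsCompact (B ∩ {x | P x = c}) :=
    hB.inter_right (isClosed_eq hP.continuous continuous_const)
  refine hcomp.finite ?_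
  rw [isDiscrete_iff_nhdsNE]
  intro x hx
  have hd : HasFDerivAt P (fderiv ℝ P x) x := (hP.differentiable one_ne_zero x).hasFDerivAt
  have ha : ∃ C, AntilipschitzWith C (fderiv ℝ P x) := by
    refine ⟨_, ((fderiv ℝ P x).toContinuousLinearEquivOfDetNeZero (hc x hx.2)).antilipschitz⟩
  have := hd.eventually_ne (c := c) ha
  rw [← Filter.empty_mem_iff_bot, Filter.mem_inf_iff_superset]
  exact ⟨_, this, _, Filter.mem_principal_self _, fun z hz => hz.1 hz.2.2⟩

/-- The missing lemma: maps from a compact subset of `ℝ^m` with empty interior to `ℝ^m` can be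
perturbed off the origin. -/
lemma miss {L : Type*} [TopologicalSpace L] [CompactSpace L] (κ : L → Fin m → ℝ)
    (hκ : Continuous κ) (hinj : Function.Injective κ) (hinter : interior (range κ) = ∅)
    (ψ : L → Fin m → ℝ) (hψ : Continuous ψ) (ε : ℝ) (hε : 0 < ε) :
    ∃ ψ' : L → Fin m → ℝ, Continuous ψ' ∧ (∀ z, dist (ψ' z) (ψ z) < ε) ∧ ∀ z, ψ' z ≠ 0 := by
  obtain ⟨P, hP, hPψ⟩ := poly_approx κ hκ hinj ψ hψ (ε / 3) (by positivity)
  obtain ⟨c, hc, hcr⟩ := exists_regular P hP (ε / 3) (by positivity)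
  have hK : IsCompact (range κ) := isCompact_range hκ
  let B := Metric.cthickening 1 (range κ)
  have hB : IsCompact B := hK.cthickening
  have hfin := finite_zeros P hP c hcr B hB
  obtain ⟨δ, hδ, hδ'⟩ := Metric.uniformContinuousOn_iff.1
    (hB.uniformContinuousOn_of_continuous hP.continuous.continuousOn) (ε / 3) (by positivity)
  -- choose the shift
  have hnd : ∀ z : Fin m → ℝ, IsClosed ((fun x => z - x) '' range κ) ∧
      interior ((fun x => z - x) '' range κ) = ∅ := by
    intro z
    refine ⟨(hK.image (by fun_prop)).isClosed, ?_⟩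
    have := (Homeomorph.subLeft z).image_interior (range κ)
    rw [hinter, image_empty] at this
    exact this.symm
  obtain ⟨a, ha, haz⟩ : ∃ a : Fin m → ℝ, ‖a‖ < min δ 1 ∧
      ∀ z ∈ B ∩ {x | P x = c}, a ∉ (fun x => z - x) '' range κ := by
    have hclos : ∀ S : Set (Fin m → ℝ), S.Finite →
        IsClosed (⋃ z ∈ S, (fun x => z - x) '' range κ) ∧
        interior (⋃ z ∈ S, (fun x => z - x) '' range κ) = ∅ := by
      intro S hS
      induction S, hS using Set.Finite.induction_on with
      | empty => simp
      | insert _ _ ih =>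
        rw [biUnion_insert]
        exact ⟨(hnd _).1.union ih.1, by
          rw [interior_union_isClosed_of_interior_empty (hnd _).1 ih.2]; exact (hnd _).2⟩
    have h2 := (hclos _ hfin).2
    by_contra hcon
    push Not at hcon
    have : Metric.ball (0 : Fin m → ℝ) (min δ 1) ⊆
        interior (⋃ z ∈ B ∩ {x | P x = c}, (fun x => z - x) '' range κ) := by
      refine interior_maximal ?_ Metric.isOpen_ball
      intro a ha
      obtain ⟨z, hz, hz'⟩ := hcon a (by simpa using ha)
      exact mem_biUnion hz hz'
    rw [h2] at this
    exact this (Metric.mem_ball_self (lt_min hδ one_pos))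
  have hmemB : ∀ z, κ z + a ∈ B := by
    intro z
    refine Metric.mem_cthickening_of_dist_le _ (κ z) _ _ ⟨z, rfl⟩ ?_
    simpa using (ha.trans_le (min_le_right _ _)).le
  have hmemB' : ∀ z, κ z ∈ B := fun z => Metric.self_subset_cthickening _ ⟨z, rfl⟩
  refine ⟨fun z => P (κ z + a) - c, ?_, fun z => ?_, fun z h0 => ?_⟩
  · exact (hP.continuous.comp (hκ.add continuous_const)).sub continuous_const
  · have h1 : dist (P (κ z + a)) (P (κ z)) < ε / 3 :=
      hδ' _ (hmemB z) _ (hmemB' z) (by simpa using ha.trans_le (min_le_left _ _))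
    have h2 := hPψ z
    have h3 : dist (P (κ z + a) - c) (P (κ z + a)) < ε / 3 := by simpa using hc
    calc _ ≤ dist (P (κ z + a) - c) (P (κ z + a)) + dist (P (κ z + a)) (P (κ z)) +
          dist (P (κ z)) (ψ z) := dist_triangle4 _ _ _ _
      _ < ε := by linarith
  · exact haz (κ z + a) ⟨hmemB z, sub_eq_zero.1 h0⟩ ⟨κ z, ⟨z, rfl⟩, by simp⟩

end Miss

end MilnorAux

set_option linter.unusedSectionVars false
set_option linter.unusedSimpArgs false

namespace MilnorAux

open scoped BigOperators Topology
open Set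

section Cover

variable {m : ℕ} {Z : Type*} [TopologicalSpace Z] [CompactSpace Z] [T2Space Z]
  {ι : Type*} [Fintype ι]

/-- Tuples whose coordinates indexed by `a` are not all equal. -/
def OO (a : Fin (m + 1) ↪ ι) : Set (ι → ℝ) := {x | ∃ j : Fin m, x (a j.succ) ≠ x (a 0)}

lemma isOpen_OO (a : Fin (m + 1) ↪ ι) : IsOpen (OO a) := by
  have : OO a = ⋃ j : Fin m, {x : ι → ℝ | x (a j.succ) ≠ x (a 0)} := by ext; simp [OO]
  rw [this]
  exact isOpen_iUnion fun j => isOpen_ne_fun (continuous_apply _) (continuous_apply _)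

lemma dense_OO (a : Fin (m + 1) ↪ ι) (L : Set Z) (hL : IsClosed L) (κ : Z → Fin m → ℝ)
    (hκ : ContinuousOn κ L) (hinj : InjOn κ L) (hinter : interior (κ '' L) = ∅) :
    Dense {f : C(Z, ι → ℝ) | MapsTo f L (OO a)} := by
  classical
  rw [Metric.dense_iff]
  intro f ε hε
  have : CompactSpace L := isCompact_iff_compactSpace.1 hL.isCompact
  let ψ : L → Fin m → ℝ := fun z j => f z (a j.succ) - f z (a 0)
  have hfc : ∀ i, Continuous (fun z : L => f z i) := fun i =>
    (continuous_apply i).comp (f.continuous.comp continuous_subtype_val)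
  have hψ : Continuous ψ := continuous_pi fun j => (hfc _).sub (hfc _)
  obtain ⟨ψ', hψ', hd, hne⟩ := miss (L.domRestrict κ) (continuousOn_iff_continuous_domRestrict.1 hκ)
    (injOn_iff_injective.1 hinj) (by rw [range_domRestrict]; exact hinter) ψ hψ (ε / 2) (by positivity)
  have hext : ∀ j : Fin m, ∃ g : C(Z, ℝ), (∀ z, g z ∈ Icc (-(ε / 2)) (ε / 2)) ∧
      ∀ z : L, g z = ψ' z j - ψ z j := by
    intro j
    obtain ⟨g, hg1, hg2⟩ := ContinuousMap.exists_restrict_eq_forall_mem_of_closed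
      (⟨fun z : L => ψ' z j - ψ z j, ((continuous_apply j).comp hψ').sub
        ((continuous_apply j).comp hψ)⟩ : C(L, ℝ)) (t := Icc (-(ε / 2)) (ε / 2)) (by
        intro z
        have h1 := (dist_le_pi_dist (ψ' z) (ψ z) j).trans_lt (hd z)
        rw [Real.dist_eq] at h1
        have := abs_lt.1 h1
        exact ⟨this.1.le, this.2.le⟩) ⟨0, by constructor <;> linarith⟩ hL
    exact ⟨g, hg1, fun z => DFunLike.congr_fun hg2 z⟩
  choose g hg1 hg2 using hext
  let η : Z → ι → ℝ := fun z i => if h : ∃ j : Fin m, a j.succ = i then g h.choose z else 0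
  have hηc : Continuous η := by
    refine continuous_pi fun i => ?_
    by_cases h : ∃ j : Fin m, a j.succ = i
    · simp only [η, dif_pos h]; exact (g _).continuous
    · simp only [η, dif_neg h]; exact continuous_const
  have hη1 : ∀ z (j : Fin m), η z (a j.succ) = g j z := by
    intro z j
    have h : ∃ j' : Fin m, a j'.succ = a j.succ := ⟨j, rfl⟩
    have : h.choose = j := Fin.succ_injective _ (a.injective h.choose_spec)
    simp only [η, dif_pos h, this]
  have hη0 : ∀ z, η z (a 0) = 0 := by
    intro z
    have h : ¬ ∃ j' : Fin m, a j'.succ = a 0 := by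
      rintro ⟨j, hj⟩
      exact (Fin.succ_ne_zero j) (a.injective hj)
    simp only [η, dif_neg h]
  have hηb : ∀ z i, |η z i| ≤ ε / 2 := by
    intro z i
    by_cases h : ∃ j : Fin m, a j.succ = i
    · simp only [η, dif_pos h]; exact abs_le.2 (hg1 _ z)
    · simp only [η, dif_neg h]; simp; positivity
  refine ⟨⟨fun z => f z + η z, f.continuous.add hηc⟩, ?_, ?_⟩
  · rw [Metric.mem_ball, ContinuousMap.dist_lt_iff hε]
    intro z
    simp only [ContinuousMap.coe_mk, dist_self_add_left]
    refine lt_of_le_of_lt ?_ (half_lt_self hε)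
    rw [pi_norm_le_iff_of_nonneg (by positivity)]
    exact hηb z
  · intro z hz
    obtain ⟨j, hj⟩ : ∃ j, ψ' ⟨z, hz⟩ j ≠ 0 := by
      by_contra hcon
      push Not at hcon
      exact hne _ (funext hcon)
    refine ⟨j, fun e => hj ?_⟩
    simp only [ContinuousMap.coe_mk, Pi.add_apply, hη1, hη0, add_zero] at e
    have h2 := hg2 j ⟨z, hz⟩
    simp only [ψ] at h2
    linarith

lemma exists_cover (U : ι → Set Z) (hU : ∀ i, IsOpen (U i)) (hcov : (⋃ i, U i) = univ)
    (κ : ι → Z → Fin m → ℝ) (hκ : ∀ i, ContinuousOn (κ i) (U i)) (hinj : ∀ i, InjOn (κ i) (U i))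
    (hinter : ∀ i, interior (κ i '' U i) = ∅) :
    ∃ V : Finset ι → Set Z, (∀ A, IsOpen (V A)) ∧ (∀ A, ∀ a ∈ A, V A ⊆ U a) ∧
      (∀ A B, A.card = B.card → A ≠ B → Disjoint (V A) (V B)) ∧
      ∀ z, ∃ A, A.Nonempty ∧ A.card ≤ m ∧ z ∈ V A := by
  classical
  obtain ⟨C, hC, hCc, hCU⟩ := exists_iUnion_eq_closed_subset hU (fun _ => toFinite _) hcov
  have hφ : ∀ i, ∃ φ : C(Z, ℝ), EqOn φ 0 (U i)ᶜ ∧ EqOn φ 1 (C i) ∧ ∀ z, φ z ∈ Icc (0 : ℝ) 1 :=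
    fun i => exists_continuous_zero_one_of_isClosed (hU i).isClosed_compl (hCc i)
      (disjoint_compl_left_iff_subset.2 (hCU i))
  choose φ hφ0 hφ1 hφI using hφ
  let Φ : C(Z, ι → ℝ) := ⟨fun z i => φ i z, continuous_pi fun i => (φ i).continuous⟩
  let L : (Fin (m + 1) ↪ ι) → Set Z := fun a => {z | ∀ j, 1 / 4 ≤ φ (a j) z}
  have hLc : ∀ a, IsClosed (L a) := by
    intro a
    have : L a = ⋂ j, {z | 1 / 4 ≤ φ (a j) z} := by ext; simp [L]
    rw [this]
    exact isClosed_iInter fun j => isClosed_le continuous_const (φ _).continuous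
  have hpos : ∀ i z, 0 < φ i z → z ∈ U i := by
    intro i z h
    by_contra hz
    have := hφ0 i hz
    simp only [Pi.zero_apply] at this
    linarith
  have hLU : ∀ a, L a ⊆ U (a 0) := fun a z hz => hpos _ _ (lt_of_lt_of_le (by norm_num) (hz 0))
  have hdense : Dense (⋂ a : Fin (m + 1) ↪ ι, {f : C(Z, ι → ℝ) | MapsTo f (L a) (OO a)}) := by
    refine dense_iInter_of_isOpen (fun a => ?_) (fun a => ?_)
    · exact ContinuousMap.isOpen_setOfPred_mapsTo (hLc a).isCompact (isOpen_OO a)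
    · refine dense_OO a (L a) (hLc a) (κ (a 0)) ((hκ _).mono (hLU a)) ((hinj _).mono (hLU a)) ?_
      exact subset_eq_empty (interior_mono (image_mono (hLU a))) (hinter _)
  obtain ⟨f, hf, hfd⟩ := Metric.dense_iff.1 hdense Φ (1 / 4) (by norm_num)
  rw [Metric.mem_ball, ContinuousMap.dist_lt_iff (by norm_num)] at hf
  have hfφ : ∀ z i, |f z i - φ i z| < 1 / 4 := by
    intro z i
    have := (dist_le_pi_dist (f z) (Φ z) i).trans_lt (hf z)
    exact this
  simp only [mem_iInter] at hfd
  have hfc : ∀ i, Continuous (fun z => f z i) := fun i => (continuous_apply i).comp f.continuous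
  refine ⟨fun A => {z | ∀ a ∈ A, 1 / 2 < f z a ∧ ∀ b, b ∉ A → f z b < f z a}, fun A => ?_,
    fun A a ha z hz => ?_, fun A B hAB hne => ?_, fun z => ?_⟩
  · have : {z | ∀ a ∈ A, 1 / 2 < f z a ∧ ∀ b, b ∉ A → f z b < f z a} =
        ⋂ a : A, ({z | 1 / 2 < f z a} ∩ ⋂ b : {b // b ∉ A}, {z | f z b < f z a}) := by
      ext z; simp
    beta_reduce
    rw [this]
    exact isOpen_iInter_of_finite fun a => (isOpen_lt continuous_const (hfc _)).inter
      (isOpen_iInter_of_finite fun b => isOpen_lt (hfc _) (hfc _))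
  · apply hpos
    have h1 := (hz a ha).1
    have h2 := abs_lt.1 (hfφ z a)
    linarith [h2.2]
  · rw [Set.disjoint_left]
    intro z hzA hzB
    obtain ⟨a, ha, ha'⟩ : ∃ a ∈ A, a ∉ B := by
      by_contra hcon
      push Not at hcon
      exact hne (Finset.eq_of_subset_of_card_le hcon hAB.ge)
    obtain ⟨b, hb, hb'⟩ : ∃ b ∈ B, b ∉ A := by
      by_contra hcon
      push Not at hcon
      exact hne (Finset.eq_of_subset_of_card_le hcon hAB.le).symm
    exact lt_asymm ((hzA a ha).2 b hb') ((hzB b hb).2 a ha')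
  · have hz : z ∈ ⋃ i, C i := by rw [hC]; trivial
    obtain ⟨i₀, hi₀⟩ := mem_iUnion.1 hz
    have : Nonempty ι := ⟨i₀⟩
    obtain ⟨M, hM⟩ := Finite.exists_max (fun i => f z i)
    have hbig : 1 / 2 < f z M := by
      have h1 := hφ1 i₀ hi₀
      simp only [Pi.one_apply] at h1
      have h2 := abs_lt.1 (hfφ z i₀)
      have := hM i₀
      linarith [h2.1]
    let A : Finset ι := Finset.univ.filter fun i => f z i = f z M
    have hA : ∀ i, i ∈ A ↔ f z i = f z M := fun i => by simp [A]
    refine ⟨A, ⟨M, (hA M).2 rfl⟩, ?_, ?_⟩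
    · by_contra hcard
      push Not at hcard
      have : Fintype.card (Fin (m + 1)) ≤ Fintype.card A := by simpa using hcard
      obtain ⟨e⟩ := Function.Embedding.nonempty_of_card_le this
      let a : Fin (m + 1) ↪ ι := e.trans (Function.Embedding.subtype _)
      have ha : ∀ j, f z (a j) = f z M := fun j => (hA _).1 (e j).2
      obtain ⟨j, hj⟩ := hfd a (show z ∈ L a from fun j => by
        have h2 := abs_lt.1 (hfφ z (a j))
        have := ha j
        linarith [h2.2])
      exact hj (by rw [ha, ha])
    · intro a ha
      rw [hA] at ha
      refine ⟨by rw [ha]; exact hbig, fun b hb => ?_⟩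
      rw [hA] at hb
      rw [ha]
      exact lt_of_le_of_ne (hM b) hb

end Cover

end MilnorAux

set_option linter.unusedSectionVars false
set_option linter.unusedSimpArgs false

namespace MilnorAux

open scoped BigOperators Topology
open Set

section Slice

variable {Y : Type*} [TopologicalSpace Y] [CompactSpace Y] [T2Space Y] [MulAction Circle Y]
  [ContinuousSMul Circle Y]

lemma exists_equivariant (hfree : ∀ (g : Circle) (x : Y), g • x = x → g = 1) (y : Y) :
    ∃ F : Y → ℂ, Continuous F ∧ (∀ (g : Circle) v, F (g • v) = (g : ℂ) * F v) ∧ F y ≠ 0 := by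
  let _ : MeasurableSpace Circle := borel Circle
  have : BorelSpace Circle := ⟨rfl⟩
  let μ : MeasureTheory.Measure Circle := MeasureTheory.Measure.haar
  let N : Set Circle := {g | (g : ℂ).re ≤ 0}
  have hN : IsClosed N := isClosed_le (Complex.continuous_re.comp continuous_subtype_val) continuous_const
  let T : Set Y := (fun g : Circle => g⁻¹ • y) '' N
  have hT : IsClosed T := (hN.isCompact.image
    ((continuous_inv).smul (continuous_const : Continuous fun _ : Circle => y))).isClosed
  have hyT : y ∉ T := by
    rintro ⟨g, hg, e⟩
    have := hfree g⁻¹ y e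
    have : g = 1 := by simpa using this
    subst this
    simp [N] at hg
    linarith
  obtain ⟨h, h0, h1, hI⟩ := exists_continuous_zero_one_of_isClosed hT (isClosed_singleton (x := y))
    (disjoint_singleton_right.2 hyT)
  let E : C(Y × Circle, ℂ) := ⟨fun p => ((h (p.2⁻¹ • p.1) : ℝ) : ℂ) * (p.2 : ℂ),
    (Complex.continuous_ofReal.comp (h.continuous.comp ((continuous_snd.inv).smul continuous_fst))).mul
      (continuous_subtype_val.comp continuous_snd)⟩
  have hinter : ∀ f : C(Circle, ℂ), MeasureTheory.Integrable f μ := fun f =>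
    f.continuous.integrable_of_hasCompactSupport (HasCompactSupport.of_compactSpace _)
  have hIc : Continuous (fun f : C(Circle, ℂ) => ∫ g, f g ∂μ) := by
    refine LipschitzWith.continuous (K := (μ.real univ).toNNReal) ?_
    refine LipschitzWith.of_dist_le_mul fun f g => ?_
    rw [dist_eq_norm, ← MeasureTheory.integral_sub (hinter f) (hinter g), Real.coe_toNNReal _ (by positivity),
      mul_comm]
    refine MeasureTheory.norm_integral_le_of_norm_le_const (Filter.Eventually.of_forall fun x => ?_)
    rw [← dist_eq_norm]
    exact ContinuousMap.dist_apply_le_dist x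
  refine ⟨fun v => ∫ g, E.curry v g ∂μ, hIc.comp E.curry.continuous, fun k v => ?_, fun h00 => ?_⟩
  · beta_reduce
    rw [← MeasureTheory.integral_mul_left_eq_self _ k, ← MeasureTheory.integral_const_mul]
    congr 1
    ext g
    simp only [ContinuousMap.curry_apply, E, ContinuousMap.coe_mk]
    rw [smul_smul]
    have : (k * g)⁻¹ * k = g⁻¹ := by group
    rw [this]
    push_cast
    ring
  · have hre : (∫ g, E.curry y g ∂μ).re = ∫ g, (E.curry y g).re ∂μ := by
      have := integral_re (hinter (E.curry y))
      simpa using this.symm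
    have hpos : 0 < ∫ g, (E.curry y g).re ∂μ := by
      refine Continuous.integral_pos_of_hasCompactSupport_nonneg_nonzero (x := (1 : Circle))
        (Complex.continuous_re.comp (E.curry y).continuous) (HasCompactSupport.of_compactSpace _) ?_ ?_
      · intro g
        simp only [ContinuousMap.curry_apply, E, ContinuousMap.coe_mk, Complex.re_ofReal_mul,
          Pi.zero_apply]
        by_cases hg : g ∈ N
        · have := h0 (show g⁻¹ • y ∈ T from ⟨g, hg, rfl⟩)
          simp only [Pi.zero_apply] at this
          simp [this]
        · have : 0 < (g : ℂ).re := not_le.1 hg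
          exact mul_nonneg (hI _).1 this.le
      · have := h1 (mem_singleton y)
        simp only [Pi.one_apply] at this
        simp [E, this]
    beta_reduce at h00
    rw [← hre, h00] at hpos
    simp at hpos

/-- The local trivialization map. -/
lemma exists_theta (hfree : ∀ (g : Circle) (x : Y), g • x = x → g = 1) (y : Y) :
    ∃ (D : Set Y) (θ : Y → Circle), IsOpen D ∧ y ∈ D ∧ (∀ (g : Circle), ∀ v ∈ D, g • v ∈ D) ∧
      ContinuousOn θ D ∧ (∀ (g : Circle), ∀ v ∈ D, θ (g • v) = g * θ v) ∧ θ y = 1 := by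
  classical
  obtain ⟨F, hF, hFg, hFy⟩ := exists_equivariant hfree y
  let D : Set Y := {v | F v ≠ 0}
  have hn : ∀ v ∈ D, ‖F v / ‖F v‖‖ = 1 := by
    intro v hv
    have : ‖F v‖ ≠ 0 := norm_ne_zero_iff.2 hv
    simp [this]
  have hex : ∀ v ∈ D, ∃ c : Circle, (c : ℂ) = F v / ‖F v‖ := fun v hv =>
    ⟨⟨F v / ‖F v‖, mem_sphere_zero_iff_norm.2 (hn v hv)⟩, rfl⟩
  let θ₀ : Y → Circle := fun v => if hv : v ∈ D then (hex v hv).choose else 1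
  have hD : ∀ (g : Circle), ∀ v ∈ D, g • v ∈ D := by
    intro g v hv
    change F (g • v) ≠ 0
    rw [hFg]
    exact mul_ne_zero (Circle.coe_ne_zero g) hv
  have hθ₀ : ∀ v ∈ D, (θ₀ v : ℂ) = F v / ‖F v‖ := by
    intro v hv
    simp only [θ₀, dif_pos hv]
    exact (hex v hv).choose_spec
  refine ⟨D, fun v => θ₀ v * (θ₀ y)⁻¹, isOpen_ne_fun hF continuous_const, hFy, hD, ?_, ?_, by simp⟩
  · refine ContinuousOn.mul ?_ continuousOn_const
    have hi : Topology.IsInducing (fun c : Circle => (c : ℂ)) := Topology.IsInducing.subtypeVal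
    rw [hi.continuousOn_iff]
    have : ContinuousOn (fun v => F v / (‖F v‖ : ℂ)) D := by
      refine hF.continuousOn.div (Complex.continuous_ofReal.comp hF.norm).continuousOn ?_
      intro v hv
      have hv' : F v ≠ 0 := hv
      simpa using hv'
    exact this.congr fun v hv => hθ₀ v hv
  · intro g v hv
    have : θ₀ (g • v) = g * θ₀ v := by
      apply Circle.ext
      rw [hθ₀ _ (hD g v hv), Circle.coe_mul, hθ₀ v hv, hFg]
      rw [norm_mul, Circle.norm_coe, one_mul, mul_div_assoc]
    simp only [this, mul_assoc]

end Slice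

end MilnorAux

set_option linter.unusedSectionVars false
set_option linter.unusedSimpArgs false

namespace MilnorAux

open scoped BigOperators Topology
open Set

section Glue

variable {Y : Type*} [TopologicalSpace Y] [CompactSpace Y] [T2Space Y] [MulAction Circle Y]
  [ContinuousSMul Circle Y] {T : Type*} [TopologicalSpace T] [MulAction Circle T]
  [ContinuousSMul Circle T] {m : ℕ}

lemma exists_circle_ne_one {s : Set Circle} (hs : s ∈ 𝓝 (1 : Circle)) : ∃ g ∈ s, g ≠ 1 := by
  have hc : Filter.Tendsto (fun t : ℝ => Circle.exp t) (𝓝[≠] 0) (𝓝 1) := by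
    have : Filter.Tendsto (fun t : ℝ => Circle.exp t) (𝓝 0) (𝓝 (Circle.exp 0)) :=
      Circle.exp.continuous.tendsto 0
    rw [Circle.exp_zero] at this
    exact this.mono_left nhdsWithin_le_nhds
  have h1 : ∀ᶠ t : ℝ in 𝓝[≠] 0, Circle.exp t ∈ s := hc hs
  have h2 : ∀ᶠ t : ℝ in 𝓝[≠] 0, t ∈ Ioo (-Real.pi) Real.pi :=
    nhdsWithin_le_nhds (Ioo_mem_nhds (by linarith [Real.pi_pos]) Real.pi_pos)
  have h3 : ∀ᶠ t : ℝ in 𝓝[≠] 0, t ≠ 0 := self_mem_nhdsWithin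
  obtain ⟨t, ht1, ht2, ht3⟩ := (h1.and (h2.and h3)).exists
  refine ⟨_, ht1, fun e => ht3 ?_⟩
  rw [← Circle.exp_zero] at e
  exact Circle.exp_injOn_Ioc (a := -Real.pi) (b := Real.pi) (by linarith) ⟨ht2.1, ht2.2.le⟩ ⟨by linarith [Real.pi_pos],
    Real.pi_pos.le⟩ e

lemma local_data (hfree : ∀ (g : Circle) (x : Y), g • x = x → g = 1) (π : T → Y)
    (hπ : ∀ (g : Circle) γ, π (g • γ) = g • π γ) (y : Y)
    (B : Set Y) (hB : IsOpen B) (hyB : y ∈ B) (e : Y → Fin m → ℝ) (he : ContinuousOn e B)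
    (hinj : InjOn e B) (ζ : Y → T) (hζ : ContinuousOn ζ B) (hζπ : ∀ v ∈ B, π (ζ v) = v) :
    ∃ (U : Set Y) (κ : Y → Fin m → ℝ) (ζ' : Y → T), IsOpen U ∧ y ∈ U ∧
      (∀ (g : Circle), ∀ v ∈ U, g • v ∈ U) ∧ ContinuousOn κ U ∧
      (∀ (g : Circle), ∀ v ∈ U, κ (g • v) = κ v) ∧
      (∀ v ∈ U, ∀ w ∈ U, κ v = κ w → ∃ g : Circle, g • v = w) ∧ interior (κ '' U) = ∅ ∧
      ContinuousOn ζ' U ∧ (∀ (g : Circle), ∀ v ∈ U, ζ' (g • v) = g • ζ' v) ∧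
      ∀ v ∈ U, π (ζ' v) = v := by
  obtain ⟨D, θ, hD, hyD, hDg, hθ, hθg, hθy⟩ := exists_theta hfree y
  let ρ : Y → Y := fun v => (θ v)⁻¹ • v
  have hρ : ContinuousOn ρ D := hθ.inv.smul continuousOn_id
  have hρg : ∀ (g : Circle), ∀ v ∈ D, ρ (g • v) = ρ v := by
    intro g v hv
    simp only [ρ, hθg g v hv, smul_smul]
    congr 1
    group
  let U : Set Y := D ∩ ρ ⁻¹' B
  have hUD : U ⊆ D := inter_subset_left
  have hmap : MapsTo ρ U B := fun v hv => hv.2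
  have hUg : ∀ (g : Circle), ∀ v ∈ U, g • v ∈ U := fun g v hv =>
    ⟨hDg g v hv.1, by change ρ (g • v) ∈ B; rw [hρg g v hv.1]; exact hv.2⟩
  refine ⟨U, fun v => e (ρ v), fun v => θ v • ζ (ρ v), hρ.isOpen_inter_preimage hD hB,
    ⟨hyD, by simpa [ρ, hθy] using hyB⟩, hUg, he.comp (hρ.mono hUD) hmap,
    fun g v hv => by simp only [hρg g v hv.1], ?_, ?_,
    (hθ.mono hUD).smul (hζ.comp (hρ.mono hUD) hmap), ?_, ?_⟩
  · intro v hv w hw h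
    have : ρ v = ρ w := hinj hv.2 hw.2 h
    refine ⟨θ w * (θ v)⁻¹, ?_⟩
    rw [mul_smul]
    change θ w • ρ v = w
    rw [this]
    exact smul_inv_smul _ _
  · by_contra hne
    obtain ⟨c, hc⟩ := nonempty_iff_ne_empty.2 hne
    obtain ⟨v, hv, hvc⟩ := interior_subset hc
    beta_reduce at hvc
    -- the point `a = ρ v` lies in the slice
    have hθρ : ∀ w ∈ U, θ (ρ w) = 1 := by
      intro w hw
      simp only [ρ]
      rw [hθg _ _ hw.1]
      simp
    have haB : ρ v ∈ B := hv.2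
    have hcont : Filter.Tendsto (fun g : Circle => g • ρ v) (𝓝 1) (𝓝 (ρ v)) := by
      have : Filter.Tendsto (fun g : Circle => g • ρ v) (𝓝 1) (𝓝 ((1 : Circle) • ρ v)) :=
        ((continuous_id.smul continuous_const : Continuous fun g : Circle => g • ρ v)).tendsto 1
      rwa [one_smul] at this
    have hO : IsOpen (B ∩ e ⁻¹' interior ((fun v => e (ρ v)) '' U)) :=
      he.isOpen_inter_preimage hB isOpen_interior
    have hmem : ρ v ∈ B ∩ e ⁻¹' interior ((fun v => e (ρ v)) '' U) :=
      ⟨haB, by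
        change e (ρ v) ∈ interior ((fun v => e (ρ v)) '' U)
        rw [hvc]; exact hc⟩
    obtain ⟨g, hg, hg1⟩ := exists_circle_ne_one (hcont (hO.mem_nhds hmem))
    obtain ⟨hgB, hgO⟩ := hg
    obtain ⟨w, hw, hwe⟩ := interior_subset hgO
    have hwg : ρ w = g • ρ v := hinj hw.2 hgB hwe
    have h1 := hθρ w hw
    have hρvD : ρ v ∈ D := hDg _ _ hv.1
    rw [hwg, hθg g _ hρvD, hθρ v hv, mul_one] at h1
    exact hg1 h1
  · intro g v hv
    simp only [hρg g v hv.1, hθg g v hv.1, mul_smul]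
  · intro v hv
    simp only [hπ, hζπ _ hv.2]
    exact smul_inv_smul _ _

lemma exists_sections [Nonempty T] (hfree : ∀ (g : Circle) (x : Y), g • x = x → g = 1) (π : T → Y)
    (hπ : ∀ (g : Circle) γ, π (g • γ) = g • π γ)
    (hloc : ∀ y : Y, ∃ B : Set Y, IsOpen B ∧ y ∈ B ∧ (∃ e : Y → Fin m → ℝ, ContinuousOn e B ∧
      InjOn e B) ∧ ∃ ζ : Y → T, ContinuousOn ζ B ∧ ∀ v ∈ B, π (ζ v) = v) :
    ∃ W : Fin m → Set Y, (∀ j, IsOpen (W j)) ∧ (⋃ j, W j) = univ ∧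
      (∀ j (g : Circle), ∀ v ∈ W j, g • v ∈ W j) ∧
      ∀ j, ∃ ζ : Y → T, ContinuousOn ζ (W j) ∧ (∀ (g : Circle), ∀ v ∈ W j, ζ (g • v) = g • ζ v) ∧
        ∀ v ∈ W j, π (ζ v) = v := by
  classical
  have hdat : ∀ y : Y, ∃ (U : Set Y) (κ : Y → Fin m → ℝ) (ζ' : Y → T), IsOpen U ∧ y ∈ U ∧
      (∀ (g : Circle), ∀ v ∈ U, g • v ∈ U) ∧ ContinuousOn κ U ∧
      (∀ (g : Circle), ∀ v ∈ U, κ (g • v) = κ v) ∧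
      (∀ v ∈ U, ∀ w ∈ U, κ v = κ w → ∃ g : Circle, g • v = w) ∧ interior (κ '' U) = ∅ ∧
      ContinuousOn ζ' U ∧ (∀ (g : Circle), ∀ v ∈ U, ζ' (g • v) = g • ζ' v) ∧
      ∀ v ∈ U, π (ζ' v) = v := by
    intro y
    obtain ⟨B, hB, hyB, ⟨e, he, hinj⟩, ζ, hζ, hζπ⟩ := hloc y
    exact local_data hfree π hπ y B hB hyB e he hinj ζ hζ hζπ
  choose U κ ζ hU hyU hUg hκ hκg hκinj hκint hζ hζg hζπ using hdat
  let Z := MulAction.orbitRel.Quotient Circle Y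
  let p : Y → Z := Quotient.mk (MulAction.orbitRel Circle Y)
  have hp : IsOpenQuotientMap p := MulAction.isOpenQuotientMap_quotientMk
  have hpe : ∀ v w, p v = p w ↔ ∃ g : Circle, g • v = w := by
    intro v w
    constructor
    · intro h
      obtain ⟨g, hg⟩ : v ∈ MulAction.orbit Circle w := Quotient.exact h
      refine ⟨g⁻¹, ?_⟩
      rw [← hg]
      exact inv_smul_smul _ _
    · rintro ⟨g, rfl⟩
      exact (Quotient.sound (show g • v ∈ MulAction.orbit Circle v from ⟨g, rfl⟩)).symm
  have hT2 : T2Space Z := by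
    rw [t2Space_iff_of_isOpenQuotientMap hp]
    have : {q : Y × Y | p q.1 = p q.2} = range (fun x : Circle × Y => (x.2, x.1 • x.2)) := by
      ext ⟨v, w⟩
      simp only [Set.mem_ofPred_eq, hpe, mem_range, Prod.mk.injEq, Prod.exists]
      constructor
      · rintro ⟨g, h⟩; exact ⟨g, v, rfl, h⟩
      · rintro ⟨g, v, rfl, h⟩; exact ⟨g, h⟩
    rw [this]
    exact (isCompact_range (continuous_snd.prodMk (continuous_fst.smul continuous_snd))).isClosed
  have hcZ : CompactSpace Z := ⟨by
    rw [← hp.surjective.range_eq]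
    exact isCompact_range hp.continuous⟩
  have hpU : ∀ y v, p v ∈ p '' U y → v ∈ U y := by
    rintro y v ⟨w, hw, hwv⟩
    obtain ⟨g, rfl⟩ := (hpe w v).1 hwv
    exact hUg y g w hw
  obtain ⟨t, ht⟩ := (isCompact_univ : IsCompact (univ : Set Y)).elim_finite_subcover U hU
    (fun y _ => mem_iUnion.2 ⟨y, hyU y⟩)
  let κ' : t → Z → Fin m → ℝ := fun i z =>
    if h : ∃ v ∈ U i, p v = z then κ i h.choose else 0
  have hκ' : ∀ (i : t), ∀ v ∈ U i, κ' i (p v) = κ i v := by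
    intro i v hv
    have h : ∃ w ∈ U i, p w = p v := ⟨v, hv, rfl⟩
    simp only [κ', dif_pos h]
    obtain ⟨g, hg⟩ := (hpe _ _).1 h.choose_spec.2
    have h2 := hκg i g _ h.choose_spec.1
    rw [hg] at h2
    exact h2.symm
  obtain ⟨V, hV, hVU, hVd, hVc⟩ := exists_cover (fun i : t => p '' U i) (fun i => hp.isOpenMap _ (hU i))
    (by
      rw [eq_univ_iff_forall]
      intro z
      obtain ⟨v, rfl⟩ := hp.surjective z
      have := ht (mem_univ v)
      simp only [mem_iUnion] at this
      obtain ⟨y, hy, hv⟩ := this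
      exact mem_iUnion.2 ⟨⟨y, hy⟩, v, hv, rfl⟩) κ' (by
      rintro i z ⟨v, hv, rfl⟩
      refine ContinuousAt.continuousWithinAt ?_
      rw [← hp.continuousAt_comp_iff]
      refine ((hκ i).continuousAt ((hU i).mem_nhds hv)).congr ?_
      filter_upwards [(hU i).mem_nhds hv] with w hw
      exact (hκ' i w hw).symm) (by
      rintro i _ ⟨v, hv, rfl⟩ _ ⟨w, hw, rfl⟩ h
      rw [hκ' i v hv, hκ' i w hw] at h
      exact (hpe _ _).2 (hκinj i v hv w hw h)) (by
      intro i
      have : κ' i '' (p '' U i) = κ i '' U i := by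
        rw [image_image]
        exact image_congr (hκ' i)
      rw [this]
      exact hκint i)
  let S : Fin m → Finset t → Prop := fun j A => A.card = j + 1
  have hne : ∀ j A, S j A → A.Nonempty := fun j A h => Finset.card_pos.1 (by rw [h]; omega)
  have hpg : ∀ (g : Circle) v, p (g • v) = p v := fun g v => ((hpe v (g • v)).2 ⟨g, rfl⟩).symm
  refine ⟨fun j => {v | ∃ A, S j A ∧ p v ∈ V A}, fun j => ?_, ?_, ?_, fun j => ?_⟩
  · have : {v | ∃ A, S j A ∧ p v ∈ V A} = ⋃ A : {A // S j A}, p ⁻¹' V A := by ext; simp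
    beta_reduce
    rw [this]
    exact isOpen_iUnion fun A => (hV A).preimage hp.continuous
  · rw [eq_univ_iff_forall]
    intro v
    obtain ⟨A, hA, hAm, hv⟩ := hVc (p v)
    have := Finset.card_pos.2 hA
    exact mem_iUnion.2 ⟨⟨A.card - 1, by omega⟩, A, by simp only [S]; omega, hv⟩
  · rintro j g v ⟨A, hA, hv⟩
    exact ⟨A, hA, by rw [hpg]; exact hv⟩
  · let ζ' : Y → T := fun v => if h : ∃ A, S j A ∧ p v ∈ V A then
      ζ (hne j _ h.choose_spec.1).choose v else Classical.arbitrary T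
    have hex : ∀ A, S j A → ∃ y, ∀ v, p v ∈ V A → v ∈ U y ∧ ζ' v = ζ y v := by
      intro A hA
      refine ⟨(hne j A hA).choose, fun v hv => ⟨?_, ?_⟩⟩
      · exact hpU _ _ (hVU A _ (hne j A hA).choose_spec hv)
      · have h : ∃ A, S j A ∧ p v ∈ V A := ⟨A, hA, hv⟩
        have hAA : h.choose = A := by
          by_contra hcon
          exact Set.disjoint_left.1 (hVd _ _ ((h.choose_spec.1).trans (Eq.symm hA)) hcon)
            h.choose_spec.2 hv
        simp only [ζ', dif_pos h]
        congr 1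
        congr 1
        simp only [hAA]
    refine ⟨ζ', ?_, ?_, ?_⟩
    · rintro v ⟨A, hA, hv⟩
      obtain ⟨y, hy⟩ := hex A hA
      refine ContinuousAt.continuousWithinAt ?_
      refine ((hζ y).continuousAt ((hU y).mem_nhds (hy v hv).1)).congr ?_
      filter_upwards [((hV A).preimage hp.continuous).mem_nhds hv] with w hw
      exact (hy w hw).2.symm
    · rintro g v ⟨A, hA, hv⟩
      obtain ⟨y, hy⟩ := hex A hA
      rw [(hy v hv).2, (hy (g • v) (by rw [hpg]; exact hv)).2]
      exact hζg y g v (hy v hv).1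
    · rintro v ⟨A, hA, hv⟩
      obtain ⟨y, hy⟩ := hex A hA
      rw [(hy v hv).2]
      exact hζπ y v (hy v hv).1

end Glue

end MilnorAux

set_option linter.unusedSectionVars false
set_option linter.unusedSimpArgs false

namespace MilnorAux

open scoped BigOperators Topology unitInterval
open Set

section LocSec

variable {X : Type*} [TopologicalSpace X] {d n : ℕ}

lemma local_sections (hn : 2 ≤ n) (p₀ : X)
    (hX : ∀ x : X, ∃ N : Set X, IsOpen N ∧ x ∈ N ∧ (∃ e : X → Fin d → ℝ, ContinuousOn e N ∧
      InjOn e N) ∧ ∃ c : N × I → X, Continuous c ∧ (∀ v, c (v, 0) = p₀) ∧ ∀ v, c (v, 1) = v)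
    (y : Fin n → X) :
    ∃ B : Set (Fin n → X), IsOpen B ∧ y ∈ B ∧ (∃ e : (Fin n → X) → Fin (n * d) → ℝ,
      ContinuousOn e B ∧ InjOn e B) ∧
      ∃ ζ : (Fin n → X) → C(I, X), ContinuousOn ζ B ∧ ∀ v ∈ B, tcPi X n (ζ v) = v := by
  classical
  choose N hN hxN he hc using hX
  choose e he heinj using he
  choose c hc hc0 hc1 using hc
  let B : Set (Fin n → X) := univ.pi fun i => N (y i)
  have hB : IsOpen B := isOpen_set_pi finite_univ fun i _ => hN (y i)
  refine ⟨B, hB, fun i _ => hxN _, ⟨fun v l => e (y (finProdFinEquiv.symm l).1)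
    (v (finProdFinEquiv.symm l).1) (finProdFinEquiv.symm l).2, ?_, ?_⟩, ?_⟩
  · rw [continuousOn_pi]
    intro l
    have h1 : ContinuousOn (fun v : Fin n → X => e (y (finProdFinEquiv.symm l).1)
        (v (finProdFinEquiv.symm l).1)) B :=
      (he _).comp (continuous_apply _).continuousOn fun v hv => hv _ (mem_univ _)
    exact (continuous_apply _).comp_continuousOn h1
  · intro v hv w hw h
    funext i
    refine heinj (y i) (hv i (mem_univ _)) (hw i (mem_univ _)) ?_
    funext j
    have := congrFun h (finProdFinEquiv (i, j))
    simpa using this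
  · have hn1 : (0 : ℝ) < (n : ℝ) - 1 := by
      have : (2 : ℝ) ≤ n := by exact_mod_cast hn
      linarith
    let τ : I → ℝ := fun t => ((n : ℝ) - 1) * t
    have hτ : Continuous τ := continuous_const.mul continuous_subtype_val
    let q : Fin n → I → I := fun k t => projIcc (0 : ℝ) 1 zero_le_one (1 - 2 * |τ t - k|)
    have hq : ∀ k, Continuous (q k) := fun k => continuous_projIcc.comp
      (continuous_const.sub (continuous_const.mul (hτ.sub continuous_const).abs))
    let P : Fin n → Set (B × I) := fun k => {z | |τ z.2 - k| ≤ 1 / 2}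
    let G : Fin n → B × I → X := fun k z =>
      c (y k) (⟨(z.1 : Fin n → X) k, z.1.2 k (mem_univ _)⟩, q k z.2)
    have hG : ∀ k, Continuous (G k) := by
      intro k
      refine (hc (y k)).comp (Continuous.prodMk ?_ ((hq k).comp continuous_snd))
      exact ((continuous_apply k).comp (continuous_subtype_val.comp continuous_fst)).subtype_mk _
    let g : B × I → X := fun z => if h : ∃ k, z ∈ P k then G h.choose z else p₀
    have hgG : ∀ k, ∀ z ∈ P k, g z = G k z := by
      intro k z hz
      have h : ∃ k, z ∈ P k := ⟨k, hz⟩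
      simp only [g, dif_pos h]
      have hz' := h.choose_spec
      generalize h.choose = k' at hz'
      by_cases hk : k' = k
      · rw [hk]
      · have h1 : |τ z.2 - k| ≤ 1 / 2 := hz
        have h2 : |τ z.2 - k'| ≤ 1 / 2 := hz'
        have h3 : (1 : ℝ) ≤ |(k' : ℝ) - k| := by
          have h4 : (1 : ℤ) ≤ |((k' : ℕ) : ℤ) - ((k : ℕ) : ℤ)| := by
            apply Int.one_le_abs
            intro h0
            apply hk
            apply Fin.ext
            omega
          exact_mod_cast h4
        have h5 : |(k' : ℝ) - k| ≤ |τ z.2 - k| + |τ z.2 - k'| := by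
          rw [show (k' : ℝ) - k = (τ z.2 - k) - (τ z.2 - k') by ring]
          exact abs_sub _ _
        have h6 : |τ z.2 - k| = 1 / 2 := by linarith
        have h7 : |τ z.2 - k'| = 1 / 2 := by linarith
        have q1 : q k z.2 = 0 := by
          simp only [q, h6]
          norm_num
        have q2 : q k' z.2 = 0 := by
          simp only [q, h7]
          norm_num
        simp only [G, q1, q2, hc0]
    have hg : Continuous g := by
      refine (locallyFinite_of_finite P).continuous ?_ ?_ ?_
      · rw [eq_univ_iff_forall]
        intro z
        have ht0 : (0 : ℝ) ≤ z.2 := z.2.2.1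
        have ht1 : (z.2 : ℝ) ≤ 1 := z.2.2.2
        have h0 : 0 ≤ τ z.2 := mul_nonneg hn1.le ht0
        have h1 : τ z.2 ≤ n - 1 := by
          have := mul_le_mul_of_nonneg_left ht1 hn1.le
          simpa [τ] using this
        have hf1 : (⌊τ z.2 + 1 / 2⌋₊ : ℝ) ≤ τ z.2 + 1 / 2 := Nat.floor_le (by linarith)
        have hf2 : τ z.2 + 1 / 2 < (⌊τ z.2 + 1 / 2⌋₊ : ℝ) + 1 := Nat.lt_floor_add_one _
        have hf3 : ⌊τ z.2 + 1 / 2⌋₊ < n := by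
          have : (⌊τ z.2 + 1 / 2⌋₊ : ℝ) < n := by linarith
          exact_mod_cast this
        refine mem_iUnion.2 ⟨⟨_, hf3⟩, ?_⟩
        change |τ z.2 - (⌊τ z.2 + 1 / 2⌋₊ : ℝ)| ≤ 1 / 2
        rw [abs_le]
        constructor <;> linarith
      · intro k
        exact isClosed_le ((hτ.comp continuous_snd).sub continuous_const).abs continuous_const
      · intro k
        exact (hG k).continuousOn.congr (hgG k)
    let S : C(B, C(I, X)) := ContinuousMap.curry ⟨g, hg⟩
    refine ⟨fun v => if h : v ∈ B then S ⟨v, h⟩ else ContinuousMap.const _ p₀, ?_, ?_⟩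
    · rw [continuousOn_iff_continuous_domRestrict]
      refine S.continuous.congr ?_
      intro v
      simp only [Set.domRestrict_apply, dif_pos v.2]
    · intro v hv
      funext i
      simp only [tcPi, dif_pos hv]
      have hi : (i : ℝ) / ((n : ℝ) - 1) ∈ Icc (0 : ℝ) 1 := by
        constructor
        · positivity
        · rw [div_le_one hn1]
          have : ((i : ℕ) : ℝ) + 1 ≤ n := by exact_mod_cast i.2
          linarith
      rw [projIcc_of_mem zero_le_one hi]
      change g (⟨v, hv⟩, ⟨_, hi⟩) = v i
      have hti : τ ⟨_, hi⟩ = i := by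
        simp only [τ]
        field_simp
      have hqi : q i ⟨_, hi⟩ = 1 := by
        simp only [q, hti]
        norm_num
      rw [hgG i]
      · simp only [G, hqi, hc1]
      · change |τ ⟨_, hi⟩ - i| ≤ 1 / 2
        rw [hti]
        norm_num

end LocSec

end MilnorAux

set_option linter.unusedSectionVars false
set_option linter.unusedSimpArgs false

namespace MilnorAux

open scoped BigOperators Topology unitInterval Matrix
open Set

section Charts

variable {r s : ℕ}

/-- Second affine vector. -/
def wB (j : Fin (s + 1)) (b : Fin (s + 1) → ℝ) (τ : ℝ) : Fin (s + 1) → ℝ :=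
  fun k => if k = j then 1 else τ * b k

/-- First affine vector. -/
def wA (h : s + 1 ≤ r + 1) (i : Fin (r + 1)) (j : Fin (s + 1)) (a : Fin (r + 1) → ℝ)
    (b : Fin (s + 1) → ℝ) (τ : ℝ) : Fin (r + 1) → ℝ :=
  fun k => if k = i then 1 else if k = Fin.castLE h j then
    -(∑ l ∈ Finset.univ.erase j,
      (if Fin.castLE h l = i then 1 else τ * a (Fin.castLE h l)) * (τ * b l)) else τ * a k

lemma wB_ne (j : Fin (s + 1)) (b : Fin (s + 1) → ℝ) (τ : ℝ) : wB j b τ ≠ 0 := by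
  intro h
  have := congrFun h j
  simp [wB] at this

lemma wA_ne (h : s + 1 ≤ r + 1) (i : Fin (r + 1)) (j : Fin (s + 1)) (a : Fin (r + 1) → ℝ)
    (b : Fin (s + 1) → ℝ) (τ : ℝ) : wA h i j a b τ ≠ 0 := by
  intro h
  have := congrFun h i
  simp [wA] at this

lemma bil_wA (h : s + 1 ≤ r + 1) {i : Fin (r + 1)} {j : Fin (s + 1)} (hij : i ≠ Fin.castLE h j)
    (a : Fin (r + 1) → ℝ) (b : Fin (s + 1) → ℝ) (τ : ℝ) :
    bil (wA h i j a b τ) (wB j b τ) = 0 := by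
  rw [bil_eq h, ← Finset.add_sum_erase _ _ (Finset.mem_univ j)]
  have h1 : wA h i j a b τ (Fin.castLE h j) * wB j b τ j = -(∑ l ∈ Finset.univ.erase j,
      (if Fin.castLE h l = i then 1 else τ * a (Fin.castLE h l)) * (τ * b l)) := by
    simp only [wA, wB, if_neg hij.symm, if_true, mul_one]
  rw [h1, neg_add_eq_zero]
  apply Finset.sum_congr rfl
  intro l hl
  have hl' : l ≠ j := Finset.ne_of_mem_erase hl
  have hl2 : Fin.castLE h l ≠ Fin.castLE h j := fun e => hl' (Fin.castLE_injective h e)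
  simp only [wA, wB, if_neg hl', if_neg hl2]

/-- Chart parametrization, with contraction parameter. -/
noncomputable def Phi (h : s + 1 ≤ r + 1) {i : Fin (r + 1)} {j : Fin (s + 1)}
    (hij : i ≠ Fin.castLE h j) (a : Fin (r + 1) → ℝ) (b : Fin (s + 1) → ℝ) (τ : ℝ) :
    RealMilnor r s :=
  mkX (wA h i j a b τ) (wB j b τ) (wA_ne _ _ _ _ _ _) (wB_ne _ _ _) (bil_wA h hij a b τ)

lemma continuous_Phi (h : s + 1 ≤ r + 1) {i : Fin (r + 1)} {j : Fin (s + 1)}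
    (hij : i ≠ Fin.castLE h j) {Z : Type*} [TopologicalSpace Z] {a : Z → Fin (r + 1) → ℝ}
    {b : Z → Fin (s + 1) → ℝ} {τ : Z → ℝ} (ha : Continuous a) (hb : Continuous b)
    (hτ : Continuous τ) : Continuous fun z => Phi h hij (a z) (b z) (τ z) := by
  have ha' : ∀ k, Continuous fun z => a z k := fun k => (continuous_apply k).comp ha
  have hb' : ∀ k, Continuous fun z => b z k := fun k => (continuous_apply k).comp hb
  refine continuous_mkX _ _ _ ?_ ?_
  · refine continuous_pi fun k => ?_
    simp only [wA]
    split_ifs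
    · exact continuous_const
    · refine (continuous_finsetSum _ fun l _ => ?_).neg
      refine Continuous.mul ?_ (hτ.mul (hb' _))
      split_ifs
      · exact continuous_const
      · exact hτ.mul (ha' _)
    · exact hτ.mul (ha' _)
  · refine continuous_pi fun k => ?_
    simp only [wB]
    split_ifs
    · exact continuous_const
    · exact hτ.mul (hb' _)

lemma Phi_congr (h : s + 1 ≤ r + 1) {i : Fin (r + 1)} {j : Fin (s + 1)}
    (hij : i ≠ Fin.castLE h j) {a a' : Fin (r + 1) → ℝ} {b b' : Fin (s + 1) → ℝ} (τ : ℝ)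
    (ha : ∀ k, k ≠ i → k ≠ Fin.castLE h j → a k = a' k) (hb : ∀ k, k ≠ j → b k = b' k) :
    Phi h hij a b τ = Phi h hij a' b' τ := by
  have h1 : wB j b τ = wB j b' τ := by
    funext k
    simp only [wB]
    split_ifs with hk
    · rfl
    · rw [hb k hk]
  have h2 : wA h i j a b τ = wA h i j a' b' τ := by
    funext k
    simp only [wA]
    split_ifs with hk hk2
    · rfl
    · congr 1
      apply Finset.sum_congr rfl
      intro l hl
      have hl' : l ≠ j := Finset.ne_of_mem_erase hl
      have hl2 : Fin.castLE h l ≠ Fin.castLE h j := fun e => hl' (Fin.castLE_injective h e)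
      rw [hb l hl']
      split_ifs with hl3
      · rfl
      · rw [ha _ hl3 hl2]
    · rw [ha k hk hk2]
  simp only [Phi, h1, h2]

lemma single_ne {k : ℕ} (i : Fin k) : (Pi.single i (1 : ℝ) : Fin k → ℝ) ≠ 0 := by
  intro h
  have := congrFun h i
  simp at this

lemma bil_single (h : s + 1 ≤ r + 1) {i : Fin (r + 1)} {j : Fin (s + 1)}
    (hij : i ≠ Fin.castLE h j) : bil (Pi.single i (1 : ℝ)) (Pi.single j (1 : ℝ)) = 0 := by
  rw [bil_eq h]
  apply Finset.sum_eq_zero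
  intro l _
  by_cases hl : l = j
  · subst hl
    simp [Pi.single_apply, hij.symm]
  · simp [Pi.single_apply, hl]

/-- Chart centers. -/
noncomputable def pt (h : s + 1 ≤ r + 1) {i : Fin (r + 1)} {j : Fin (s + 1)}
    (hij : i ≠ Fin.castLE h j) : RealMilnor r s :=
  mkX (Pi.single i 1) (Pi.single j 1) (single_ne _) (single_ne _) (bil_single h hij)

lemma Phi_zero (h : s + 1 ≤ r + 1) {i : Fin (r + 1)} {j : Fin (s + 1)}
    (hij : i ≠ Fin.castLE h j) (a : Fin (r + 1) → ℝ) (b : Fin (s + 1) → ℝ) :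
    Phi h hij a b 0 = pt h hij := by
  refine mkX_eq (a := 1) (b := 1) ?_ ?_
  · rw [one_smul]
    funext k
    simp [wA, Pi.single_apply]
  · rw [one_smul]
    funext k
    simp [wB, Pi.single_apply]

/-- Normalized coordinates. -/
noncomputable def nrm {k : ℕ} (i : Fin k) (p : RP k) : Fin k → ℝ := fun l => pm p l i / pm p i i

lemma pm_mk_ne {k : ℕ} {v : Fin k → ℝ} (hv : v ≠ 0) (i : Fin k) :
    pm (Projectivization.mk ℝ v hv) i i ≠ 0 ↔ v i ≠ 0 := by
  rw [pm_mk]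
  have := dot_self_ne hv
  simp [this]

lemma nrm_mk {k : ℕ} {v : Fin k → ℝ} (hv : v ≠ 0) {i : Fin k} (hi : v i ≠ 0) :
    nrm i (Projectivization.mk ℝ v hv) = (v i)⁻¹ • v := by
  funext l
  have := dot_self_ne hv
  simp only [nrm, pm_mk, Pi.smul_apply, smul_eq_mul]
  field_simp

/-- Chart domains. -/
def NN (i : Fin (r + 1)) (j : Fin (s + 1)) : Set (RealMilnor r s) :=
  {x | pm x.1.1 i i ≠ 0 ∧ pm x.1.2 j j ≠ 0}

lemma continuous_pm_fst (k l : Fin (r + 1)) :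
    Continuous fun x : RealMilnor r s => pm x.1.1 k l :=
  (continuous_pm.comp (continuous_fst.comp continuous_subtype_val)).matrix_elem k l

lemma continuous_pm_snd (k l : Fin (s + 1)) :
    Continuous fun x : RealMilnor r s => pm x.1.2 k l :=
  (continuous_pm.comp (continuous_snd.comp continuous_subtype_val)).matrix_elem k l

lemma isOpen_NN (i : Fin (r + 1)) (j : Fin (s + 1)) : IsOpen (NN i j : Set (RealMilnor r s)) :=
  (isOpen_ne_fun (continuous_pm_fst i i) continuous_const).inter
    (isOpen_ne_fun (continuous_pm_snd j j) continuous_const)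

lemma continuousOn_nrm_fst (i : Fin (r + 1)) (j : Fin (s + 1)) :
    ContinuousOn (fun x : RealMilnor r s => nrm i x.1.1) (NN i j) := by
  rw [continuousOn_pi]
  intro l
  exact (continuous_pm_fst l i).continuousOn.div (continuous_pm_fst i i).continuousOn
    fun x hx => hx.1

lemma continuousOn_nrm_snd (i : Fin (r + 1)) (j : Fin (s + 1)) :
    ContinuousOn (fun x : RealMilnor r s => nrm j x.1.2) (NN i j) := by
  rw [continuousOn_pi]
  intro l
  exact (continuous_pm_snd l j).continuousOn.div (continuous_pm_snd j j).continuousOn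
    fun x hx => hx.2

lemma exists_mkX (x : RealMilnor r s) : ∃ v w hv hw h, x = mkX v w hv hw h := by
  obtain ⟨⟨p, q⟩, hx⟩ := x
  induction p using Projectivization.ind with | _ v hv => ?_
  induction q using Projectivization.ind with | _ w hw => ?_
  exact ⟨v, w, hv, hw, (mem_milnor hv hw).1 hx, rfl⟩

lemma mkX_mem_NN {v : Fin (r + 1) → ℝ} {w : Fin (s + 1) → ℝ} {hv : v ≠ 0} {hw : w ≠ 0}
    {h : bil v w = 0} (i : Fin (r + 1)) (j : Fin (s + 1)) :
    mkX v w hv hw h ∈ (NN i j : Set (RealMilnor r s)) ↔ v i ≠ 0 ∧ w j ≠ 0 :=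
  and_congr (pm_mk_ne hv i) (pm_mk_ne hw j)

lemma Phi_one (h : s + 1 ≤ r + 1) {i : Fin (r + 1)} {j : Fin (s + 1)}
    (hij : i ≠ Fin.castLE h j) {x : RealMilnor r s} (hx : x ∈ NN i j) :
    Phi h hij (nrm i x.1.1) (nrm j x.1.2) 1 = x := by
  obtain ⟨v, w, hv, hw, hb, rfl⟩ := exists_mkX x
  obtain ⟨hi, hj⟩ := (mkX_mem_NN i j).1 hx
  have e1 : nrm i (mkX v w hv hw hb).1.1 = (v i)⁻¹ • v := nrm_mk hv hi
  have e2 : nrm j (mkX v w hv hw hb).1.2 = (w j)⁻¹ • w := nrm_mk hw hj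
  rw [e1, e2]
  refine mkX_eq (a := (v i)⁻¹) (b := (w j)⁻¹) ?_ ?_
  · funext k
    simp only [wA, one_mul]
    split_ifs with h1 h2
    · subst h1
      simp [hi]
    · subst h2
      rw [bil_eq h, ← Finset.add_sum_erase _ _ (Finset.mem_univ j)] at hb
      have h3 : ∑ l ∈ Finset.univ.erase j,
          (if Fin.castLE h l = i then 1 else ((v i)⁻¹ • v) (Fin.castLE h l)) * ((w j)⁻¹ • w) l
          = (v i)⁻¹ * (w j)⁻¹ * ∑ l ∈ Finset.univ.erase j, v (Fin.castLE h l) * w l := by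
        rw [Finset.mul_sum]
        apply Finset.sum_congr rfl
        intro l _
        split_ifs with h4
        · rw [h4]
          simp only [Pi.smul_apply, smul_eq_mul]
          field_simp
        · simp only [Pi.smul_apply, smul_eq_mul]
          ring
      rw [h3]
      have h4 : ∑ l ∈ Finset.univ.erase j, v (Fin.castLE h l) * w l = -(v (Fin.castLE h j) * w j) := by
        linarith
      rw [h4]
      simp only [Pi.smul_apply, smul_eq_mul]
      field_simp
    · rfl
  · funext k
    simp only [wB, one_mul]
    split_ifs with h1
    · subst h1
      simp [hj]
    · rfl

lemma exists_NN (h : s + 1 ≤ r + 1) (x : RealMilnor r s) :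
    ∃ (i : Fin (r + 1)) (j : Fin (s + 1)), i ≠ Fin.castLE h j ∧ x ∈ NN i j := by
  obtain ⟨v, w, hv, hw, hb, rfl⟩ := exists_mkX x
  obtain ⟨j, hj⟩ := Function.ne_iff.1 hw
  simp only [Pi.zero_apply] at hj
  by_contra hcon
  push Not at hcon
  have h1 : ∀ i, i ≠ Fin.castLE h j → v i = 0 := by
    intro i hi
    by_contra h0
    exact hcon i j hi ((mkX_mem_NN i j).2 ⟨h0, hj⟩)
  apply hv
  funext k
  by_cases hk : k = Fin.castLE h j
  · rw [bil_eq h, Finset.sum_eq_single j] at hb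
    · rw [hk]
      exact (mul_eq_zero.1 hb).resolve_right hj
    · intro l _ hl
      rw [h1 _ fun e => hl (Fin.castLE_injective h e), zero_mul]
    · simp
  · exact h1 k hk

lemma joined_NN (h : s + 1 ≤ r + 1) {i : Fin (r + 1)} {j : Fin (s + 1)}
    (hij : i ≠ Fin.castLE h j) {x : RealMilnor r s} (hx : x ∈ NN i j) : Joined (pt h hij) x :=
  ⟨⟨⟨fun t => Phi h hij (nrm i x.1.1) (nrm j x.1.2) t,
    continuous_Phi h hij continuous_const continuous_const continuous_subtype_val⟩,
    by simp [Phi_zero], by simp [Phi_one h hij hx]⟩⟩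

lemma bil_add_left (v v' : Fin (r + 1) → ℝ) (w : Fin (s + 1) → ℝ) :
    bil (v + v') w = bil v w + bil v' w := by
  simp only [bil, Pi.add_apply, add_mul, Finset.sum_add_distrib]

lemma bil_add_right (v : Fin (r + 1) → ℝ) (w w' : Fin (s + 1) → ℝ) :
    bil v (w + w') = bil v w + bil v w' := by
  simp only [bil, Pi.add_apply, mul_add, Finset.sum_add_distrib]

lemma two_single {k : ℕ} (i i' : Fin k) :
    (Pi.single i (1 : ℝ) + Pi.single i' (1 : ℝ) : Fin k → ℝ) i ≠ 0 ∧
      (Pi.single i (1 : ℝ) + Pi.single i' (1 : ℝ) : Fin k → ℝ) i' ≠ 0 := by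
  constructor <;> simp only [Pi.add_apply, Pi.single_apply, if_true] <;> split_ifs <;> norm_num

lemma two_single_ne {k : ℕ} (i i' : Fin k) :
    (Pi.single i (1 : ℝ) + Pi.single i' (1 : ℝ) : Fin k → ℝ) ≠ 0 := fun h =>
  (two_single i i').1 (congrFun h i)

lemma joined_left (h : s + 1 ≤ r + 1) {i i' : Fin (r + 1)} {j : Fin (s + 1)}
    (hij : i ≠ Fin.castLE h j) (hij' : i' ≠ Fin.castLE h j) : Joined (pt h hij) (pt h hij') := by
  have hb : bil (Pi.single i (1 : ℝ) + Pi.single i' (1 : ℝ)) (Pi.single j (1 : ℝ)) = 0 := by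
    rw [bil_add_left, bil_single h hij, bil_single h hij', add_zero]
  have hj : (Pi.single j (1 : ℝ) : Fin (s + 1) → ℝ) j ≠ 0 := by simp
  exact (joined_NN h hij ((mkX_mem_NN (hv := two_single_ne i i') (hw := single_ne j) (h := hb) i j).2
    ⟨(two_single i i').1, hj⟩)).trans (joined_NN h hij' ((mkX_mem_NN i' j).2
    ⟨(two_single i i').2, hj⟩)).symm

lemma joined_right (h : s + 1 ≤ r + 1) {i : Fin (r + 1)} {j j' : Fin (s + 1)}
    (hij : i ≠ Fin.castLE h j) (hij' : i ≠ Fin.castLE h j') : Joined (pt h hij) (pt h hij') := by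
  have hb : bil (Pi.single i (1 : ℝ)) (Pi.single j (1 : ℝ) + Pi.single j' (1 : ℝ)) = 0 := by
    rw [bil_add_right, bil_single h hij, bil_single h hij', add_zero]
  have hi : (Pi.single i (1 : ℝ) : Fin (r + 1) → ℝ) i ≠ 0 := by simp
  exact (joined_NN h hij ((mkX_mem_NN (hv := single_ne i) (hw := two_single_ne j j') (h := hb) i j).2
    ⟨hi, (two_single j j').1⟩)).trans (joined_NN h hij' ((mkX_mem_NN i j').2
    ⟨hi, (two_single j j').2⟩)).symm

lemma joined_pt (h : s + 1 ≤ r + 1) (hr : 2 ≤ r) {i i' : Fin (r + 1)} {j j' : Fin (s + 1)}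
    (hij : i ≠ Fin.castLE h j) (hij' : i' ≠ Fin.castLE h j') :
    Joined (pt h hij) (pt h hij') := by
  obtain ⟨k, hk⟩ : ∃ k, k ∉ ({Fin.castLE h j, Fin.castLE h j'} : Finset (Fin (r + 1))) := by
    by_contra hcon
    push Not at hcon
    have h1 := Finset.card_le_card (fun x _ => hcon x : Finset.univ ⊆ _)
    have h2 := Finset.card_le_two (a := Fin.castLE h j) (b := Fin.castLE h j')
    rw [Finset.card_univ, Fintype.card_fin] at h1
    omega
  simp only [Finset.mem_insert, Finset.mem_singleton, not_or] at hk
  exact ((joined_left h hij hk.1).trans (joined_right h hk.1 hk.2)).trans (joined_left h hk.2 hij')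

lemma card_free (h : s + 1 ≤ r + 1) (hr : 2 ≤ r) {i : Fin (r + 1)} {j : Fin (s + 1)}
    (hij : i ≠ Fin.castLE h j) :
    Fintype.card ({k : Fin (r + 1) // k ∉ ({i, Fin.castLE h j} : Finset (Fin (r + 1)))} ⊕
      {k : Fin (s + 1) // k ∉ ({j} : Finset (Fin (s + 1)))}) = s + r - 1 := by
  rw [Fintype.card_sum, Fintype.card_subtype_compl (fun k => k ∈ ({i, Fin.castLE h j} : Finset _)),
    Fintype.card_subtype_compl (fun k => k ∈ ({j} : Finset _))]
  simp only [Fintype.card_fin, Fintype.card_coe, Finset.card_pair hij, Finset.card_singleton]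
  omega

lemma milnor_local (h : s + 1 ≤ r + 1) (hr : 2 ≤ r) (p₀ : RealMilnor r s) (x : RealMilnor r s) :
    ∃ N : Set (RealMilnor r s), IsOpen N ∧ x ∈ N ∧
      (∃ e : RealMilnor r s → Fin (s + r - 1) → ℝ, ContinuousOn e N ∧ InjOn e N) ∧
      ∃ c : N × I → RealMilnor r s, Continuous c ∧ (∀ v, c (v, 0) = p₀) ∧ ∀ v, c (v, 1) = v := by
  obtain ⟨i, j, hij, hx⟩ := exists_NN h x
  refine ⟨NN i j, isOpen_NN i j, hx, ?_, ?_⟩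
  · let E := Fintype.equivFinOfCardEq (card_free h hr hij)
    refine ⟨fun x l => Sum.elim (fun k => nrm i x.1.1 k.1) (fun k => nrm j x.1.2 k.1) (E.symm l),
      ?_, ?_⟩
    · rw [continuousOn_pi]
      intro l
      rcases E.symm l with k | k
      · exact (continuous_apply k.1).comp_continuousOn (continuousOn_nrm_fst i j)
      · exact (continuous_apply k.1).comp_continuousOn (continuousOn_nrm_snd i j)
    · intro x hx y hy hxy
      rw [← Phi_one h hij hx, ← Phi_one h hij hy]
      apply Phi_congr
      · intro k hk hk2
        have := congrFun hxy (E (Sum.inl ⟨k, by simp [hk, hk2]⟩))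
        simpa using this
      · intro k hk
        have := congrFun hxy (E (Sum.inr ⟨k, by simp [hk]⟩))
        simpa using this
  · obtain ⟨i', j', hij', hx'⟩ := exists_NN h p₀
    obtain ⟨γ⟩ : Joined p₀ (pt h hij) :=
      (joined_NN h hij' hx').symm.trans (joined_pt h hr hij' hij)
    refine ⟨fun z => if (z.2 : ℝ) ≤ 1 / 2 then γ.extend (2 * (z.2 : ℝ)) else
      Phi h hij (nrm i z.1.1.1.1) (nrm j z.1.1.1.2) (2 * (z.2 : ℝ) - 1), ?_, ?_, ?_⟩
    · have ht : Continuous fun z : ↥(NN i j : Set (RealMilnor r s)) × I => ((z.2 : I) : ℝ) :=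
        continuous_subtype_val.comp continuous_snd
      refine Continuous.if_le ?_ ?_ ht continuous_const ?_
      · exact γ.continuous_extend.comp (continuous_const.mul ht)
      · refine continuous_Phi h hij ?_ ?_ ((continuous_const.mul ht).sub continuous_const)
        · exact (continuousOn_iff_continuous_domRestrict.1 (continuousOn_nrm_fst i j)).comp
            continuous_fst
        · exact (continuousOn_iff_continuous_domRestrict.1 (continuousOn_nrm_snd i j)).comp
            continuous_fst
      · intro z hz
        rw [hz]
        norm_num
        rw [Phi_zero]
    · intro v
      simp
    · intro v
      have : ¬ ((1 : ℝ) ≤ 1 / 2) := by norm_num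
      simp only [Set.Icc.coe_one, if_neg this]
      norm_num
      exact Phi_one h hij v.2

lemma compact_milnor (r s : ℕ) : CompactSpace (RealMilnor r s) := by
  let K : Set ((Fin (r + 1) → ℝ) × (Fin (s + 1) → ℝ)) :=
    {z | (z.1 ⬝ᵥ z.1 = 1 ∧ z.2 ⬝ᵥ z.2 = 1) ∧ bil z.1 z.2 = 0}
  have hbil : Continuous fun z : (Fin (r + 1) → ℝ) × (Fin (s + 1) → ℝ) => bil z.1 z.2 := by
    unfold bil
    refine continuous_finsetSum _ fun l _ => ?_
    exact ((continuous_apply _).comp continuous_fst).mul ((continuous_apply _).comp continuous_snd)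
  have hKc : IsClosed K := by
    refine ((isClosed_eq ?_ continuous_const).inter (isClosed_eq ?_ continuous_const)).inter
      (isClosed_eq hbil continuous_const)
    · exact continuous_fst.dotProduct continuous_fst
    · exact continuous_snd.dotProduct continuous_snd
  have hbd : ∀ {k : ℕ} (v : Fin k → ℝ), v ⬝ᵥ v = 1 → v ∈ Icc (fun _ => (-1 : ℝ)) (fun _ => 1) := by
    intro k v hv
    have : ∀ i, v i ^ 2 ≤ 1 := by
      intro i
      rw [← hv, sq]
      exact Finset.single_le_sum (f := fun i => v i * v i) (fun i _ => mul_self_nonneg _)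
        (Finset.mem_univ i)
    exact ⟨fun i => (abs_le.1 ((sq_le_one_iff_abs_le_one _).1 (this i))).1,
      fun i => (abs_le.1 ((sq_le_one_iff_abs_le_one _).1 (this i))).2⟩
  have hK : IsCompact K :=
    ((isCompact_Icc (a := fun _ : Fin (r + 1) => (-1 : ℝ)) (b := fun _ => 1)).prod
      (isCompact_Icc (a := fun _ : Fin (s + 1) => (-1 : ℝ)) (b := fun _ => 1))).of_isClosed_subset hKc
      fun z hz => ⟨hbd _ hz.1.1, hbd _ hz.1.2⟩
  have hKs : CompactSpace K := isCompact_iff_compactSpace.1 hK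
  have hne : ∀ {k : ℕ} (v : Fin k → ℝ), v ⬝ᵥ v = 1 → v ≠ 0 := by
    rintro k v hv rfl
    simp at hv
  let f : K → RealMilnor r s := fun z => mkX z.1.1 z.1.2 (hne _ z.2.1.1) (hne _ z.2.1.2) z.2.2
  have hf : Continuous f := continuous_mkX _ _ _ (continuous_fst.comp continuous_subtype_val)
    (continuous_snd.comp continuous_subtype_val)
  have hn : ∀ {k : ℕ} (v : Fin k → ℝ), v ≠ 0 → ∃ a : ℝ, a ≠ 0 ∧ (a • v) ⬝ᵥ (a • v) = 1 := by
    intro k v hv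
    have h0 : 0 < v ⬝ᵥ v := lt_of_le_of_ne
      (Finset.sum_nonneg fun i _ => mul_self_nonneg _) (dot_self_ne hv).symm
    have h1 : √(v ⬝ᵥ v) ≠ 0 := (Real.sqrt_pos.2 h0).ne'
    refine ⟨(√(v ⬝ᵥ v))⁻¹, inv_ne_zero h1, ?_⟩
    rw [smul_dotProduct, dotProduct_smul, smul_eq_mul, smul_eq_mul, ← mul_assoc, ← mul_inv,
      Real.mul_self_sqrt h0.le, inv_mul_cancel₀ h0.ne']
  have hs : Function.Surjective f := by
    intro x
    obtain ⟨v, w, hv, hw, hb, rfl⟩ := exists_mkX x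
    obtain ⟨a, ha, hav⟩ := hn v hv
    obtain ⟨b, hb', hbw⟩ := hn w hw
    exact ⟨⟨(a • v, b • w), ⟨hav, hbw⟩, by simp [bil_smul, hb]⟩, mkX_eq (a := a) (b := b) rfl rfl⟩
  exact ⟨by rw [← hs.range_eq]; exact isCompact_range hf⟩

end Charts

end MilnorAux

set_option linter.unusedSectionVars false
set_option linter.unusedSimpArgs false

namespace MilnorAux

open scoped BigOperators Topology unitInterval
open Set

section Upper

variable {r s n : ℕ}

lemma upper_bound (h : s + 1 ≤ r + 1) (hr : 2 ≤ r) (hn : 2 ≤ n)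
    [MulAction Circle (↥(RealMilnor r s))] [ContinuousSMul Circle (↥(RealMilnor r s))]
    (hfree : ∀ (g : Circle) (x : ↥(RealMilnor r s)), g • x = x → g = 1) :
    eqHigherTC Circle (↥(RealMilnor r s)) n ∈
      {k | 0 < k ∧ ∃ U : Fin k → Set (Fin n → RealMilnor r s),
    (∀ i, IsOpen (U i)) ∧ (⋃ i, U i) = Set.univ ∧
    (∀ i (g : Circle), ∀ v ∈ U i, g • v ∈ U i) ∧
    ∀ i, ∃ sec : C(U i, C(I, RealMilnor r s)),
      (∀ (g : Circle) (v : U i) (hgv : g • (v : Fin n → RealMilnor r s) ∈ U i) (t : I),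
        (sec ⟨g • (v : Fin n → RealMilnor r s), hgv⟩) t = g • (sec v) t) ∧
      ∃ H : C(U i × I, Fin n → RealMilnor r s),
        (∀ v : U i, H (v, 0) = tcPi (RealMilnor r s) n (sec v)) ∧
        (∀ v : U i, H (v, 1) = (v : Fin n → RealMilnor r s)) ∧
        (∀ (g : Circle) (v : U i) (hgv : g • (v : Fin n → RealMilnor r s) ∈ U i) (t : I),
          H (⟨g • (v : Fin n → RealMilnor r s), hgv⟩, t) = g • H (v, t))} ∧
      eqHigherTC Circle (↥(RealMilnor r s)) n ≤ n * (s + r - 1) := by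
  have hcX := compact_milnor r s
  have h01 : (⟨1, by omega⟩ : Fin (r + 1)) ≠ Fin.castLE h 0 := by
    intro e
    have := congrArg Fin.val e
    simp at this
  let p₀ : RealMilnor r s := pt h h01
  have hne : Nonempty C(I, RealMilnor r s) := ⟨ContinuousMap.const _ p₀⟩
  have hfreeY : ∀ (g : Circle) (v : Fin n → RealMilnor r s), g • v = v → g = 1 := fun g v hv =>
    hfree g (v ⟨0, by omega⟩) (congrFun hv ⟨0, by omega⟩)
  obtain ⟨W, hW, hWc, hWg, hWs⟩ := exists_sections (m := n * (s + r - 1)) hfreeY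
    (tcPi (RealMilnor r s) n) (fun g γ => rfl)
    (local_sections hn p₀ (milnor_local h hr p₀))
  have hm : 0 < n * (s + r - 1) := Nat.mul_pos (by omega) (by omega)
  have key : n * (s + r - 1) ∈ {k | 0 < k ∧ ∃ U : Fin k → Set (Fin n → RealMilnor r s),
    (∀ i, IsOpen (U i)) ∧ (⋃ i, U i) = Set.univ ∧
    (∀ i (g : Circle), ∀ v ∈ U i, g • v ∈ U i) ∧
    ∀ i, ∃ sec : C(U i, C(I, RealMilnor r s)),
      (∀ (g : Circle) (v : U i) (hgv : g • (v : Fin n → RealMilnor r s) ∈ U i) (t : I),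
        (sec ⟨g • (v : Fin n → RealMilnor r s), hgv⟩) t = g • (sec v) t) ∧
      ∃ H : C(U i × I, Fin n → RealMilnor r s),
        (∀ v : U i, H (v, 0) = tcPi (RealMilnor r s) n (sec v)) ∧
        (∀ v : U i, H (v, 1) = (v : Fin n → RealMilnor r s)) ∧
        (∀ (g : Circle) (v : U i) (hgv : g • (v : Fin n → RealMilnor r s) ∈ U i) (t : I),
          H (⟨g • (v : Fin n → RealMilnor r s), hgv⟩, t) = g • H (v, t))} := by
    refine ⟨hm, W, hW, hWc, hWg, fun j => ?_⟩
    obtain ⟨f, hf, hfg, hfs⟩ := hWs j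
    refine ⟨⟨fun v => f v, continuousOn_iff_continuous_domRestrict.1 hf⟩, ?_, ⟨fun z => z.1,
      continuous_subtype_val.comp continuous_fst⟩, ?_, ?_, ?_⟩
    · intro g v hgv t
      change f (g • (v : Fin n → RealMilnor r s)) t = g • f v t
      rw [hfg g v v.2]
      rfl
    · intro v
      exact (hfs v v.2).symm
    · intro v
      rfl
    · intro g v hgv t
      rfl
  exact ⟨Nat.sInf_mem ⟨_, key⟩, Nat.sInf_le key⟩

end Upper

end MilnorAux

/-- For odd `0 ≤ s ≤ r` with `r ≥ 2^t`, any free (continuous) circle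
action on `ℝH_{r,s}` satisfies, for `n ≥ 2`:
`n(2^t+s-1) - s + 2 ≤ TC_{S¹,n}(ℝH_{r,s}) ≤ n(s+r-1)`; in particular for `s = 1`,
`r = 2^t+1`: `n·2^t + 1 ≤ TC_{S¹,n}(ℝH_{r,1}) ≤ n(2^t+1)`. -/
theorem eqHigherTC_circle_milnor' (r s n t : ℕ) (hsr : s ≤ r)
    (hrodd : Odd r) (hsodd : Odd s) (ht : 0 < t) (hrt : 2 ^ t ≤ r) (hn : 2 ≤ n)
    [MulAction Circle (↥(RealMilnor r s))]
    [ContinuousSMul Circle (↥(RealMilnor r s))]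
    (hfree : ∀ (g : Circle) (x : ↥(RealMilnor r s)), g • x = x → g = 1) :
    (n * (2 ^ t + s - 1) - s + 2 ≤ eqHigherTC Circle (↥(RealMilnor r s)) n ∧
      eqHigherTC Circle (↥(RealMilnor r s)) n ≤ n * (s + r - 1)) ∧
    (s = 1 → r = 2 ^ t + 1 →
      n * 2 ^ t + 1 ≤ eqHigherTC Circle (↥(RealMilnor r s)) n ∧
      eqHigherTC Circle (↥(RealMilnor r s)) n ≤ n * (2 ^ t + 1)) := by
  have hr3 : 2 ^ t + 1 ≤ r := by
    have h2 : Even (2 ^ t) := (even_two).pow_of_ne_zero ht.ne'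
    rcases hrt.eq_or_lt with h | h
    · rw [← h] at hrodd
      exact absurd hrodd (Nat.not_odd_iff_even.2 h2)
    · exact h
  have hP : 2 ≤ 2 ^ t := by
    calc 2 = 2 ^ 1 := rfl
      _ ≤ 2 ^ t := Nat.pow_le_pow_right (by norm_num) ht
  have h : s + 1 ≤ r + 1 := by omega
  have hr2 : 2 ≤ r := by omega
  have hs1 : 1 ≤ s := hsodd.pos
  obtain ⟨hmem, hle⟩ := MilnorAux.upper_bound h hr2 hn hfree
  have hlow : 2 ^ t - 1 + (n - 1) * (s + 2 ^ t) < eqHigherTC Circle (↥(RealMilnor r s)) n := by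
    obtain ⟨-, U, hU, hcov, -, hsec⟩ := hmem
    refine MilnorAux.lower_bound h t hr3 hn _ U hU hcov fun p a b => ?_
    obtain ⟨sec, -, H, h0, h1, -⟩ := hsec p
    exact MilnorAux.proj_homotopic (U p) sec H h0 h1 a b
  generalize eqHigherTC Circle (↥(RealMilnor r s)) n = K at *
  generalize 2 ^ t = P at *
  obtain ⟨m, rfl⟩ : ∃ m, n = m + 1 := ⟨n - 1, by omega⟩
  obtain ⟨q, rfl⟩ : ∃ q, s = q + 1 := ⟨s - 1, by omega⟩
  have e1 : m + 1 - 1 = m := rfl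
  have e2 : P + (q + 1) - 1 = P + q := by omega
  rw [e1] at hlow
  refine ⟨⟨?_, hle⟩, ?_⟩
  · rw [e2]
    have h3 : m * (q + 1 + P) = m * (P + q) + m := by ring
    have h4 : (m + 1) * (P + q) = m * (P + q) + P + q := by ring
    rw [h3] at hlow
    rw [h4]
    omega
  · intro hs hr
    obtain rfl : q = 0 := by omega
    subst hr
    have h3 : m * (0 + 1 + P) = m * P + m := by ring
    have h4 : (m + 1) * P = m * P + P := by ring
    have h5 : 0 + 1 + (P + 1) - 1 = P + 1 := by omega
    rw [h3] at hlow
    rw [h5] at hle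
    refine ⟨?_, hle⟩
    rw [h4]
    omega
end

section
/- Let s = 2^t + 1 for a positive integer t, let 0 ≤ s ≤ r be integers, and let A_{r,s} = (ℤ/2)[a,b]/⟨a^{s+1}, b^r + a b^{r−1} + ⋯ + a^s b^{r−s}⟩. Then in the tensor square A_{r,s} ⊗_{ℤ/2} A_{r,s} one has (a⊗1 + 1⊗a)^{2s−3} = Σ_{j=0}^{3} a^{s−j} ⊗ a^{s−3+j}, and this element is nonzero. -/
open MvPolynomial
open scoped TensorProduct

noncomputable section

/-- The ideal ⟨a^{s+1}, b^r + a b^{r-1} + ⋯ + a^s b^{r-s}⟩ of `(ℤ/2)[a,b]`,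
with `a = X 0` and `b = X 1`. -/
def milnorIdeal (r s : ℕ) : Ideal (MvPolynomial (Fin 2) (ZMod 2)) :=
  Ideal.span {(X 0 : MvPolynomial (Fin 2) (ZMod 2)) ^ (s + 1),
    ∑ i ∈ Finset.range (s + 1), (X 0 : MvPolynomial (Fin 2) (ZMod 2)) ^ i * (X 1) ^ (r - i)}

/-- The ring `A_{r,s} = (ℤ/2)[a,b]/⟨a^{s+1}, b^r + a b^{r-1} + ⋯ + a^s b^{r-s}⟩`,
the mod-2 cohomology ring of the real Milnor manifold `ℝH_{r,s}`. -/
abbrev MilnorRing (r s : ℕ) : Type :=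
  MvPolynomial (Fin 2) (ZMod 2) ⧸ milnorIdeal r s

/-- The class `a` of `X 0` in `A_{r,s}`. -/
def ma (r s : ℕ) : MilnorRing r s := Ideal.Quotient.mk _ (X 0)

/-- The class `b` of `X 1` in `A_{r,s}`. -/
def mb (r s : ℕ) : MilnorRing r s := Ideal.Quotient.mk _ (X 1)

end

theorem odd_choose_aux (k i : ℕ) (hi : i ≤ 2 ^ k - 1) :
    (((2 ^ k - 1).choose i : ℕ) : ZMod 2) = 1 := by
  induction i with
  | zero => simp
  | succ i ih =>
    have h1 := ih (by omega)
    have hpos : 0 < 2 ^ k := by positivity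
    have h2 : 2 ∣ (2 ^ k).choose (i + 1) :=
      Nat.Prime.dvd_choose_pow Nat.prime_two (by omega) (by omega)
    have h3 : (2 ^ k).choose (i + 1) = (2 ^ k - 1).choose i + (2 ^ k - 1).choose (i + 1) := by
      obtain ⟨m, hm⟩ : ∃ m, 2 ^ k = m + 1 := ⟨2 ^ k - 1, by omega⟩
      rw [hm, Nat.add_sub_cancel, Nat.choose_succ_succ]
    rw [h3, ← ZMod.natCast_eq_zero_iff, Nat.cast_add, h1] at h2
    generalize (((2 ^ k - 1).choose (i + 1) : ℕ) : ZMod 2) = z at h2 ⊢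
    revert z; decide

theorem ma_pow_succ (r s : ℕ) : ma r s ^ (s + 1) = 0 := by
  unfold ma
  rw [← map_pow, Ideal.Quotient.eq_zero_iff_mem]
  exact Ideal.subset_span (by simp)

theorem ma_pow_zero (r s m : ℕ) (h : s < m) : ma r s ^ m = 0 :=
  pow_eq_zero_of_le h (ma_pow_succ r s)

/-- `a ^ s` is nonzero when `s` is odd: send both `a` and `b` to the class of `X`
in `(ℤ/2)[X]/(X^{s+1})`. -/
theorem ma_pow_ne_zero (r s : ℕ) (hsr : s ≤ r) (hodd : 2 ∣ s + 1) : ma r s ^ s ≠ 0 := by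
  intro h
  unfold ma at h
  rw [← map_pow, Ideal.Quotient.eq_zero_iff_mem] at h
  let f : MvPolynomial (Fin 2) (ZMod 2) →ₐ[ZMod 2] Polynomial (ZMod 2) :=
    aeval (fun _ => Polynomial.X)
  have hle : milnorIdeal r s ≤
      (Ideal.span {(Polynomial.X : Polynomial (ZMod 2)) ^ (s + 1)}).comap f := by
    unfold milnorIdeal
    rw [Ideal.span_le]
    rintro p (rfl | rfl)
    · simp only [SetLike.mem_coe, Ideal.mem_comap]
      simp [f, Ideal.mem_span_singleton]
    · simp only [SetLike.mem_coe, Ideal.mem_comap]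
      have : f (∑ i ∈ Finset.range (s + 1),
          (X 0 : MvPolynomial (Fin 2) (ZMod 2)) ^ i * (X 1) ^ (r - i)) = 0 := by
        rw [map_sum]
        rw [Finset.sum_congr rfl (g := fun _ => (Polynomial.X : Polynomial (ZMod 2)) ^ r)]
        · rw [Finset.sum_const, Finset.card_range, nsmul_eq_mul,
            (CharP.cast_eq_zero_iff (Polynomial (ZMod 2)) 2 (s + 1)).2 hodd, zero_mul]
        · intro i hi
          have := Finset.mem_range.1 hi
          simp only [f, map_mul, map_pow, aeval_X]
          rw [← pow_add]
          congr 1; omega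
      rw [this]; exact zero_mem _
  have h' := hle h
  rw [Ideal.mem_comap, Ideal.mem_span_singleton, map_pow, aeval_X,
    pow_dvd_pow_iff Polynomial.X_ne_zero Polynomial.not_isUnit_X] at h'
  omega

theorem tmul_self_ne_zero {A : Type*} [CommRing A] [Algebra (ZMod 2) A] (x : A) (hx : x ≠ 0) :
    x ⊗ₜ[ZMod 2] x ≠ 0 := by
  intro h
  apply hx
  rw [← Module.forall_dual_apply_eq_zero_iff (ZMod 2)]
  intro f
  have := congrArg (fun z => TensorProduct.lid (ZMod 2) (ZMod 2) (TensorProduct.map f f z)) h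
  simpa using this

theorem tensor_pow_general {A : Type*} [CommRing A] [Algebra (ZMod 2) A] (a : A) (s t : ℕ)
    (ht : 0 < t) (hs : s = 2 ^ t + 1) (hz : ∀ m, s < m → a ^ m = 0) (hne : a ^ s ≠ 0) :
    ((a ⊗ₜ[ZMod 2] (1 : A) + (1 : A) ⊗ₜ[ZMod 2] a) ^ (2 * s - 3) =
        ∑ j ∈ Finset.range 4, (a ^ (s - j)) ⊗ₜ[ZMod 2] (a ^ (s - 3 + j))) ∧
      (a ⊗ₜ[ZMod 2] (1 : A) + (1 : A) ⊗ₜ[ZMod 2] a) ^ (2 * s - 3) ≠ 0 := by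
  have h2t : 2 ∣ 2 ^ t := dvd_pow_self 2 (by omega)
  have hpos : 0 < 2 ^ t := by positivity
  have hs3 : 3 ≤ s := by omega
  have key : (a ⊗ₜ[ZMod 2] (1 : A) +
          (1 : A) ⊗ₜ[ZMod 2] a) ^ (2 * s - 3) =
        ∑ j ∈ Finset.range 4, (a ^ (s - j)) ⊗ₜ[ZMod 2] (a ^ (s - 3 + j)) := by
    have hn : 2 * s - 3 = 2 ^ (t + 1) - 1 := by rw [pow_succ]; omega
    rw [add_pow]
    have hterm : ∀ m ∈ Finset.range (2 * s - 3 + 1),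
        (a ⊗ₜ[ZMod 2] (1 : A)) ^ m *
          ((1 : A) ⊗ₜ[ZMod 2] a) ^ (2 * s - 3 - m) *
          (((2 * s - 3).choose m : ℕ) : A ⊗[ZMod 2] A) =
        (a ^ m) ⊗ₜ[ZMod 2] (a ^ (2 * s - 3 - m)) := by
      intro m hm
      have hm' := Finset.mem_range.1 hm
      have hc : (((2 * s - 3).choose m : ℕ) : A ⊗[ZMod 2] A) = 1 := by
        have h := odd_choose_aux (t + 1) m (by omega)
        rw [← hn] at h
        have := congrArg (algebraMap (ZMod 2) (A ⊗[ZMod 2] A)) h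
        rwa [map_natCast, map_one] at this
      rw [hc, mul_one, Algebra.TensorProduct.tmul_pow, Algebra.TensorProduct.tmul_pow,
        Algebra.TensorProduct.tmul_mul_tmul, one_pow, one_pow, one_mul, mul_one]
    rw [Finset.sum_congr rfl hterm]
    symm
    refine Finset.sum_of_injOn (fun j => s - j) ?_ ?_ ?_ ?_
    · intro x hx y hy hxy
      simp only [Finset.coe_range, Set.mem_Iio] at hx hy hxy
      omega
    · intro x hx
      simp only [Finset.coe_range, Set.mem_Iio] at hx ⊢
      omega
    · intro m hm hm2
      have hm' := Finset.mem_range.1 hm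
      by_cases h1 : s < m
      · rw [hz m h1, TensorProduct.zero_tmul]
      · by_cases h2 : s < 2 * s - 3 - m
        · rw [hz _ h2, TensorProduct.tmul_zero]
        · exfalso
          apply hm2
          refine ⟨s - m, ?_, ?_⟩
          · simp only [Finset.coe_range, Set.mem_Iio]; omega
          · show s - (s - m) = m
            omega
    · intro j hj
      have hj' := Finset.mem_range.1 hj
      congr 2
      show s - 3 + j = 2 * s - 3 - (s - j)
      omega
  refine ⟨key, ?_⟩
  rw [key]
  intro h0
  have h := congrArg (fun z => z * ((1 : A) ⊗ₜ[ZMod 2] (a ^ 3))) h0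
  simp only [Finset.sum_range_succ, Finset.sum_range_zero, zero_add, add_mul, zero_mul,
    Algebra.TensorProduct.tmul_mul_tmul, mul_one, ← pow_add] at h
  rw [hz (s - 3 + 1 + 3) (by omega), hz (s - 3 + 2 + 3) (by omega),
    hz (s - 3 + 3 + 3) (by omega)] at h
  simp only [TensorProduct.tmul_zero, add_zero, Nat.sub_zero] at h
  rw [Nat.sub_add_cancel hs3] at h
  exact tmul_self_ne_zero _ hne h

/-- For `s = 2^t + 1` (`t` positive) and `s ≤ r`, in
`A_{r,s} ⊗ A_{r,s}` one has `(a⊗1 + 1⊗a)^{2s-3} = Σ_{j=0}^{3} a^{s-j} ⊗ a^{s-3+j}`,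
and this element is nonzero. -/
theorem milnorRing_tensor_a_pow (r s t : ℕ) (ht : 0 < t) (hs : s = 2 ^ t + 1)
    (hsr : s ≤ r) :
    (((ma r s) ⊗ₜ[ZMod 2] (1 : MilnorRing r s) +
          (1 : MilnorRing r s) ⊗ₜ[ZMod 2] (ma r s)) ^ (2 * s - 3) =
        ∑ j ∈ Finset.range 4, (ma r s ^ (s - j)) ⊗ₜ[ZMod 2] (ma r s ^ (s - 3 + j))) ∧
      ((ma r s) ⊗ₜ[ZMod 2] (1 : MilnorRing r s) +
          (1 : MilnorRing r s) ⊗ₜ[ZMod 2] (ma r s)) ^ (2 * s - 3) ≠ 0 := by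
  have h2t : 2 ∣ 2 ^ t := dvd_pow_self 2 (by omega)
  exact tensor_pow_general (ma r s) s t ht hs (ma_pow_zero r s)
    (ma_pow_ne_zero r s hsr (by omega))
end

section
/- Let r = 2^t for a positive integer t, let 0 ≤ s ≤ r be integers with s ≥ 1, and let A_{r,s} = (ℤ/2)[a,b]/⟨a^{s+1}, b^r + a b^{r−1} + ⋯ + a^s b^{r−s}⟩. Then in the tensor square A_{r,s} ⊗_{ℤ/2} A_{r,s} one has (b⊗1 + 1⊗b)^{2r−1} = b^{r−1} ⊗ b^r + b^r ⊗ b^{r−1}, and this element is nonzero. -/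
open MvPolynomial
open scoped TensorProduct

theorem mb_pow_succ (r s : ℕ) (hsr : s ≤ r) : mb r s ^ (r + 1) = 0 := by
  have h1 : ma r s ^ (s + 1) = 0 := by
    unfold ma
    rw [← map_pow]
    exact Ideal.Quotient.eq_zero_iff_mem.2 (Ideal.subset_span (by simp))
  have h2 : ∑ i ∈ Finset.range (s + 1), ma r s ^ i * mb r s ^ (r - i) = 0 := by
    unfold ma mb
    simp only [← map_pow, ← map_mul, ← map_sum]
    exact Ideal.Quotient.eq_zero_iff_mem.2 (Ideal.subset_span (by simp))
  have key : ∀ n, n ≤ r → (mb r s - ma r s) *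
      ∑ i ∈ Finset.range (n + 1), ma r s ^ i * mb r s ^ (r - i)
      = mb r s ^ (r + 1) - ma r s ^ (n + 1) * mb r s ^ (r - n) := by
    intro n
    induction n with
    | zero => intro _; simp; ring
    | succ n ih =>
      intro h
      rw [Finset.sum_range_succ, mul_add, ih (by omega)]
      obtain ⟨k, rfl⟩ : ∃ k, r = k + (n + 1) := ⟨r - (n + 1), by omega⟩
      rw [show k + (n + 1) - n = k + 1 by omega, show k + (n + 1) - (n + 1) = k by omega]
      ring
  have := key s hsr
  rw [h2, h1] at this
  simpa using this.symm

theorem add_pow_aux {R : Type*} [CommRing R] (x y : R) (r n : ℕ) (hx : x ^ (r + 1) = 0) :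
    x ^ r * (x + y) ^ n = x ^ r * y ^ n := by
  induction n with
  | zero => simp
  | succ n ih =>
    rw [pow_succ, ← mul_assoc, ih]
    linear_combination y ^ n * hx

theorem add_pow_two_pow {R : Type*} [CommRing R] [Algebra (ZMod 2) R] (r t : ℕ) (hr : r = 2 ^ t)
    (hr1 : 1 ≤ r) (x y : R) (hx : x ^ (r + 1) = 0) (hy : y ^ (r + 1) = 0) :
    (x + y) ^ (2 * r - 1) = y ^ r * x ^ (r - 1) + x ^ r * y ^ (r - 1) := by
  have h2 : (2 : R) = 0 := by
    have := map_ofNat (algebraMap (ZMod 2) R) 2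
    rw [← this, show (OfNat.ofNat 2 : ZMod 2) = 0 from rfl, map_zero]
  have fr : (x + y) ^ r = x ^ r + y ^ r := by
    rw [hr]
    clear * - h2
    induction t with
    | zero => simp
    | succ t ih =>
      rw [pow_succ, pow_mul, ih, pow_mul, pow_mul]
      linear_combination x ^ 2 ^ t * y ^ 2 ^ t * h2
  rw [show 2 * r - 1 = r + (r - 1) by omega, pow_add, fr, add_mul,
    add_pow_aux x y r (r - 1) hx, add_comm x y, add_pow_aux y x r (r - 1) hy, add_comm]

theorem tensor_aux {A : Type*} [CommRing A] [Algebra (ZMod 2) A] (r t : ℕ) (hr : r = 2 ^ t)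
    (hr1 : 1 ≤ r) (b : A) (hb : b ^ (r + 1) = 0) :
    (b ⊗ₜ[ZMod 2] (1 : A) + (1 : A) ⊗ₜ[ZMod 2] b) ^ (2 * r - 1) =
      (b ^ (r - 1)) ⊗ₜ[ZMod 2] (b ^ r) + (b ^ r) ⊗ₜ[ZMod 2] (b ^ (r - 1)) := by
  have hx : (b ⊗ₜ[ZMod 2] (1 : A)) ^ (r + 1) = 0 := by
    rw [Algebra.TensorProduct.tmul_pow, hb, TensorProduct.zero_tmul]
  have hy : ((1 : A) ⊗ₜ[ZMod 2] b) ^ (r + 1) = 0 := by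
    rw [Algebra.TensorProduct.tmul_pow, hb, TensorProduct.tmul_zero]
  have e1 : (b ^ (r - 1)) ⊗ₜ[ZMod 2] (b ^ r) =
      ((1 : A) ⊗ₜ[ZMod 2] b) ^ r *
      (b ⊗ₜ[ZMod 2] (1 : A)) ^ (r - 1) := by
    simp [Algebra.TensorProduct.tmul_pow]
  have e2 : (b ^ r) ⊗ₜ[ZMod 2] (b ^ (r - 1)) =
      (b ⊗ₜ[ZMod 2] (1 : A)) ^ r *
      ((1 : A) ⊗ₜ[ZMod 2] b) ^ (r - 1) := by
    simp [Algebra.TensorProduct.tmul_pow]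
  rw [e1, e2]
  exact add_pow_two_pow (R := A ⊗[ZMod 2] A) r t hr hr1 _ _ hx hy

theorem coeff_aux (p : MvPolynomial (Fin 2) (ZMod 2)) (c d i j : ℕ) :
    coeff (Finsupp.single 0 c + Finsupp.single 1 d) (p * (X 0 ^ i * X 1 ^ j)) =
      if i ≤ c ∧ j ≤ d then
        coeff (Finsupp.single 0 (c - i) + Finsupp.single 1 (d - j)) p else 0 := by
  have h : (X 0 ^ i * X 1 ^ j : MvPolynomial (Fin 2) (ZMod 2)) =
      monomial (Finsupp.single 0 i + Finsupp.single 1 j) 1 := by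
    rw [X_pow_eq_monomial, X_pow_eq_monomial, monomial_mul, one_mul]
  rw [h, coeff_mul_monomial', mul_one]
  have e : (Finsupp.single 0 i + Finsupp.single 1 j : Fin 2 →₀ ℕ) ≤
      Finsupp.single 0 c + Finsupp.single 1 d ↔ i ≤ c ∧ j ≤ d := by
    rw [Finsupp.le_def]
    simp [Fin.forall_fin_two]
  have e2 : (Finsupp.single 0 c + Finsupp.single 1 d : Fin 2 →₀ ℕ) -
      (Finsupp.single 0 i + Finsupp.single 1 j) =
      Finsupp.single 0 (c - i) + Finsupp.single 1 (d - j) := by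
    ext k
    fin_cases k <;> simp
  simp only [e, e2]

theorem coeff_X1 (c d n : ℕ) :
    coeff (Finsupp.single 0 c + Finsupp.single 1 d)
      (X 1 ^ n : MvPolynomial (Fin 2) (ZMod 2)) = if c = 0 ∧ d = n then 1 else 0 := by
  rw [X_pow_eq_monomial, coeff_monomial]
  congr 1
  rw [Finsupp.ext_iff]
  simp [Fin.forall_fin_two, eq_comm]

theorem exists_functional (r s : ℕ) (F : MvPolynomial (Fin 2) (ZMod 2) →+ ZMod 2)
    (h1 : ∀ p, F (p * X 0 ^ (s + 1)) = 0)
    (h2 : ∀ p, F (p * ∑ i ∈ Finset.range (s + 1), X 0 ^ i * X 1 ^ (r - i)) = 0) :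
    ∃ f : MilnorRing r s →ₗ[ZMod 2] ZMod 2, ∀ n, f (mb r s ^ n) = F (X 1 ^ n) := by
  let f : MilnorRing r s →+ ZMod 2 := QuotientAddGroup.lift (milnorIdeal r s).toAddSubgroup F (by
    intro x hx
    obtain ⟨u, v, rfl⟩ := Ideal.mem_span_pair.1 (show x ∈ milnorIdeal r s from hx)
    rw [AddMonoidHom.mem_ker, map_add, h1, h2, add_zero])
  refine ⟨f.toZModLinearMap 2, fun n => ?_⟩
  unfold mb
  rw [← map_pow]
  rfl

/-- For `r = 2^t` (`t` positive) and `1 ≤ s ≤ r`, in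
`A_{r,s} ⊗ A_{r,s}` one has `(b⊗1 + 1⊗b)^{2r-1} = b^{r-1} ⊗ b^r + b^r ⊗ b^{r-1}`,
and this element is nonzero. -/
theorem milnorRing_tensor_b_pow (r s t : ℕ) (ht : 0 < t) (hr : r = 2 ^ t)
    (hs1 : 1 ≤ s) (hsr : s ≤ r) :
    (((mb r s) ⊗ₜ[ZMod 2] (1 : MilnorRing r s) +
          (1 : MilnorRing r s) ⊗ₜ[ZMod 2] (mb r s)) ^ (2 * r - 1) =
        (mb r s ^ (r - 1)) ⊗ₜ[ZMod 2] (mb r s ^ r) +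
          (mb r s ^ r) ⊗ₜ[ZMod 2] (mb r s ^ (r - 1))) ∧
      ((mb r s) ⊗ₜ[ZMod 2] (1 : MilnorRing r s) +
          (1 : MilnorRing r s) ⊗ₜ[ZMod 2] (mb r s)) ^ (2 * r - 1) ≠ 0 := by
  have hr2 : 2 ≤ r := by
    rw [hr]; exact Nat.le_self_pow ht.ne' 2
  have hb := mb_pow_succ r s hsr
  have main : ((mb r s) ⊗ₜ[ZMod 2] (1 : MilnorRing r s) +
          (1 : MilnorRing r s) ⊗ₜ[ZMod 2] (mb r s)) ^ (2 * r - 1) =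
        (mb r s ^ (r - 1)) ⊗ₜ[ZMod 2] (mb r s ^ r) +
          (mb r s ^ r) ⊗ₜ[ZMod 2] (mb r s ^ (r - 1)) := 
    tensor_aux r t hr (by omega) _ hb
  refine ⟨main, ?_⟩
  rw [main]
  obtain ⟨k, rfl⟩ : ∃ k, s = k + 1 := ⟨s - 1, by omega⟩
  have hX : ∀ p : MvPolynomial (Fin 2) (ZMod 2),
      p * X 0 ^ (k + 1 + 1) = p * (X 0 ^ (k + 1 + 1) * X 1 ^ 0) := by
    intro p; simp
  obtain ⟨f, hf⟩ := exists_functional r (k + 1)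
    (lcoeff (ZMod 2) (Finsupp.single 0 0 + Finsupp.single 1 (r - 1))).toAddMonoidHom
    (by
      intro p
      rw [hX]
      simp only [LinearMap.toAddMonoidHom_coe, lcoeff_apply]
      rw [coeff_aux, if_neg (by omega)])
    (by
      intro p
      simp only [LinearMap.toAddMonoidHom_coe, lcoeff_apply]
      rw [Finset.mul_sum, coeff_sum]
      refine Finset.sum_eq_zero fun i _ => ?_
      rw [coeff_aux, if_neg (by omega)])
  obtain ⟨g, hg⟩ := exists_functional r (k + 1)
    (lcoeff (σ := Fin 2) (ZMod 2) (Finsupp.single 0 0 + Finsupp.single 1 r) +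
      lcoeff (σ := Fin 2) (ZMod 2) (Finsupp.single 0 1 + Finsupp.single 1 (r - 1))).toAddMonoidHom
    (by
      intro p
      rw [hX]
      simp only [LinearMap.toAddMonoidHom_coe, LinearMap.add_apply, lcoeff_apply]
      rw [coeff_aux, coeff_aux, if_neg (by omega), if_neg (by omega), add_zero])
    (by
      intro p
      simp only [LinearMap.toAddMonoidHom_coe, LinearMap.add_apply, lcoeff_apply]
      rw [Finset.mul_sum, coeff_sum, coeff_sum, Finset.sum_eq_single 0,
        Finset.sum_eq_single 1, coeff_aux, coeff_aux, if_pos (by omega), if_pos (by omega)]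
      · simp [CharTwo.add_self_eq_zero]
      · intro i _ hi
        rw [coeff_aux, if_neg (by omega)]
      · intro h; simp at h
      · intro i _ hi
        rw [coeff_aux, if_neg (by omega)]
      · intro h; simp at h)
  intro h0
  have h3 := congrArg (TensorProduct.lid (ZMod 2) (ZMod 2)) (congrArg (TensorProduct.map f g) h0)
  simp only [map_add, TensorProduct.map_tmul, hf, hg, map_zero,
    LinearMap.toAddMonoidHom_coe, LinearMap.add_apply, lcoeff_apply, coeff_X1,
    TensorProduct.lid_tmul] at h3
  have n1 : r ≠ r - 1 := by omega
  simp [n1, n1.symm] at h3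
end
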